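/- If α ≠ pβ, then: B(α)/L(α) ≠ 0 if and only if π(α) contains a GL₂(ℚ_p)-stable 𝒪_L-lattice, and B(β)/L(β) ≠ 0 if and only if π(β) contains a GL₂(ℚ_p)-stable 𝒪_L-lattice. If α = pβ, then B(α)/L(α) ≠ 0 if and only if π(α) contains a GL₂(ℚ_p)-stable 𝒪_L-lattice. -/

import Mathlib

open Filter Topology Classical

noncomputable section

namespace Paper

variable (p : ℕ) [Fact p.Prime]
variable (L : Type) [NontriviallyNormedField L] [NormedAlgebra ℚ_[p] L]

/-- The canonical embedding `ℚ_p → L`. -/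
noncomputable def iotaL : ℚ_[p] → L := algebraMap ℚ_[p] L

/-- The binomial coefficient `binom(z, n) = z(z-1)⋯(z-n+1)/n!` of a `p`-adic
integer, computed in `ℚ_p`. -/
noncomputable def binomQ (z : ℤ_[p]) (n : ℕ) : ℚ_[p] :=
  (∏ i ∈ Finset.range n, ((z : ℚ_[p]) - (i : ℚ_[p]))) / (n.factorial : ℚ_[p])

/-- The Mahler coefficients `a_n(f) = ∑_{i=0}^n (-1)^i binom(n,i) f(n-i)`. -/
noncomputable def mahlerCoeff (f : ℤ_[p] → L) (n : ℕ) : L :=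
  ∑ i ∈ Finset.range (n + 1), (-1 : L) ^ i * (n.choose i : L) * f (((n - i : ℕ) : ℤ_[p]))

/-- `f : ℤ_p → L` is of class `C^r` : the scaled Mahler coefficients
`n^r a_n(f)` tend to `0`, and `f` is the sum of its Mahler expansion. -/
def IsCr (r : ℝ) (f : ℤ_[p] → L) : Prop :=
  Tendsto (fun n : ℕ => (n : ℝ) ^ r * ‖mahlerCoeff p L f n‖) atTop (nhds 0) ∧
  ∀ z : ℤ_[p], HasSum (fun n : ℕ => mahlerCoeff p L f n * iotaL p L (binomQ p z n)) (f z)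

/-- The norm `‖f‖_r = sup_n (n+1)^r ‖a_n(f)‖` on `C^r(ℤ_p, L)`. -/
noncomputable def crNorm (r : ℝ) (f : ℤ_[p] → L) : ℝ :=
  ⨆ n : ℕ, ((n : ℝ) + 1) ^ r * ‖mahlerCoeff p L f n‖

/-- A continuous (= bounded) linear functional on `C^r(ℤ_p, L)`, i.e. a tempered
distribution of order `r`. -/
structure CrDual (r : ℝ) where
  toFun : (ℤ_[p] → L) → L
  map_add' : ∀ f g : ℤ_[p] → L, IsCr p L r f → IsCr p L r g →
    toFun (f + g) = toFun f + toFun g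
  map_smul' : ∀ (c : L) (f : ℤ_[p] → L), IsCr p L r f → toFun (c • f) = c * toFun f
  bound' : ∃ C : ℝ, ∀ f : ℤ_[p] → L, IsCr p L r f → ‖toFun f‖ ≤ C * crNorm p L r f

/-- The function `z ↦ 1_{a + pⁿℤ_p}(z) (z - a)^j`. -/
noncomputable def indPoly (a : ℤ_[p]) (n : ℕ) (j : ℕ) : ℤ_[p] → L := fun z =>
  if ‖z - a‖ ≤ (p : ℝ) ^ (-(n : ℤ)) then (iotaL p L ((z : ℚ_[p]) - (a : ℚ_[p]))) ^ j else 0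

/-- The norm `‖μ‖_{r,d} = sup_{a, 0 ≤ j ≤ d, n} p^{n(j-r)} ‖∫_{a+pⁿℤ_p} (z-a)^j dμ‖`. -/
noncomputable def dualNormRD (r : ℝ) (d : ℕ) (μ : CrDual p L r) : ℝ :=
  ⨆ (a : ℤ_[p]) (j : Fin (d + 1)) (n : ℕ),
    (p : ℝ) ^ ((n : ℝ) * (((j : ℕ) : ℝ) - r)) * ‖μ.toFun (indPoly p L a n j)‖

/-- `f : ℤ_p → L` is locally polynomial of local degree at most `d`. -/
def IsLocPoly (d : ℕ) (f : ℤ_[p] → L) : Prop :=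
  ∃ n : ℕ, ∀ a : ℤ_[p], ∃ P : Polynomial L, P.natDegree ≤ d ∧
    ∀ z : ℤ_[p], ‖z - a‖ ≤ (p : ℝ) ^ (-(n : ℤ)) → f z = Polynomial.eval (iotaL p L (z : ℚ_[p])) P

/-- A linear functional on `Pol^d(ℤ_p, L)`. -/
structure PolDual (d : ℕ) where
  toFun : (ℤ_[p] → L) → L
  map_add' : ∀ f g : ℤ_[p] → L, IsLocPoly p L d f → IsLocPoly p L d g →
    toFun (f + g) = toFun f + toFun g
  map_smul' : ∀ (c : L) (f : ℤ_[p] → L), IsLocPoly p L d f → toFun (c • f) = c * toFun f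

/-- The valuation `val(x) = -log_p ‖x‖` on `L`, normalized by `val(p) = 1`. -/
noncomputable def valL (x : L) : ℝ := -Real.logb p ‖x‖

/-- `g : ℤ_p → L` is a class-`C^{val α}` extension of
`z ↦ (αp/β)^{val z} z^{k-2} f(1/z)` from `ℤ_p ∖ {0}` to `ℤ_p`. -/
def Ext2 (k : ℕ) (α β : L) (f : ℚ_[p] → L) (g : ℤ_[p] → L) : Prop :=
  IsCr p L (valL p L α) g ∧ ∀ z : ℤ_[p], z ≠ 0 →
    g z = (α * (p : L) / β) ^ ((z : ℚ_[p]).valuation) *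
      (iotaL p L (z : ℚ_[p])) ^ (k - 2) * f (((z : ℚ_[p]))⁻¹)

/-- Membership in the Banach space `B(α)`. -/
def MemB (k : ℕ) (α β : L) (f : ℚ_[p] → L) : Prop :=
  IsCr p L (valL p L α) (fun z : ℤ_[p] => f ((p : ℚ_[p]) * (z : ℚ_[p]))) ∧
  ∃ g : ℤ_[p] → L, Ext2 p L k α β f g

/-- The extension `f₂` of `z ↦ (αp/β)^{val z} z^{k-2} f(1/z)` to `ℤ_p`
(it is unique when it exists). -/
noncomputable def ext2 (k : ℕ) (α β : L) (f : ℚ_[p] → L) : ℤ_[p] → L :=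
  if h : ∃ g : ℤ_[p] → L, Ext2 p L k α β f g then h.choose else 0

/-- The norm `‖f‖ = max(‖f₁‖_{val α}, ‖f₂‖_{val α})` on `B(α)`. -/
noncomputable def bNorm (k : ℕ) (α β : L) (f : ℚ_[p] → L) : ℝ :=
  max (crNorm p L (valL p L α) (fun z : ℤ_[p] => f ((p : ℚ_[p]) * (z : ℚ_[p]))))
      (crNorm p L (valL p L α) (ext2 p L k α β f))

/-- Determinant of a 2×2 matrix. -/
noncomputable def det2 (m : Matrix (Fin 2) (Fin 2) ℚ_[p]) : ℚ_[p] :=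
  m 0 0 * m 1 1 - m 0 1 * m 1 0

/-- The action of `g = (a b; c d) ∈ GL₂(ℚ_p)` on `B(α)`:
`(g·f)(z) = α^{-val(ad-bc)} (αp/β)^{val(-cz+a)} (-cz+a)^{k-2} f((dz-b)/(-cz+a))`,
the value at the pole `-cz+a = 0` being the one prescribed by the extension `f₂`. -/
noncomputable def gAct (k : ℕ) (α β : L) (m : Matrix (Fin 2) (Fin 2) ℚ_[p])
    (f : ℚ_[p] → L) : ℚ_[p] → L := fun z =>
  if -(m 1 0) * z + m 0 0 = 0 then
    α ^ (-(det2 p m).valuation) * (α * (p : L) / β) ^ ((det2 p m / m 1 0).valuation) *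
      (iotaL p L (det2 p m / m 1 0)) ^ (k - 2) * ext2 p L k α β f 0
  else
    α ^ (-(det2 p m).valuation) * (α * (p : L) / β) ^ ((-(m 1 0) * z + m 0 0).valuation) *
      (iotaL p L (-(m 1 0) * z + m 0 0)) ^ (k - 2) *
      f ((m 1 1 * z - m 0 1) / (-(m 1 0) * z + m 0 0))

/-- The monomial function `z ↦ z^j` on `ℚ_p`. -/
noncomputable def monomialFun (j : ℕ) : ℚ_[p] → L := fun z => (iotaL p L z) ^ j

/-- The function `z ↦ (αp/β)^{val(z-a)} (z-a)^{k-2-j}` (extended by `0` at `z = a`). -/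
noncomputable def specFun (k : ℕ) (α β : L) (a : ℚ_[p]) (j : ℕ) : ℚ_[p] → L := fun z =>
  if z = a then 0 else
    (α * (p : L) / β) ^ ((z - a).valuation) * (iotaL p L (z - a)) ^ (k - 2 - j)

/-- The generators of `L(α)` : the functions `z^j` and
`(αp/β)^{val(z-a)}(z-a)^{k-2-j}` for `0 ≤ j < val(α)` and `a ∈ ℚ_p`. -/
def lGen (k : ℕ) (α β : L) : Set (ℚ_[p] → L) :=
  {f | ∃ j : ℕ, (j : ℝ) < valL p L α ∧
    (f = monomialFun p L j ∨ ∃ a : ℚ_[p], f = specFun p L k α β a j)}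

/-- Membership in `L(α)`, the closure in `B(α)` of the span of the special
functions. -/
def MemLalpha (k : ℕ) (α β : L) (f : ℚ_[p] → L) : Prop :=
  MemB p L k α β f ∧ ∀ ε : ℝ, 0 < ε →
    ∃ g ∈ Submodule.span L (lGen p L k α β), bNorm p L k α β (f - g) < ε

/-- The quotient (semi)norm on `Π(V) = B(α)/L(α)`. -/
noncomputable def qNorm (k : ℕ) (α β : L) (f : ℚ_[p] → L) : ℝ :=
  sInf {x : ℝ | ∃ g : ℚ_[p] → L, MemLalpha p L k α β g ∧ x = bNorm p L k α β (f - g)}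

/-- `h : ℚ_p → L` is locally constant. -/
def LocConst (h : ℚ_[p] → L) : Prop :=
  ∀ x : ℚ_[p], ∃ n : ℕ, ∀ y : ℚ_[p], ‖y - x‖ ≤ (p : ℝ) ^ (-(n : ℤ)) → h y = h x

/-- `h` belongs to the smooth induced representation: `h` is locally constant and
`z ↦ (αp/β)^{val z} h(1/z)` extends to a locally constant function on `ℚ_p`. -/
def IndCond (α β : L) (h : ℚ_[p] → L) : Prop :=
  LocConst p L h ∧ ∃ h' : ℚ_[p] → L, LocConst p L h' ∧
    ∀ z : ℚ_[p], z ≠ 0 → h' z = (α * (p : L) / β) ^ z.valuation * h z⁻¹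

/-- The generators `z ↦ P(z) h(z)` of the locally algebraic representation `π(α)`. -/
def piGen (k : ℕ) (α β : L) : Set (ℚ_[p] → L) :=
  {f | ∃ (P : Polynomial L) (h : ℚ_[p] → L), P.natDegree ≤ k - 2 ∧ IndCond p L α β h ∧
    f = fun z => Polynomial.eval (iotaL p L z) P * h z}

/-- The locally algebraic representation `π(α)`, as a subspace of functions
`ℚ_p → L`. -/
noncomputable def piRep (k : ℕ) (α β : L) : Submodule L (ℚ_[p] → L) :=
  Submodule.span L (piGen p L k α β)

/-- The standing hypotheses on `(k, α, β)` coming from an absolutely irreducible,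
`φ`-semisimple crystalline representation: `k ≥ 2`, `α ≠ β`,
`0 < val(β) ≤ val(α)` and `val(α) + val(β) = k - 1`. -/
def Hyps (k : ℕ) (α β : L) : Prop :=
  2 ≤ k ∧ α ≠ β ∧ 0 < valL p L α ∧ 0 < valL p L β ∧
    valL p L α + valL p L β = (k : ℝ) - 1 ∧ valL p L β ≤ valL p L α

/-- `Λ` is a `GL₂(ℚ_p)`-stable `𝒪_L`-lattice in `π(α)`: an `𝒪_L`-submodule of
`π(α)` generating it over `L`, containing no `L`-line and stable by the action. -/
def IsLatticeStable (k : ℕ) (α β : L) (Λ : Set (ℚ_[p] → L)) : Prop :=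
  (∀ f ∈ Λ, f ∈ piRep p L k α β) ∧ ((0 : ℚ_[p] → L) ∈ Λ) ∧
  (∀ f ∈ Λ, ∀ g ∈ Λ, f + g ∈ Λ) ∧
  (∀ c : L, ‖c‖ ≤ 1 → ∀ f ∈ Λ, c • f ∈ Λ) ∧
  (∀ f ∈ piRep p L k α β, ∃ c : L, c ≠ 0 ∧ c • f ∈ Λ) ∧
  (∀ f, f ∈ piRep p L k α β → f ≠ 0 → ¬ ∀ c : L, c • f ∈ Λ) ∧
  (∀ m : Matrix (Fin 2) (Fin 2) ℚ_[p], det2 p m ≠ 0 → ∀ f ∈ Λ, gAct p L k α β m f ∈ Λ)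

section ProofOfStatement

set_option linter.unusedSectionVars false
set_option linter.unusedSimpArgs false
variable {p L}

lemma norm_iotaL (x : ℚ_[p]) : ‖iotaL p L x‖ = ‖x‖ := norm_algebraMap' L x

lemma norm_natCast_p : ‖(p : L)‖ = (p : ℝ)⁻¹ := by
  have := norm_iotaL (L := L) (p : ℚ_[p])
  simpa [iotaL] using this

lemma p_pos : (0 : ℝ) < p := by exact_mod_cast (Fact.out : p.Prime).pos

lemma one_lt_p : (1 : ℝ) < p := by exact_mod_cast (Fact.out : p.Prime).one_lt

lemma mahlerCoeff_eq_fwdDiff (f : ℤ_[p] → L) (n : ℕ) :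
    mahlerCoeff p L f n = (fwdDiff 1)^[n] f 0 := by
  rw [fwdDiff_iter_eq_sum_shift, mahlerCoeff, ← Finset.sum_range_reflect]
  refine Finset.sum_congr rfl fun i hi => ?_
  have hi' : i ≤ n := by simpa [Nat.lt_succ_iff] using hi
  have h1 : n + 1 - 1 - i = n - i := by omega
  have h2 : n - (n - i) = i := by omega
  simp [h1, h2, Nat.choose_symm hi', zsmul_eq_mul]

lemma mahlerCoeff_add (f g : ℤ_[p] → L) (n : ℕ) :
    mahlerCoeff p L (f + g) n = mahlerCoeff p L f n + mahlerCoeff p L g n := by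
  simp [mahlerCoeff, mul_add, Finset.sum_add_distrib]

lemma mahlerCoeff_sub (f g : ℤ_[p] → L) (n : ℕ) :
    mahlerCoeff p L (f - g) n = mahlerCoeff p L f n - mahlerCoeff p L g n := by
  simp [mahlerCoeff, mul_sub, Finset.sum_sub_distrib]

lemma mahlerCoeff_smul (c : L) (f : ℤ_[p] → L) (n : ℕ) :
    mahlerCoeff p L (c • f) n = c * mahlerCoeff p L f n := by
  simp only [mahlerCoeff, Pi.smul_apply, smul_eq_mul, Finset.mul_sum]
  exact Finset.sum_congr rfl fun i _ => by ring

lemma tendsto_mahlerCoeff {ι : Type*} {l : Filter ι} {g : ι → ℤ_[p] → L} {f : ℤ_[p] → L}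
    (h : ∀ z, Tendsto (fun i => g i z) l (𝓝 (f z))) (n : ℕ) :
    Tendsto (fun i => mahlerCoeff p L (g i) n) l (𝓝 (mahlerCoeff p L f n)) :=
  tendsto_finsetSum _ fun _ _ => (h _).const_mul _

/-- `f` is a polynomial of degree at most `d` on each ball of radius `p^{-N}`. -/
def LPn (d N : ℕ) (f : ℤ_[p] → L) : Prop :=
  ∀ a : ℤ_[p], ∃ P : Polynomial L, P.natDegree ≤ d ∧
    ∀ z : ℤ_[p], ‖z - a‖ ≤ (p : ℝ) ^ (-(N : ℤ)) → f z = P.eval (iotaL p L (z : ℚ_[p]))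

lemma LPn.zero (d N : ℕ) : LPn d N (0 : ℤ_[p] → L) := fun _ => ⟨0, by simp, by simp⟩

lemma LPn.add {d N : ℕ} {f g : ℤ_[p] → L} (hf : LPn d N f) (hg : LPn d N g) :
    LPn d N (f + g) := by
  intro a
  obtain ⟨P, hP, hP'⟩ := hf a
  obtain ⟨Q, hQ, hQ'⟩ := hg a
  exact ⟨P + Q, (Polynomial.natDegree_add_le _ _).trans (max_le hP hQ),
    fun z hz => by simp [hP' z hz, hQ' z hz]⟩

lemma LPn.smul {d N : ℕ} {f : ℤ_[p] → L} (c : L) (hf : LPn d N f) : LPn d N (c • f) := by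
  intro a
  obtain ⟨P, hP, hP'⟩ := hf a
  exact ⟨c • P, (Polynomial.natDegree_smul_le _ _).trans hP, fun z hz => by simp [hP' z hz]⟩

lemma LPn.sub {d N : ℕ} {f g : ℤ_[p] → L} (hf : LPn d N f) (hg : LPn d N g) :
    LPn d N (f - g) := by
  have := hf.add (hg.smul (-1))
  simpa [sub_eq_add_neg] using this

lemma LPn.mono {d d' N N' : ℕ} (hd : d ≤ d') (hN : N ≤ N') {f : ℤ_[p] → L} (hf : LPn d N f) :
    LPn d' N' f := by
  intro a
  obtain ⟨P, hP, hP'⟩ := hf a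
  refine ⟨P, hP.trans hd, fun z hz => hP' z (hz.trans ?_)⟩
  exact zpow_le_zpow_right₀ one_lt_p.le (by omega)

lemma continuous_iotaL : Continuous (iotaL p L) := continuous_algebraMap ℚ_[p] L

lemma LPn.continuous {d N : ℕ} {f : ℤ_[p] → L} (hf : LPn d N f) : Continuous f := by
  rw [continuous_iff_continuousAt]
  intro a
  obtain ⟨P, -, hP⟩ := hf a
  have h1 : ContinuousAt (fun z : ℤ_[p] => P.eval (iotaL p L (z : ℚ_[p]))) a :=
    (P.continuous.comp (continuous_iotaL.comp continuous_subtype_val)).continuousAt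
  refine h1.congr ?_
  have : Metric.closedBall a ((p : ℝ) ^ (-(N : ℤ))) ∈ 𝓝 a :=
    Metric.closedBall_mem_nhds _ (zpow_pos p_pos _)
  filter_upwards [this] with z hz
  exact (hP z (by simpa [dist_eq_norm] using hz)).symm

lemma iotaL_mul (x y : ℚ_[p]) : iotaL p L (x * y) = iotaL p L x * iotaL p L y := map_mul _ _ _
lemma iotaL_add (x y : ℚ_[p]) : iotaL p L (x + y) = iotaL p L x + iotaL p L y := map_add _ _ _
lemma iotaL_sub (x y : ℚ_[p]) : iotaL p L (x - y) = iotaL p L x - iotaL p L y := map_sub _ _ _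
lemma iotaL_pow (x : ℚ_[p]) (n : ℕ) : iotaL p L (x ^ n) = iotaL p L x ^ n := map_pow _ _ _
lemma iotaL_inv (x : ℚ_[p]) : iotaL p L x⁻¹ = (iotaL p L x)⁻¹ := map_inv₀ _ _
lemma iotaL_div (x y : ℚ_[p]) : iotaL p L (x / y) = iotaL p L x / iotaL p L y := map_div₀ _ _ _
lemma iotaL_natCast (n : ℕ) : iotaL p L (n : ℚ_[p]) = n := map_natCast (algebraMap ℚ_[p] L) n
lemma iotaL_one : iotaL p L 1 = 1 := map_one _
lemma iotaL_eq_zero {x : ℚ_[p]} : iotaL p L x = 0 ↔ x = 0 := map_eq_zero _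

lemma fwdDiff_iter_eq_zero_of_LPn {d N : ℕ} {f : ℤ_[p] → L} (hf : LPn d N f) (z : ℤ_[p]) :
    (fwdDiff ((p ^ N : ℕ) : ℤ_[p]))^[d + 1] f z = 0 := by
  obtain ⟨P, hP, hP'⟩ := hf z
  have key := Polynomial.fwdDiff_iter_eq_zero_of_degree_lt
    (P := P.comp (Polynomial.C (iotaL p L (z : ℚ_[p])) + Polynomial.C ((p : L) ^ N) * Polynomial.X))
    (n := d + 1) ?_
  · have key' := congrFun key 0
    rw [fwdDiff_iter_eq_sum_shift] at key' ⊢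
    rw [Pi.zero_apply] at key'
    rw [← key']
    refine Finset.sum_congr rfl fun i _ => ?_
    congr 1
    rw [hP']
    · simp [iotaL_add, iotaL_mul, iotaL_natCast, iotaL_pow, mul_comm]
    · simp only [add_sub_cancel_left, nsmul_eq_mul, norm_mul, Nat.cast_pow, norm_pow,
        PadicInt.norm_p]
      calc ‖(i : ℤ_[p])‖ * ((p : ℝ)⁻¹) ^ N ≤ 1 * ((p : ℝ)⁻¹) ^ N := by
            gcongr; exact PadicInt.norm_le_one _
        _ = _ := by simp
  · refine lt_of_le_of_lt Polynomial.natDegree_comp_le ?_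
    refine lt_of_le_of_lt (Nat.mul_le_mul hP (?_ : _ ≤ 1)) (by omega)
    refine (Polynomial.natDegree_add_le _ _).trans (max_le (by simp) ?_)
    exact (Polynomial.natDegree_C_mul_le _ _).trans (by simp)

variable [IsUltrametricDist L]

lemma norm_sum_le_of_le {ι : Type*} (s : Finset ι) (f : ι → L) {C : ℝ} (hC : 0 ≤ C)
    (h : ∀ i ∈ s, ‖f i‖ ≤ C) : ‖∑ i ∈ s, f i‖ ≤ C :=
  IsUltrametricDist.norm_sum_le_of_forall_le_of_nonneg hC h

lemma norm_intCast_le_one (p : ℕ) [Fact p.Prime] {L : Type} [NontriviallyNormedField L]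
    [NormedAlgebra ℚ_[p] L] (n : ℤ) : ‖(n : L)‖ ≤ 1 := by
  have h := norm_iotaL (L := L) (n : ℚ_[p])
  have h2 : iotaL p L (n : ℚ_[p]) = (n : L) := map_intCast (algebraMap ℚ_[p] L) n
  rw [h2] at h
  rw [h]
  exact Padic.norm_int_le_one n

lemma norm_aeval_shift_le {f : ℤ_[p] → L} {C : ℝ} (hf : ∀ z, ‖f z‖ ≤ C) (G : Polynomial ℤ)
    (z : ℤ_[p]) : ‖(Polynomial.aeval (fwdDiff_aux.shiftₗ ℤ_[p] L 1) G) f z‖ ≤ C := by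
  have hC : 0 ≤ C := (norm_nonneg _).trans (hf 0)
  rw [Polynomial.aeval_eq_sum_range, LinearMap.sum_apply, Finset.sum_apply]
  refine norm_sum_le_of_le _ _ hC fun i _ => ?_
  rw [LinearMap.smul_apply, Pi.smul_apply, zsmul_eq_mul, norm_mul, fwdDiff_aux.shiftₗ_pow_apply]
  calc _ ≤ 1 * C := mul_le_mul (norm_intCast_le_one p _) (hf _) (norm_nonneg _) zero_le_one
    _ = C := one_mul C

lemma exists_sub_pow_eq (N : ℕ) : ∃ U : Polynomial ℤ,
    (Polynomial.X - 1) ^ (p ^ N) = (Polynomial.X ^ (p ^ N) - 1) + Polynomial.C (p : ℤ) * U := by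
  have : Polynomial.C (p : ℤ) ∣
      (Polynomial.X - 1 : Polynomial ℤ) ^ (p ^ N) - (Polynomial.X ^ (p ^ N) - 1) := by
    rw [Polynomial.C_dvd_iff_dvd_coeff]
    intro i
    rw [← Int.modEq_zero_iff_dvd, ← ZMod.intCast_eq_intCast_iff, Int.cast_zero]
    have h : Polynomial.map (Int.castRingHom (ZMod p))
      ((Polynomial.X - 1 : Polynomial ℤ) ^ (p ^ N) - (Polynomial.X ^ (p ^ N) - 1)) = 0 := by
      simp [sub_pow_char_pow]
    have h' := congrArg (fun Q => Polynomial.coeff Q i) h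
    simpa only [Polynomial.coeff_map, Polynomial.coeff_zero, eq_intCast] using h'
  obtain ⟨U, hU⟩ := this
  exact ⟨U, by rw [← hU]; ring⟩

lemma aeval_shift_X_pow_sub_one (q : ℕ) :
    Polynomial.aeval (fwdDiff_aux.shiftₗ ℤ_[p] L 1) (Polynomial.X ^ q - 1 : Polynomial ℤ) =
      fwdDiff_aux.fwdDiffₗ ℤ_[p] L (q : ℤ_[p]) := by
  ext f z
  simp [fwdDiff_aux.shiftₗ_pow_apply, fwdDiff_aux.fwdDiffₗ, fwdDiff]

lemma norm_mahlerCoeff_le_of_LPn {d N : ℕ} {f : ℤ_[p] → L} {C : ℝ} (hf : LPn d N f)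
    (hC : ∀ z, ‖f z‖ ≤ C) (s t : ℕ) :
    ‖mahlerCoeff p L f (s * p ^ N + t)‖ ≤ C * (p : ℝ) ^ d * ((p : ℝ)⁻¹) ^ s := by
  have hC0 : 0 ≤ C := (norm_nonneg _).trans (hC 0)
  have hp := p_pos (p := p)
  obtain ⟨U, hU⟩ := exists_sub_pow_eq (p := p) N
  have h1 : Polynomial.aeval (fwdDiff_aux.shiftₗ ℤ_[p] L 1) (Polynomial.X - 1 : Polynomial ℤ) =
      fwdDiff_aux.fwdDiffₗ ℤ_[p] L (1 : ℤ_[p]) := by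
    simpa using aeval_shift_X_pow_sub_one (p := p) (L := L) 1
  have h2 : mahlerCoeff p L f (s * p ^ N + t) = Polynomial.aeval (fwdDiff_aux.shiftₗ ℤ_[p] L 1)
      ((Polynomial.X - 1 : Polynomial ℤ) ^ (s * p ^ N + t)) f 0 := by
    rw [map_pow, h1, mahlerCoeff_eq_fwdDiff, fwdDiff_aux.coe_fwdDiffₗ_pow]
  have h3 : (Polynomial.X - 1 : Polynomial ℤ) ^ (s * p ^ N + t) =
      ∑ i ∈ Finset.range (s + 1), (Polynomial.C ((p : ℤ) ^ (s - i)) *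
        ((Polynomial.X - 1) ^ t * U ^ (s - i) * (s.choose i : Polynomial ℤ))) *
        (Polynomial.X ^ (p ^ N) - 1) ^ i := by
    rw [pow_add, mul_comm s, pow_mul, hU, add_pow, Finset.sum_mul]
    refine Finset.sum_congr rfl fun i _ => ?_
    rw [mul_pow, ← Polynomial.C_pow]
    ring
  rw [h2, h3, map_sum, LinearMap.sum_apply, Finset.sum_apply]
  refine norm_sum_le_of_le _ _ (by positivity) fun i hi => ?_
  have hi' : i ≤ s := by simpa [Nat.lt_succ_iff] using hi
  by_cases hid : i ≤ d
  · rw [mul_assoc, map_mul, Module.End.mul_apply, Polynomial.aeval_C]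
    rw [Module.algebraMap_end_apply, Pi.smul_apply, zsmul_eq_mul, norm_mul]
    have h4 : ‖(((p : ℤ) ^ (s - i) : ℤ) : L)‖ = ((p : ℝ)⁻¹) ^ (s - i) := by
      push_cast; rw [norm_pow, norm_natCast_p]
    rw [h4]
    calc _ ≤ ((p : ℝ)⁻¹) ^ (s - i) * C := by
          gcongr; exact norm_aeval_shift_le hC _ _
      _ ≤ _ := by
          have : ((p : ℝ)⁻¹) ^ (s - i) = (p : ℝ) ^ i * ((p : ℝ)⁻¹) ^ s := by
            conv_rhs => rw [← Nat.sub_add_cancel hi', pow_add]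
            rw [mul_comm, mul_assoc, ← mul_pow, inv_mul_cancel₀ hp.ne', one_pow, mul_one]
          rw [this]
          have h5 : (p : ℝ) ^ i ≤ (p : ℝ) ^ d := pow_le_pow_right₀ one_lt_p.le hid
          have h6 : 0 ≤ C * ((p : ℝ)⁻¹) ^ s := by positivity
          nlinarith [mul_le_mul_of_nonneg_right h5 h6]
  · have h7 : (Polynomial.aeval (fwdDiff_aux.shiftₗ ℤ_[p] L 1)
        ((Polynomial.X ^ (p ^ N) - 1 : Polynomial ℤ) ^ i)) f = 0 := by
      obtain ⟨e, rfl⟩ : ∃ e, i = e + (d + 1) := ⟨i - (d + 1), by omega⟩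
      have h8 : (fwdDiff_aux.fwdDiffₗ ℤ_[p] L ((p ^ N : ℕ) : ℤ_[p]) ^ (d + 1)) f = 0 := by
        funext z
        rw [fwdDiff_aux.coe_fwdDiffₗ_pow]
        exact fwdDiff_iter_eq_zero_of_LPn hf z
      rw [map_pow, aeval_shift_X_pow_sub_one, pow_add, Module.End.mul_apply, h8, map_zero]
    rw [map_mul, Module.End.mul_apply, h7, map_zero]
    simp only [Pi.zero_apply, norm_zero]
    positivity

variable [CompleteSpace L]

lemma binomQ_eq_choose (z : ℤ_[p]) (n : ℕ) :
    binomQ p z n = ((Ring.choose z n : ℤ_[p]) : ℚ_[p]) := by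
  have h := Ring.descPochhammer_eq_factorial_smul_choose z n
  have h2 : (∏ i ∈ Finset.range n, ((z : ℚ_[p]) - (i : ℚ_[p]))) =
      (n.factorial : ℚ_[p]) * ((Ring.choose z n : ℤ_[p]) : ℚ_[p]) := by
    rw [← Polynomial.aeval_eq_smeval, Polynomial.aeval_def,
      ← Polynomial.eval_map, descPochhammer_map, descPochhammer_eval_eq_prod_range] at h
    have h' := congrArg (fun x : ℤ_[p] => (x : ℚ_[p])) h
    have h3 : ((∏ j ∈ Finset.range n, (z - (j : ℤ_[p])) : ℤ_[p]) : ℚ_[p]) =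
        ∏ i ∈ Finset.range n, ((z : ℚ_[p]) - (i : ℚ_[p])) := by
      rw [← PadicInt.algebraMap_apply, map_prod]
      simp
    rw [← h3]
    simpa using h'
  rw [binomQ, h2, mul_div_cancel_left₀]
  exact_mod_cast n.factorial_ne_zero

lemma norm_binomQ_le_one (z : ℤ_[p]) (n : ℕ) : ‖binomQ p z n‖ ≤ 1 := by
  rw [binomQ_eq_choose]
  exact PadicInt.norm_le_one _

lemma hasSum_mahlerCoeff {f : ℤ_[p] → L} (hf : Continuous f) (z : ℤ_[p]) :
    HasSum (fun n : ℕ => mahlerCoeff p L f n * iotaL p L (binomQ p z n)) (f z) := by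
  let _ : Module ℤ_[p] L := Module.compHom L (algebraMap ℤ_[p] ℚ_[p])
  have hs : ∀ (a : ℤ_[p]) (x : L), a • x = iotaL p L (a : ℚ_[p]) * x := fun a x =>
    Algebra.smul_def (a : ℚ_[p]) x
  have : IsBoundedSMul ℤ_[p] L := IsBoundedSMul.of_norm_smul_le fun a x => by
    rw [hs, norm_mul, norm_iotaL]; rfl
  have h := PadicInt.hasSum_mahler (⟨f, hf⟩ : C(ℤ_[p], L))
  have h2 := ContinuousMap.hasSum_apply h z
  refine h2.congr_fun ?_
  intro n
  rw [PadicInt.mahlerTerm_apply, mahler_apply, hs, ← binomQ_eq_choose, mul_comm]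
  congr 1
  rw [mahlerCoeff_eq_fwdDiff]
  rfl

lemma isCr_of_continuous {r : ℝ} {f : ℤ_[p] → L} (hf : Continuous f)
    (h : Tendsto (fun n : ℕ => (n : ℝ) ^ r * ‖mahlerCoeff p L f n‖) atTop (nhds 0)) :
    IsCr p L r f := ⟨h, hasSum_mahlerCoeff hf⟩

/-- `f` is of class `C^r` with norm at most `C`. -/
def CrBd (r : ℝ) (f : ℤ_[p] → L) (C : ℝ) : Prop :=
  IsCr p L r f ∧ ∀ n : ℕ, ((n : ℝ) + 1) ^ r * ‖mahlerCoeff p L f n‖ ≤ C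

variable {r : ℝ}

lemma IsCr.add {f g : ℤ_[p] → L} (hf : IsCr p L r f) (hg : IsCr p L r g) :
    IsCr p L r (f + g) := by
  refine ⟨?_, fun z => ?_⟩
  · refine squeeze_zero (fun n => by positivity) (fun n => ?_) (by simpa using hf.1.add hg.1)
    rw [mahlerCoeff_add, ← mul_add]
    gcongr
    exact norm_add_le _ _
  · have := (hf.2 z).add (hg.2 z)
    simp only [mahlerCoeff_add, add_mul]
    exact this

lemma IsCr.smul {f : ℤ_[p] → L} (c : L) (hf : IsCr p L r f) : IsCr p L r (c • f) := by
  refine ⟨?_, fun z => ?_⟩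
  · have := hf.1.const_mul ‖c‖
    simp only [mul_zero] at this
    refine this.congr fun n => ?_
    rw [mahlerCoeff_smul, norm_mul]; ring
  · have := (hf.2 z).mul_left c
    simp only [mahlerCoeff_smul, mul_assoc]
    exact this

lemma CrBd.add {f g : ℤ_[p] → L} {C : ℝ} (hf : CrBd r f C) (hg : CrBd r g C) :
    CrBd r (f + g) C := by
  refine ⟨hf.1.add hg.1, fun n => ?_⟩
  rw [mahlerCoeff_add]
  have hn : (0 : ℝ) ≤ ((n : ℝ) + 1) ^ r := by positivity
  rcases le_max_iff.1 (IsUltrametricDist.norm_add_le_max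
    (mahlerCoeff p L f n) (mahlerCoeff p L g n)) with h | h
  · exact (mul_le_mul_of_nonneg_left h hn).trans (hf.2 n)
  · exact (mul_le_mul_of_nonneg_left h hn).trans (hg.2 n)

lemma CrBd.smul {f : ℤ_[p] → L} {C : ℝ} (c : L) (hf : CrBd r f C) :
    CrBd r (c • f) (‖c‖ * C) := by
  refine ⟨hf.1.smul c, fun n => ?_⟩
  rw [mahlerCoeff_smul, norm_mul, mul_left_comm]
  exact mul_le_mul_of_nonneg_left (hf.2 n) (norm_nonneg _)

lemma CrBd.mono {f : ℤ_[p] → L} {C C' : ℝ} (hf : CrBd r f C) (h : C ≤ C') : CrBd r f C' :=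
  ⟨hf.1, fun n => (hf.2 n).trans h⟩

lemma CrBd.nonneg {f : ℤ_[p] → L} {C : ℝ} (hf : CrBd r f C) : 0 ≤ C :=
  le_trans (by positivity) (hf.2 0)

lemma CrBd.zero {C : ℝ} (hC : 0 ≤ C) : CrBd r (0 : ℤ_[p] → L) C := by
  have h : ∀ n, mahlerCoeff p L (0 : ℤ_[p] → L) n = 0 := fun n => by simp [mahlerCoeff]
  refine ⟨⟨by simp [h], fun z => by simp [h, hasSum_zero]⟩, fun n => by simpa [h] using hC⟩

lemma CrBd.sum {ι : Type*} (s : Finset ι) {f : ι → ℤ_[p] → L} {C : ℝ} (hC : 0 ≤ C)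
    (h : ∀ i ∈ s, CrBd r (f i) C) : CrBd r (∑ i ∈ s, f i) C := by
  induction s using Finset.induction_on with
  | empty => simpa using CrBd.zero hC
  | insert a s ha ih =>
    rw [Finset.sum_insert ha]
    exact (h a (by simp)).add (ih fun i hi => h i (by simp [hi]))

lemma CrBd.norm_le (hr : 0 ≤ r) {f : ℤ_[p] → L} {C : ℝ} (hf : CrBd r f C) (z : ℤ_[p]) :
    ‖f z‖ ≤ C := by
  have h := hf.1.2 z
  refine le_of_tendsto h.norm (Eventually.of_forall fun s => ?_)
  refine norm_sum_le_of_le _ _ hf.nonneg fun n _ => ?_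
  rw [norm_mul, norm_iotaL]
  have h1 : (1 : ℝ) ≤ ((n : ℝ) + 1) ^ r := Real.one_le_rpow (by linarith [n.cast_nonneg (α := ℝ)]) hr
  have h2 := hf.2 n
  have h3 := norm_binomQ_le_one z n
  have h4 := norm_nonneg (mahlerCoeff p L f n)
  nlinarith [norm_nonneg (binomQ p z n)]

lemma IsCr.exists_crBd (hr : 0 ≤ r) {f : ℤ_[p] → L} (hf : IsCr p L r f) : ∃ C, CrBd r f C := by
  obtain ⟨B, hB⟩ := hf.1.bddAbove_range
  refine ⟨max (2 ^ r * B) ‖mahlerCoeff p L f 0‖, hf, fun n => ?_⟩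
  rcases Nat.eq_zero_or_pos n with rfl | hn
  · simp
  · refine le_trans ?_ (le_max_left _ _)
    have h1 := hB (Set.mem_range_self n)
    have hn' : (1 : ℝ) ≤ n := by exact_mod_cast hn
    have h2 : ((n : ℝ) + 1) ^ r ≤ 2 ^ r * (n : ℝ) ^ r := by
      rw [← Real.mul_rpow (by norm_num) (by positivity)]
      exact Real.rpow_le_rpow (by positivity) (by linarith) hr
    calc _ ≤ 2 ^ r * (n : ℝ) ^ r * ‖mahlerCoeff p L f n‖ := by gcongr
      _ = 2 ^ r * ((n : ℝ) ^ r * ‖mahlerCoeff p L f n‖) := by ring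
      _ ≤ _ := by gcongr

lemma IsCr.crBd_of_crNorm_le (hr : 0 ≤ r) {f : ℤ_[p] → L} (hf : IsCr p L r f) {C : ℝ}
    (h : crNorm p L r f ≤ C) : CrBd r f C := by
  obtain ⟨B, hB⟩ := hf.exists_crBd hr
  refine ⟨hf, fun n => le_trans ?_ h⟩
  exact le_ciSup (f := fun n : ℕ => ((n : ℝ) + 1) ^ r * ‖mahlerCoeff p L f n‖)
    ⟨B, by rintro _ ⟨n, rfl⟩; exact hB.2 n⟩ n

lemma CrBd.crNorm_le {f : ℤ_[p] → L} {C : ℝ} (hf : CrBd r f C) : crNorm p L r f ≤ C :=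
  ciSup_le hf.2

lemma continuous_binomQ (n : ℕ) : Continuous fun z : ℤ_[p] => binomQ p z n := by
  simp only [binomQ_eq_choose]
  exact continuous_subtype_val.comp (PadicInt.continuous_choose n)

lemma IsCr.continuous (hr : 0 ≤ r) {f : ℤ_[p] → L} (hf : IsCr p L r f) : Continuous f := by
  have hu : TendstoUniformly (fun m z => ∑ n ∈ Finset.range m,
      mahlerCoeff p L f n * iotaL p L (binomQ p z n)) f atTop := by
    rw [Metric.tendstoUniformly_iff]
    intro ε hε
    have h0 : ∀ᶠ n : ℕ in atTop, ‖mahlerCoeff p L f n‖ ≤ ε / 2 := by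
      filter_upwards [hf.1.eventually (ge_mem_nhds (half_pos hε)), eventually_ge_atTop 1]
        with n hn h1
      refine le_trans ?_ hn
      exact le_mul_of_one_le_left (norm_nonneg _)
        (Real.one_le_rpow (by exact_mod_cast h1) hr)
    obtain ⟨n0, hn0⟩ := eventually_atTop.1 h0
    filter_upwards [eventually_ge_atTop n0] with m hm z
    rw [dist_eq_norm]
    refine lt_of_le_of_lt ?_ (half_lt_self hε)
    have h := ((hf.2 z).tendsto_sum_nat.sub_const (∑ n ∈ Finset.range m,
      mahlerCoeff p L f n * iotaL p L (binomQ p z n))).norm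
    refine le_of_tendsto h ?_
    filter_upwards [eventually_ge_atTop m] with M hM
    rw [← Finset.sum_sdiff (Finset.range_mono hM), add_sub_cancel_right]
    refine norm_sum_le_of_le _ _ (by positivity) fun n hn => ?_
    rw [norm_mul, norm_iotaL]
    have hn' : m ≤ n := by
      simp only [Finset.mem_sdiff, Finset.mem_range] at hn; omega
    exact (mul_le_of_le_one_right (norm_nonneg _) (norm_binomQ_le_one z n)).trans
      (hn0 n (hm.trans hn'))
  refine hu.continuous (Frequently.of_forall fun m => ?_)
  exact continuous_finsetSum _ fun n _ =>
    continuous_const.mul (continuous_iotaL.comp (continuous_binomQ n))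

/-- A sequence that is Cauchy in `C^r` and converges pointwise converges in `C^r`. -/
lemma CrBd.of_tendsto (hr : 0 ≤ r) {G : ℕ → ℤ_[p] → L} {g : ℤ_[p] → L} {C : ℝ} {ε : ℕ → ℝ}
    (hε : Tendsto ε atTop (𝓝 0)) (hC : ∀ M, CrBd r (G M) C)
    (hd : ∀ M M', M ≤ M' → CrBd r (G M' - G M) (ε M))
    (hlim : ∀ z, Tendsto (fun M => G M z) atTop (𝓝 (g z))) : CrBd r g C := by
  have hcoeff := tendsto_mahlerCoeff hlim
  have hdist : ∀ (M n : ℕ), ((n : ℝ) + 1) ^ r * ‖mahlerCoeff p L g n - mahlerCoeff p L (G M) n‖ ≤ ε M := by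
    intro M n
    refine le_of_tendsto (((hcoeff n).sub_const _).norm.const_mul _) ?_
    filter_upwards [eventually_ge_atTop M] with M' hM'
    rw [← mahlerCoeff_sub]
    exact (hd M M' hM').2 n
  have hcont : Continuous g := by
    have hu : TendstoUniformly G g atTop := by
      rw [Metric.tendstoUniformly_iff]
      intro δ hδ
      filter_upwards [hε.eventually (gt_mem_nhds hδ)] with M hM z
      refine lt_of_le_of_lt ?_ hM
      rw [dist_eq_norm]
      refine le_of_tendsto ((hlim z).sub_const _).norm ?_
      filter_upwards [eventually_ge_atTop M] with M' hM'
      exact (hd M M' hM').norm_le hr z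
    exact hu.continuous (Frequently.of_forall fun M => (hC M).1.continuous hr)
  refine ⟨isCr_of_continuous hcont ?_, fun n =>
    le_of_tendsto ((hcoeff n).norm.const_mul _) (Eventually.of_forall fun M => (hC M).2 n)⟩
  rw [Metric.tendsto_atTop]
  intro δ hδ
  obtain ⟨M, hM⟩ := (hε.eventually (gt_mem_nhds (half_pos hδ))).exists
  obtain ⟨n0, hn0⟩ := eventually_atTop.1 ((hC M).1.1.eventually (gt_mem_nhds (half_pos hδ)))
  refine ⟨n0, fun n hn => ?_⟩
  rw [dist_zero_right, Real.norm_of_nonneg (by positivity)]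
  have h1 := hdist M n
  have h2 : (n : ℝ) ^ r ≤ ((n : ℝ) + 1) ^ r := Real.rpow_le_rpow (by positivity) (by linarith) hr
  have h3 := norm_add_le (mahlerCoeff p L g n - mahlerCoeff p L (G M) n) (mahlerCoeff p L (G M) n)
  rw [sub_add_cancel] at h3
  have h4 := hn0 n hn
  have h5 : (0 : ℝ) ≤ (n : ℝ) ^ r := by positivity
  nlinarith [mul_le_mul_of_nonneg_left h3 h5, mul_le_mul_of_nonneg_right h2
    (norm_nonneg (mahlerCoeff p L g n - mahlerCoeff p L (G M) n))]

/-- A locally polynomial function of level `N` bounded by `M` has `C^r`-norm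
at most a constant times `p^{Nr} M`. -/
lemma exists_crBd_of_LPn (p : ℕ) [Fact p.Prime] (L : Type) [NontriviallyNormedField L]
    [NormedAlgebra ℚ_[p] L] [IsUltrametricDist L] [CompleteSpace L] (hr : 0 ≤ r) (d : ℕ) :
    ∃ C : ℝ, 0 < C ∧ ∀ (N : ℕ) (f : ℤ_[p] → L) (M : ℝ),
      LPn d N f → (∀ z, ‖f z‖ ≤ M) → CrBd r f (C * (p : ℝ) ^ ((N : ℝ) * r) * M) := by
  have hp := p_pos (p := p)
  have hp1 := one_lt_p (p := p)
  have key : ∀ R : ℝ, 0 ≤ R → ∃ S : ℝ, 0 < S ∧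
      ∀ s : ℕ, ((s : ℝ) + 1) ^ R * ((p : ℝ)⁻¹) ^ s ≤ S := by
    intro R hR
    obtain ⟨e, he⟩ := exists_nat_ge R
    have ht : Tendsto (fun s : ℕ => ((s : ℝ)) ^ e * ((p : ℝ)⁻¹) ^ s) atTop (𝓝 0) :=
      tendsto_pow_const_mul_const_pow_of_lt_one e (by positivity) (inv_lt_one_of_one_lt₀ hp1)
    obtain ⟨B, hB⟩ := ht.bddAbove_range
    have hB0 : 0 ≤ B := le_trans (by positivity) (hB (Set.mem_range_self 0))
    refine ⟨p * B + 1, by positivity, fun s => ?_⟩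
    have h1 := hB (Set.mem_range_self (s + 1))
    simp only [pow_succ, Nat.cast_add, Nat.cast_one] at h1
    have h2 : ((s : ℝ) + 1) ^ R ≤ ((s : ℝ) + 1) ^ e := by
      rw [← Real.rpow_natCast]
      exact Real.rpow_le_rpow_of_exponent_le (by linarith [s.cast_nonneg (α := ℝ)]) he
    calc _ ≤ ((s : ℝ) + 1) ^ e * ((p : ℝ)⁻¹) ^ s := by gcongr
      _ = p * (((s : ℝ) + 1) ^ e * (((p : ℝ)⁻¹) ^ s * (p : ℝ)⁻¹)) := by field_simp
      _ ≤ p * B := by gcongr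
      _ ≤ _ := by linarith
  have coeffBound : ∀ R : ℝ, 0 ≤ R → ∃ S : ℝ, 0 < S ∧ ∀ (N : ℕ) (f : ℤ_[p] → L) (M : ℝ),
      LPn d N f → (∀ z, ‖f z‖ ≤ M) → ∀ n : ℕ, ((n : ℝ) + 1) ^ R * ‖mahlerCoeff p L f n‖ ≤
        S * (p : ℝ) ^ ((N : ℝ) * R) * M := by
    intro R hR
    obtain ⟨S, hS, hS'⟩ := key R hR
    refine ⟨S * (p : ℝ) ^ d, by positivity, fun N f M hf hM n => ?_⟩
    have hM0 : 0 ≤ M := (norm_nonneg _).trans (hM 0)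
    set q := p ^ N with hq
    have hq0 : 0 < q := pow_pos (Fact.out : p.Prime).pos N
    have hn : n = n / q * q + n % q := (Nat.div_add_mod' n q).symm
    have h1 := norm_mahlerCoeff_le_of_LPn hf hM (n / q) (n % q)
    rw [← hq, ← hn] at h1
    have h2 : (n : ℝ) + 1 ≤ (((n / q : ℕ) : ℝ) + 1) * q := by
      have : n + 1 ≤ (n / q + 1) * q := by
        have := Nat.mod_lt n hq0
        rw [add_mul, one_mul]; omega
      exact_mod_cast this
    have h3 : ((q : ℕ) : ℝ) ^ R = (p : ℝ) ^ ((N : ℝ) * R) := by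
      rw [hq, Nat.cast_pow, ← Real.rpow_natCast, ← Real.rpow_mul hp.le]
    calc _ ≤ ((((n / q : ℕ) : ℝ) + 1) * q) ^ R * (M * (p : ℝ) ^ d * ((p : ℝ)⁻¹) ^ (n / q)) := by
          gcongr
      _ = ((((n / q : ℕ) : ℝ) + 1) ^ R * ((p : ℝ)⁻¹) ^ (n / q)) *
          ((p : ℝ) ^ ((N : ℝ) * R) * M * (p : ℝ) ^ d) := by
          rw [Real.mul_rpow (by positivity) (by positivity), h3]; ring
      _ ≤ S * ((p : ℝ) ^ ((N : ℝ) * R) * M * (p : ℝ) ^ d) := by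
          gcongr; exact hS' _
      _ = _ := by ring
  obtain ⟨S, hS, hS'⟩ := coeffBound r hr
  obtain ⟨S1, hS1, hS1'⟩ := coeffBound (r + 1) (by linarith)
  refine ⟨S, hS, fun N f M hf hM => ⟨isCr_of_continuous hf.continuous ?_, hS' N f M hf hM⟩⟩
  have hlim : Tendsto (fun n : ℕ => (S1 * (p : ℝ) ^ ((N : ℝ) * (r + 1)) * M) * (1 / ((n : ℝ) + 1)))
      atTop (𝓝 0) := by
    simpa using tendsto_one_div_add_atTop_nhds_zero_nat.const_mul
      (S1 * (p : ℝ) ^ ((N : ℝ) * (r + 1)) * M)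
  refine squeeze_zero (fun n => by positivity) (fun n => ?_) hlim
  have h1 := hS1' N f M hf hM n
  have hn : (0 : ℝ) < (n : ℝ) + 1 := by positivity
  rw [Real.rpow_add_one hn.ne'] at h1
  have h2 : (n : ℝ) ^ r ≤ ((n : ℝ) + 1) ^ r := Real.rpow_le_rpow (by positivity) (by linarith) hr
  rw [mul_one_div, le_div_iff₀ hn]
  calc _ ≤ ((n : ℝ) + 1) ^ r * ‖mahlerCoeff p L f n‖ * ((n : ℝ) + 1) := by gcongr
    _ = ((n : ℝ) + 1) ^ r * ((n : ℝ) + 1) * ‖mahlerCoeff p L f n‖ := by ring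
    _ ≤ _ := h1

/-- The coefficients of `P` satisfy `‖P.coeff l‖ ≤ ρ ^ l`. -/
def GaussBd (ρ : ℝ) (P : Polynomial L) : Prop := ∀ l, ‖P.coeff l‖ ≤ ρ ^ l

lemma GaussBd.mul {ρ : ℝ} (hρ : 0 ≤ ρ) {P Q : Polynomial L} (hP : GaussBd ρ P)
    (hQ : GaussBd ρ Q) : GaussBd ρ (P * Q) := by
  intro l
  rw [Polynomial.coeff_mul]
  refine norm_sum_le_of_le _ _ (by positivity) fun x hx => ?_
  rw [norm_mul, ← Finset.HasAntidiagonal.mem_antidiagonal.1 hx, pow_add]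
  exact mul_le_mul (hP _) (hQ _) (norm_nonneg _) (by positivity)

lemma GaussBd.sum {ι : Type*} (s : Finset ι) {ρ : ℝ} (hρ : 0 ≤ ρ) {P : ι → Polynomial L}
    (h : ∀ i ∈ s, GaussBd ρ (P i)) : GaussBd ρ (∑ i ∈ s, P i) := by
  intro l
  rw [Polynomial.finsetSum_coeff]
  exact norm_sum_le_of_le _ _ (by positivity) fun i hi => h i hi l

lemma GaussBd.C {ρ : ℝ} (hρ : 0 ≤ ρ) {c : L} (hc : ‖c‖ ≤ 1) :
    GaussBd ρ (Polynomial.C c) := by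
  intro l
  rw [Polynomial.coeff_C]
  split_ifs with h
  · simpa [h] using hc
  · simpa using pow_nonneg hρ l

lemma GaussBd.C_mul_X_sub {ρ : ℝ} (hρ : 0 ≤ ρ) {c e : L} (hc : ‖c‖ ≤ ρ) (he : ‖e‖ ≤ 1) :
    GaussBd ρ (Polynomial.C c * Polynomial.X - Polynomial.C e) := by
  intro l
  rcases l with _ | _ | l
  · simpa using he
  · simpa using hc
  · simp [Polynomial.coeff_X, Polynomial.coeff_C]
    positivity

lemma norm_natCast_inv_le (p : ℕ) [Fact p.Prime] {L : Type} [NontriviallyNormedField L]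
    [NormedAlgebra ℚ_[p] L] {n : ℕ} (hn : n ≠ 0) : ‖((n : L))⁻¹‖ ≤ n := by
  rw [← iotaL_natCast (p := p), norm_inv, norm_iotaL]
  have h1 : (n : ℚ_[p]) ≠ 0 := by exact_mod_cast hn
  rw [Padic.norm_eq_zpow_neg_valuation h1, ← zpow_neg, neg_neg, Padic.valuation_natCast,
    zpow_natCast]
  have := Nat.le_of_dvd (Nat.pos_of_ne_zero hn) (pow_padicValNat_dvd (p := p) (n := n))
  exact_mod_cast this

lemma exists_binom_poly (p : ℕ) [Fact p.Prime] (L : Type) [NontriviallyNormedField L]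
    [NormedAlgebra ℚ_[p] L] [IsUltrametricDist L] [CompleteSpace L] (m i : ℕ) (hi : i ≤ m) :
    ∃ P : Polynomial L, GaussBd (m : ℝ) P ∧
      ∀ y : ℤ_[p], P.eval (iotaL p L (y : ℚ_[p])) = iotaL p L (binomQ p y i) := by
  have hm : (0 : ℝ) ≤ m := Nat.cast_nonneg m
  rcases i with _ | i
  · exact ⟨1, by simpa using GaussBd.C hm (c := (1 : L)) (by simp), fun y => by
      simp [binomQ, iotaL_one]⟩
  · have hE : ∀ j ≤ i, GaussBd (m : ℝ) (∏ t ∈ Finset.range j,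
        (Polynomial.C (((t + 1 : ℕ) : L)⁻¹) * Polynomial.X - Polynomial.C 1)) := by
      intro j
      induction j with
      | zero => intro _; simpa using GaussBd.C hm (c := (1 : L)) (by simp)
      | succ j ih =>
        intro hj
        rw [Finset.prod_range_succ]
        refine GaussBd.mul hm (ih (by omega)) (GaussBd.C_mul_X_sub hm ?_ (by simp))
        refine (norm_natCast_inv_le p (by omega)).trans ?_
        exact_mod_cast (by omega : j + 1 ≤ m)
    refine ⟨(Polynomial.C (((i + 1 : ℕ) : L)⁻¹) * Polynomial.X - Polynomial.C 0) *
      ∏ t ∈ Finset.range i, (Polynomial.C (((t + 1 : ℕ) : L)⁻¹) * Polynomial.X - Polynomial.C 1),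
      GaussBd.mul hm (GaussBd.C_mul_X_sub hm ?_ (by simp)) (hE i le_rfl), fun y => ?_⟩
    · refine (norm_natCast_inv_le p (by omega)).trans ?_
      exact_mod_cast hi
    · have h : binomQ p y (i + 1) = (((i + 1 : ℕ) : ℚ_[p])⁻¹ * y) *
          ∏ t ∈ Finset.range i, (((t + 1 : ℕ) : ℚ_[p])⁻¹ * y - 1) := by
        rw [binomQ, Finset.prod_range_succ', Nat.factorial_succ]
        have h2 : ((i.factorial : ℕ) : ℚ_[p]) = ∏ t ∈ Finset.range i, ((t + 1 : ℕ) : ℚ_[p]) := by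
          rw [← Nat.cast_prod, Finset.prod_range_add_one_eq_factorial]
        have h3 : ∏ t ∈ Finset.range i, (((t + 1 : ℕ) : ℚ_[p])⁻¹ * y - 1) =
            (∏ t ∈ Finset.range i, ((y : ℚ_[p]) - ((t + 1 : ℕ) : ℚ_[p]))) /
              ∏ t ∈ Finset.range i, ((t + 1 : ℕ) : ℚ_[p]) := by
          rw [← Finset.prod_div_distrib]
          refine Finset.prod_congr rfl fun t _ => ?_
          have : ((t + 1 : ℕ) : ℚ_[p]) ≠ 0 := Nat.cast_ne_zero.2 (by omega)
          field_simp
        rw [h3, ← h2, Nat.cast_mul]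
        have h4 : ((i + 1 : ℕ) : ℚ_[p]) ≠ 0 := Nat.cast_ne_zero.2 (by omega)
        have h5 : ((i.factorial : ℕ) : ℚ_[p]) ≠ 0 := Nat.cast_ne_zero.2 i.factorial_ne_zero
        field_simp
        simp [mul_comm]
      rw [h]
      simp [Polynomial.eval_prod, iotaL, map_prod]

lemma exists_binom_taylor (a : ℤ_[p]) (m : ℕ) :
    ∃ P : Polynomial L, GaussBd (m : ℝ) P ∧
      ∀ y : ℤ_[p], P.eval (iotaL p L (y : ℚ_[p])) = iotaL p L (binomQ p (a + y) m) := by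
  have hm : (0 : ℝ) ≤ m := Nat.cast_nonneg m
  choose! B hB hB' using exists_binom_poly p L m
  refine ⟨∑ ij ∈ Finset.HasAntidiagonal.antidiagonal m, Polynomial.C (iotaL p L (binomQ p a ij.1)) * B ij.2,
    GaussBd.sum _ hm fun ij hij => GaussBd.mul hm (GaussBd.C hm ?_) (hB _ ?_), fun y => ?_⟩
  · rw [norm_iotaL]; exact norm_binomQ_le_one _ _
  · have := Finset.HasAntidiagonal.mem_antidiagonal.1 hij; omega
  · have h : binomQ p (a + y) m =
        ∑ ij ∈ Finset.HasAntidiagonal.antidiagonal m, binomQ p a ij.1 * binomQ p y ij.2 := by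
      simp only [binomQ_eq_choose]
      rw [Ring.add_choose_eq m (Commute.all a y), ← PadicInt.algebraMap_apply, map_sum]
      simp
    have hs : iotaL p L (∑ ij ∈ Finset.HasAntidiagonal.antidiagonal m,
        binomQ p a ij.1 * binomQ p y ij.2) = ∑ ij ∈ Finset.HasAntidiagonal.antidiagonal m,
        iotaL p L (binomQ p a ij.1 * binomQ p y ij.2) := map_sum (algebraMap ℚ_[p] L) _ _
    rw [h, hs, Polynomial.eval_finsetSum]
    refine Finset.sum_congr rfl fun ij hij => ?_
    have hij' := Finset.HasAntidiagonal.mem_antidiagonal.1 hij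
    rw [Polynomial.eval_mul, Polynomial.eval_C, hB' ij.2 (by omega), iotaL_mul]

lemma rpow_neg_natCast_mul (n : ℕ) (r : ℝ) :
    (p : ℝ) ^ (-((n : ℝ) * r)) = (((p : ℝ) ^ n) ^ r)⁻¹ := by
  rw [Real.rpow_neg p_pos.le, Real.rpow_mul p_pos.le, Real.rpow_natCast]

lemma norm_taylor_remainder_le {m d n : ℕ} (hm : m < p ^ n) (hr : r ≤ d + 1)
    {P : Polynomial L} (hP : GaussBd (m : ℝ) P) {y : L} (hy : ‖y‖ ≤ (p : ℝ) ^ (-(n : ℤ))) :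
    ‖P.eval y - ∑ l ∈ Finset.range (d + 1), P.coeff l * y ^ l‖ ≤
      (m : ℝ) ^ r * (p : ℝ) ^ (-((n : ℝ) * r)) := by
  have hp := p_pos (p := p)
  have hp' : (0 : ℝ) < (p : ℝ) ^ n := by positivity
  rw [Polynomial.eval_eq_sum_range' (n := max (P.natDegree + 1) (d + 1)) (by omega),
    ← Finset.sum_sdiff (Finset.range_mono (le_max_right (P.natDegree + 1) (d + 1))),
    add_sub_cancel_right]
  refine norm_sum_le_of_le _ _ (by positivity) fun l hl => ?_
  have hl' : d + 1 ≤ l := by simp only [Finset.mem_sdiff, Finset.mem_range] at hl; omega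
  rw [norm_mul, norm_pow, rpow_neg_natCast_mul, ← div_eq_mul_inv,
    ← Real.div_rpow (Nat.cast_nonneg m) hp'.le]
  set x : ℝ := (m : ℝ) / (p : ℝ) ^ n with hx
  have hx0 : 0 ≤ x := by positivity
  have hx1 : x ≤ 1 := by
    rw [hx, div_le_one hp']; exact_mod_cast hm.le
  calc ‖P.coeff l‖ * ‖y‖ ^ l ≤ (m : ℝ) ^ l * ((p : ℝ) ^ (-(n : ℤ))) ^ l := by
        gcongr; exact hP l
    _ = x ^ l := by rw [hx, ← mul_pow, zpow_neg, zpow_natCast, div_eq_mul_inv]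
    _ ≤ x ^ r := by
        rcases hx0.eq_or_lt with h0 | h0
        · rw [← h0, zero_pow (by omega)]; positivity
        · rw [← Real.rpow_natCast]
          refine Real.rpow_le_rpow_of_exponent_ge h0 hx1 (hr.trans ?_)
          exact_mod_cast hl'

lemma norm_coe_sub_le {z a : ℤ_[p]} {ρ : ℝ} (h : ‖z - a‖ ≤ ρ) :
    ‖iotaL p L ((z - a : ℤ_[p]) : ℚ_[p])‖ ≤ ρ := by
  rw [norm_iotaL]; exact h

lemma CrBd.exists_poly_approx (hr : 0 ≤ r) {d : ℕ} (hrd : r ≤ d + 1) {f : ℤ_[p] → L} {C : ℝ}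
    (hf : CrBd r f C) (a : ℤ_[p]) (n : ℕ) :
    ∃ P : Polynomial L, P.natDegree ≤ d ∧ ∀ z : ℤ_[p], ‖z - a‖ ≤ (p : ℝ) ^ (-(n : ℤ)) →
      ‖f z - P.eval (iotaL p L (z : ℚ_[p]))‖ ≤ C * (p : ℝ) ^ (-((n : ℝ) * r)) := by
  have hp := p_pos (p := p)
  choose T hT hT' using exists_binom_taylor (p := p) (L := L) a
  set X' : Polynomial L := Polynomial.X - Polynomial.C (iotaL p L (a : ℚ_[p])) with hX'
  refine ⟨∑ m ∈ Finset.range (p ^ n), Polynomial.C (mahlerCoeff p L f m) *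
    ∑ l ∈ Finset.range (d + 1), Polynomial.C ((T m).coeff l) * X' ^ l, ?_, fun z hz => ?_⟩
  · refine Polynomial.natDegree_sum_le_of_forall_le _ _ fun m _ => ?_
    refine (Polynomial.natDegree_C_mul_le _ _).trans ?_
    refine Polynomial.natDegree_sum_le_of_forall_le _ _ fun l hl => ?_
    refine (Polynomial.natDegree_C_mul_le _ _).trans (Polynomial.natDegree_pow_le.trans ?_)
    rw [hX', Polynomial.natDegree_X_sub_C]
    have := Finset.mem_range.1 hl
    omega
  · rw [Polynomial.eval_finsetSum]
    set y : L := iotaL p L ((z - a : ℤ_[p]) : ℚ_[p]) with hy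
    have hy' : ‖y‖ ≤ (p : ℝ) ^ (-(n : ℤ)) := norm_coe_sub_le hz
    have hX : Polynomial.eval (iotaL p L (z : ℚ_[p])) X' = y := by
      rw [hX', hy]; simp [iotaL]
    refine le_of_tendsto ((hf.1.2 z).tendsto_sum_nat.sub_const _).norm ?_
    filter_upwards [eventually_ge_atTop (p ^ n)] with M hM
    rw [← Finset.sum_sdiff (Finset.range_mono hM), add_sub_assoc, ← Finset.sum_sub_distrib]
    have hC0 := hf.nonneg
    have hCp : 0 ≤ C * (p : ℝ) ^ (-((n : ℝ) * r)) := by positivity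
    refine (IsUltrametricDist.norm_add_le_max _ _).trans (max_le ?_ ?_)
    · refine norm_sum_le_of_le _ _ hCp fun m hm => ?_
      have hm' : p ^ n ≤ m := by simp only [Finset.mem_sdiff, Finset.mem_range] at hm; omega
      rw [norm_mul, norm_iotaL, rpow_neg_natCast_mul, ← div_eq_mul_inv,
        le_div_iff₀ (by positivity)]
      have h1 : ((p : ℝ) ^ n) ^ r ≤ ((m : ℝ) + 1) ^ r := by
        refine Real.rpow_le_rpow (by positivity) ?_ hr
        have : ((p ^ n : ℕ) : ℝ) ≤ m := by exact_mod_cast hm'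
        push_cast at this; linarith
      calc _ ≤ ‖mahlerCoeff p L f m‖ * 1 * ((m : ℝ) + 1) ^ r := by
            gcongr; exact norm_binomQ_le_one z m
        _ = ((m : ℝ) + 1) ^ r * ‖mahlerCoeff p L f m‖ := by ring
        _ ≤ C := hf.2 m
    · refine norm_sum_le_of_le _ _ hCp fun m hm => ?_
      have hm' := Finset.mem_range.1 hm
      have h1 := norm_taylor_remainder_le hm' hrd (hT m) hy'
      have h2 : (T m).eval y = iotaL p L (binomQ p z m) := by
        rw [hy, hT' m (z - a), add_sub_cancel]
      rw [h2] at h1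
      rw [Polynomial.eval_mul, Polynomial.eval_C, Polynomial.eval_finsetSum, ← mul_sub, norm_mul]
      simp only [Polynomial.eval_mul, Polynomial.eval_C, Polynomial.eval_pow, hX]
      have h3 : (m : ℝ) ^ r ≤ ((m : ℝ) + 1) ^ r :=
        Real.rpow_le_rpow (by positivity) (by linarith) hr
      calc _ ≤ ‖mahlerCoeff p L f m‖ * (((m : ℝ) + 1) ^ r * (p : ℝ) ^ (-((n : ℝ) * r))) := by
            gcongr
            exact h1.trans (by gcongr)
        _ = ((m : ℝ) + 1) ^ r * ‖mahlerCoeff p L f m‖ * (p : ℝ) ^ (-((n : ℝ) * r)) := by ring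
        _ ≤ _ := by gcongr; exact hf.2 m

lemma appr_unique {n a b : ℕ} (ha : a < p ^ n) (hb : b < p ^ n)
    (h : ‖(a : ℤ_[p]) - b‖ ≤ (p : ℝ) ^ (-(n : ℤ))) : a = b := by
  have h1 : ‖((a - b : ℤ) : ℤ_[p])‖ ≤ (p : ℝ) ^ (-(n : ℤ)) := by push_cast; exact h
  rw [PadicInt.norm_int_le_pow_iff_dvd] at h1
  have h2 : (a : ℤ) ≡ b [ZMOD (p ^ n : ℕ)] := by
    refine (Int.modEq_iff_dvd.2 ?_).symm
    exact_mod_cast h1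
  have h3 := (Int.natCast_modEq_iff.1 h2)
  exact Nat.ModEq.eq_of_lt_of_lt h3 ha hb

lemma norm_sub_appr_le (z : ℤ_[p]) (n : ℕ) :
    ‖z - (z.appr n : ℤ_[p])‖ ≤ (p : ℝ) ^ (-(n : ℤ)) := by
  rw [PadicInt.norm_le_pow_iff_mem_span_pow]
  exact PadicInt.appr_spec n z

lemma norm_add_le_of_le {x y : ℤ_[p]} {ρ : ℝ} (hx : ‖x‖ ≤ ρ) (hy : ‖y‖ ≤ ρ) : ‖x + y‖ ≤ ρ :=
  (IsUltrametricDist.norm_add_le_max _ _).trans (max_le hx hy)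

lemma norm_sub_trans_le {x y z : ℤ_[p]} {ρ : ℝ} (h1 : ‖x - y‖ ≤ ρ) (h2 : ‖y - z‖ ≤ ρ) :
    ‖x - z‖ ≤ ρ := by
  have := norm_add_le_of_le h1 h2
  rwa [sub_add_sub_cancel] at this

lemma appr_eq_of_norm_le {z : ℤ_[p]} {n a : ℕ} (ha : a < p ^ n)
    (h : ‖z - a‖ ≤ (p : ℝ) ^ (-(n : ℤ))) : z.appr n = a := by
  refine appr_unique (PadicInt.appr_lt _ _) ha (norm_sub_trans_le (y := z) ?_ h)
  rw [norm_sub_rev]; exact norm_sub_appr_le z n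

lemma CrBd.exists_LPn_approx (hr : 0 ≤ r) {d : ℕ} (hrd : r ≤ d + 1) {f : ℤ_[p] → L} {C : ℝ}
    (hf : CrBd r f C) (n : ℕ) :
    ∃ g : ℤ_[p] → L, LPn d n g ∧ ∀ z, ‖f z - g z‖ ≤ C * (p : ℝ) ^ (-((n : ℝ) * r)) := by
  choose P hP hP' using fun a => hf.exists_poly_approx hr hrd a n
  refine ⟨fun z => (P (z.appr n : ℕ)).eval (iotaL p L (z : ℚ_[p])), fun a => ?_, fun z =>
    hP' _ z (norm_sub_appr_le z n)⟩
  refine ⟨P (a.appr n : ℕ), hP _, fun z hz => ?_⟩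
  dsimp only
  rw [appr_eq_of_norm_le (PadicInt.appr_lt a n)
    (norm_sub_trans_le hz (norm_sub_appr_le a n))]

lemma norm_sub_le_max' (x y : L) : ‖x - y‖ ≤ max ‖x‖ ‖y‖ := by
  simpa [sub_eq_add_neg] using IsUltrametricDist.norm_add_le_max x (-y)

lemma exists_coeff_bound (p : ℕ) [Fact p.Prime] (L : Type) [NontriviallyNormedField L]
    [NormedAlgebra ℚ_[p] L] [IsUltrametricDist L] (d : ℕ) :
    ∃ K : ℝ, 0 < K ∧ ∀ (Q : Polynomial L) (ε : ℝ), Q.natDegree ≤ d →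
      (∀ z : ℤ_[p], ‖Q.eval (iotaL p L (z : ℚ_[p]))‖ ≤ ε) → ∀ i, ‖Q.coeff i‖ ≤ K * ε := by
  set v : ℕ → L := fun i => (i : L) with hv
  set s := Finset.range (d + 1) with hs
  have : CharZero L := charZero_of_injective_algebraMap (algebraMap ℚ_[p] L).injective
  have hinj : Set.InjOn v s := fun a _ b _ hab => Nat.cast_injective (R := L) hab
  set K : ℝ := 1 + ∑ i ∈ s, ∑ l ∈ s, ‖(Lagrange.basis s v i).coeff l‖ with hK
  have hK0 : 0 ≤ ∑ i ∈ s, ∑ l ∈ s, ‖(Lagrange.basis s v i).coeff l‖ :=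
    Finset.sum_nonneg fun i _ => Finset.sum_nonneg fun l _ => norm_nonneg _
  refine ⟨K, by positivity, fun Q ε hQ hε l => ?_⟩
  have hε0 : 0 ≤ ε := (norm_nonneg _).trans (hε 0)
  by_cases hl : l ∈ s
  swap
  · rw [Polynomial.coeff_eq_zero_of_natDegree_lt (by
      simp only [hs, Finset.mem_range] at hl; omega), norm_zero]
    positivity
  have h := Lagrange.eq_interpolate (f := Q) hinj (by
    rw [hs, Finset.card_range]
    exact Polynomial.degree_le_natDegree.trans_lt (by exact_mod_cast (by omega)))
  rw [h, Lagrange.interpolate_apply, Polynomial.finsetSum_coeff]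
  refine norm_sum_le_of_le _ _ (by positivity) fun i hi => ?_
  rw [Polynomial.coeff_C_mul, norm_mul, mul_comm]
  have h1 := hε (i : ℤ_[p])
  rw [PadicInt.coe_natCast, iotaL_natCast] at h1
  refine mul_le_mul ?_ h1 (norm_nonneg _) (by positivity)
  have h2 : ‖(Lagrange.basis s v i).coeff l‖ ≤ ∑ l ∈ s, ‖(Lagrange.basis s v i).coeff l‖ :=
    Finset.single_le_sum (f := fun l => ‖(Lagrange.basis s v i).coeff l‖)
      (fun _ _ => norm_nonneg _) hl
  have h3 := Finset.single_le_sum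
    (f := fun i => ∑ l ∈ s, ‖(Lagrange.basis s v i).coeff l‖)
      (fun _ _ => Finset.sum_nonneg fun _ _ => norm_nonneg _) hi
  linarith

/-- The function `α^n ((z - a) / p^n)^j` on the ball `a + p^n ℤ_p`, extended by zero. -/
def atom (α : L) (a : ℤ_[p]) (n j : ℕ) : ℤ_[p] → L := fun z =>
  if ‖z - a‖ ≤ (p : ℝ) ^ (-(n : ℤ)) then
    α ^ n * (iotaL p L ((z : ℚ_[p]) - (a : ℚ_[p])) / (p : L) ^ n) ^ j else 0

/-- `S` is stable under addition and under scalars of norm at most one. -/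
structure IsOMod {V : Type} [AddCommGroup V] [Module L V] (S : Set V) : Prop where
  zero_mem : (0 : V) ∈ S
  add_mem : ∀ f ∈ S, ∀ g ∈ S, f + g ∈ S
  smul_mem : ∀ c : L, ‖c‖ ≤ 1 → ∀ f ∈ S, c • f ∈ S

lemma IsOMod.sum_mem {V : Type} [AddCommGroup V] [Module L V] {S : Set V}
    (hS : IsOMod (L := L) S) {ι : Type*} (s : Finset ι) (f : ι → V) (h : ∀ i ∈ s, f i ∈ S) :
    ∑ i ∈ s, f i ∈ S := by
  induction s using Finset.induction_on with
  | empty => simpa using hS.zero_mem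
  | insert a s ha ih =>
    rw [Finset.sum_insert ha]
    exact hS.add_mem _ (h a (by simp)) _ (ih fun i hi => h i (by simp [hi]))

lemma p_ne_zero : (p : L) ≠ 0 := by
  rw [← norm_pos_iff, norm_natCast_p (p := p)]; exact inv_pos.2 p_pos

lemma exists_shift_eq {z a : ℤ_[p]} {n : ℕ} (h : ‖z - a‖ ≤ (p : ℝ) ^ (-(n : ℤ))) :
    ∃ y : ℤ_[p], z = a + (p : ℤ_[p]) ^ n * y := by
  rw [PadicInt.norm_le_pow_iff_mem_span_pow, Ideal.mem_span_singleton] at h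
  obtain ⟨y, hy⟩ := h
  exact ⟨y, by rw [← hy]; ring⟩

lemma norm_shift_le (a y : ℤ_[p]) (n : ℕ) :
    ‖a + (p : ℤ_[p]) ^ n * y - a‖ ≤ (p : ℝ) ^ (-(n : ℤ)) := by
  rw [add_sub_cancel_left, PadicInt.norm_le_pow_iff_mem_span_pow]
  exact Ideal.mul_mem_right _ _ (Ideal.mem_span_singleton_self _)

lemma exists_LPn_mem (p : ℕ) [Fact p.Prime] (L : Type) [NontriviallyNormedField L]
    [NormedAlgebra ℚ_[p] L] [IsUltrametricDist L] [CompleteSpace L] (α : L)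
    (hα : ‖α‖ = (p : ℝ) ^ (-r)) (d : ℕ) :
    ∃ K : ℝ, 0 < K ∧ ∀ S : Set (ℤ_[p] → L), IsOMod (L := L) S →
      (∀ a n j, j ≤ d → atom α a n j ∈ S) → ∀ (N : ℕ) (g : ℤ_[p] → L) (ε : ℝ) (c : L),
      LPn d N g → (∀ z, ‖g z‖ ≤ ε) → ‖c‖ * K * ε * (p : ℝ) ^ ((N : ℝ) * r) ≤ 1 → c • g ∈ S := by
  obtain ⟨K, hK, hKc⟩ := exists_coeff_bound p L d
  have hp := p_pos (p := p)
  have hα0 : α ≠ 0 := by rw [← norm_pos_iff, hα]; positivity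
  refine ⟨K, hK, fun S hS hat N g ε c hg hε hc => ?_⟩
  have hball : ∀ a : ℤ_[p], ∃ q : ℕ → L, (∀ j, ‖q j‖ ≤ K * ε) ∧ ∀ z : ℤ_[p],
      ‖z - a‖ ≤ (p : ℝ) ^ (-(N : ℤ)) → g z = ∑ j ∈ Finset.range (d + 1),
        q j * (iotaL p L ((z : ℚ_[p]) - (a : ℚ_[p])) / (p : L) ^ N) ^ j := by
    intro a
    obtain ⟨P, hP, hP'⟩ := hg a
    set Q : Polynomial L := P.comp (Polynomial.C (iotaL p L (a : ℚ_[p])) +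
      Polynomial.C ((p : L) ^ N) * Polynomial.X) with hQ
    have hQd : Q.natDegree ≤ d := by
      refine Polynomial.natDegree_comp_le.trans ?_
      have : (Polynomial.C (iotaL p L (a : ℚ_[p])) +
        Polynomial.C ((p : L) ^ N) * Polynomial.X).natDegree ≤ 1 := by
        rw [add_comm]; exact Polynomial.natDegree_linear_le
      calc _ ≤ P.natDegree * 1 := Nat.mul_le_mul le_rfl this
        _ ≤ d := by omega
    have hQe : ∀ y : ℤ_[p], Q.eval (iotaL p L (y : ℚ_[p])) = g (a + (p : ℤ_[p]) ^ N * y) := by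
      intro y
      rw [hP' _ (norm_shift_le a y N), hQ]
      simp [iotaL]
    refine ⟨Q.coeff, hKc Q ε hQd fun z => by rw [hQe]; exact hε _, fun z hz => ?_⟩
    obtain ⟨y, rfl⟩ := exists_shift_eq hz
    rw [← hQe, Polynomial.eval_eq_sum_range' (n := d + 1) (by omega)]
    have hy : iotaL p L (((a + (p : ℤ_[p]) ^ N * y : ℤ_[p]) : ℚ_[p]) - (a : ℚ_[p])) / (p : L) ^ N =
        iotaL p L (y : ℚ_[p]) := by
      rw [div_eq_iff (pow_ne_zero _ (p_ne_zero (p := p)))]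
      simp [iotaL, mul_comm]
    rw [hy]
  choose q hq hqg using hball
  have hsum : c • g = ∑ a ∈ Finset.range (p ^ N), ∑ j ∈ Finset.range (d + 1),
      (c * q (a : ℕ) j * (α ^ N)⁻¹) • atom (p := p) α (a : ℕ) N j := by
    funext z
    rw [Finset.sum_apply, Finset.sum_eq_single (z.appr N)]
    · rw [Finset.sum_apply, Pi.smul_apply, hqg _ z (norm_sub_appr_le z N), smul_eq_mul,
        Finset.mul_sum]
      refine Finset.sum_congr rfl fun j _ => ?_
      rw [Pi.smul_apply, atom, if_pos (norm_sub_appr_le z N), smul_eq_mul]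
      field_simp
    · intro a ha hne
      rw [Finset.sum_apply]
      refine Finset.sum_eq_zero fun j _ => ?_
      rw [Pi.smul_apply, atom, if_neg, smul_zero]
      exact fun h => hne (appr_eq_of_norm_le (Finset.mem_range.1 ha) h).symm
    · intro h
      exact absurd (Finset.mem_range.2 (PadicInt.appr_lt z N)) h
  rw [hsum]
  refine hS.sum_mem _ _ fun a _ => hS.sum_mem _ _ fun j hj =>
    hS.smul_mem _ ?_ _ (hat _ _ _ (by have := Finset.mem_range.1 hj; omega))
  rw [norm_mul, norm_mul, norm_inv, norm_pow, hα, ← Real.rpow_natCast, ← Real.rpow_mul hp.le,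
    ← Real.rpow_neg hp.le]
  refine le_trans ?_ hc
  rw [show -(-r * (N : ℝ)) = (N : ℝ) * r by ring, mul_assoc ‖c‖ K]
  gcongr
  exact hq _ _

lemma exists_LPn_crBd_mem (p : ℕ) [Fact p.Prime] (L : Type) [NontriviallyNormedField L]
    [NormedAlgebra ℚ_[p] L] [IsUltrametricDist L] [CompleteSpace L] (α : L)
    (hα : ‖α‖ = (p : ℝ) ^ (-r)) (hr : 0 ≤ r) (d : ℕ) (hrd : r ≤ d + 1) :
    ∃ K : ℝ, 0 < K ∧ ∀ S : Set (ℤ_[p] → L), IsOMod (L := L) S →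
      (∀ a n j, j ≤ d → atom α a n j ∈ S) → ∀ (N : ℕ) (f : ℤ_[p] → L) (C : ℝ) (c : L),
      LPn d N f → CrBd r f C → ‖c‖ * K * C ≤ 1 → c • f ∈ S := by
  obtain ⟨K, hK, hKc⟩ := exists_LPn_mem p L α hα d
  have hp := p_pos (p := p)
  refine ⟨K * (p : ℝ) ^ r, by positivity, fun S hS hat N f C c hf hfC hc => ?_⟩
  have hC := hfC.nonneg
  have hpr : 1 ≤ (p : ℝ) ^ r := Real.one_le_rpow one_lt_p.le hr
  have hc' : ‖c‖ * K * C ≤ 1 := by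
    refine le_trans ?_ hc
    have : K ≤ K * (p : ℝ) ^ r := le_mul_of_one_le_right hK.le hpr
    gcongr
  choose g hg hgf using fun n => hfC.exists_LPn_approx hr hrd n
  have hcancel : ∀ n : ℕ, (p : ℝ) ^ (-((n : ℝ) * r)) * (p : ℝ) ^ ((n : ℝ) * r) = 1 := fun n => by
    rw [← Real.rpow_add hp]; simp
  have hgS : ∀ n, c • g n ∈ S := by
    intro n
    induction n with
    | zero =>
      refine hKc S hS hat 0 (g 0) C c (hg 0) (fun z => ?_) (by simpa using hc')
      have h1 := hgf 0 z
      have h2 := hfC.norm_le hr z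
      have h3 := norm_sub_le_max' (f z) (f z - g 0 z)
      rw [sub_sub_cancel] at h3
      exact h3.trans (max_le h2 (by simpa using h1))
    | succ n ih =>
      have : c • g (n + 1) = c • g n + c • (g (n + 1) - g n) := by rw [smul_sub]; abel
      rw [this]
      refine hS.add_mem _ ih _ (hKc S hS hat (n + 1) _ (C * (p : ℝ) ^ (-((n : ℝ) * r))) c
        ((hg (n + 1)).sub ((hg n).mono le_rfl (by omega))) (fun z => ?_) ?_)
      · have h3 := norm_sub_le_max' (f z - g n z) (f z - g (n + 1) z)
        rw [sub_sub_sub_cancel_left] at h3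
        refine h3.trans (max_le (hgf n z) ((hgf (n + 1) z).trans ?_))
        gcongr
        · exact one_lt_p.le
        · exact_mod_cast (by omega)
      · have : ((n + 1 : ℕ) : ℝ) * r = (n : ℝ) * r + r := by push_cast; ring
        rw [this, Real.rpow_add hp]
        calc _ = ‖c‖ * (K * (p : ℝ) ^ r) * C *
              ((p : ℝ) ^ (-((n : ℝ) * r)) * (p : ℝ) ^ ((n : ℝ) * r)) := by ring
          _ ≤ 1 := by rw [hcancel, mul_one]; exact hc
  have : c • f = c • g N + c • (f - g N) := by rw [smul_sub]; abel
  rw [this]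
  refine hS.add_mem _ (hgS N) _ (hKc S hS hat N _ (C * (p : ℝ) ^ (-((N : ℝ) * r))) c
    (hf.sub (hg N)) (hgf N) ?_)
  calc _ = ‖c‖ * K * C * ((p : ℝ) ^ (-((N : ℝ) * r)) * (p : ℝ) ^ ((N : ℝ) * r)) := by ring
    _ ≤ 1 := by rw [hcancel, mul_one]; exact hc'

lemma mahlerCoeff_binomQ (m n : ℕ) :
    mahlerCoeff p L (fun z => iotaL p L (binomQ p z m)) n = if n = m then 1 else 0 := by
  have h := fwdDiff_iter_choose_zero m n
  rw [fwdDiff_iter_eq_sum_shift, ← Finset.sum_range_reflect] at h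
  have h2 := congrArg (Int.cast : ℤ → L) h
  rw [Int.cast_sum] at h2
  have h3 : ((if n = m then (1 : ℤ) else 0 : ℤ) : L) = if n = m then 1 else 0 := by
    split_ifs <;> simp
  rw [← h3, ← h2, mahlerCoeff]
  refine Finset.sum_congr rfl fun i hi => ?_
  have hi' : i ≤ n := by have := Finset.mem_range.1 hi; omega
  have h4 : n + 1 - 1 - i = n - i := by omega
  rw [h4, Nat.sub_sub_self hi', Nat.choose_symm hi', binomQ_eq_choose, Ring.choose_natCast,
    PadicInt.coe_natCast, iotaL_natCast]
  simp

lemma LPn.exists_bound {d N : ℕ} {f : ℤ_[p] → L} (hf : LPn d N f) : ∃ M, ∀ z, ‖f z‖ ≤ M := by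
  obtain ⟨M, hM⟩ := isCompact_univ.exists_bound_of_continuousOn hf.continuous.continuousOn
  exact ⟨M, fun z => hM z (Set.mem_univ z)⟩

lemma mahlerCoeff_sum {ι : Type*} (s : Finset ι) (f : ι → ℤ_[p] → L) (n : ℕ) :
    mahlerCoeff p L (∑ i ∈ s, f i) n = ∑ i ∈ s, mahlerCoeff p L (f i) n := by
  simp only [mahlerCoeff, Finset.sum_apply, Finset.mul_sum]
  exact Finset.sum_comm

lemma IsCr.exists_LPn_crBd_sub (hr : 0 ≤ r) {d : ℕ} (hrd : r < d + 1) {f : ℤ_[p] → L}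
    (hf : IsCr p L r f) {ε : ℝ} (hε : 0 < ε) :
    ∃ (N : ℕ) (g : ℤ_[p] → L), LPn d N g ∧ CrBd r (f - g) ε := by
  have hp := p_pos (p := p)
  have hlim : ∀ᶠ n : ℕ in atTop, ((n : ℝ) + 1) ^ r * ‖mahlerCoeff p L f n‖ ≤ ε := by
    have h2r : (0 : ℝ) < 2 ^ r := by positivity
    filter_upwards [hf.1.eventually_lt_const (div_pos hε h2r), eventually_ge_atTop 1] with n hn hn1
    have hn1' : (1 : ℝ) ≤ n := by exact_mod_cast hn1
    rw [lt_div_iff₀ h2r] at hn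
    have : ((n : ℝ) + 1) ^ r ≤ (n : ℝ) ^ r * 2 ^ r := by
      rw [← Real.mul_rpow (by positivity) (by norm_num)]
      exact Real.rpow_le_rpow (by positivity) (by linarith) hr
    calc _ ≤ (n : ℝ) ^ r * 2 ^ r * ‖mahlerCoeff p L f n‖ := by gcongr
      _ = (n : ℝ) ^ r * ‖mahlerCoeff p L f n‖ * 2 ^ r := by ring
      _ ≤ ε := hn.le
  obtain ⟨M, hM⟩ := hlim.exists_forall_of_atTop
  choose B hB hB' using fun i => exists_binom_poly p L i i le_rfl
  set T : ℤ_[p] → L := ∑ i ∈ Finset.range M, mahlerCoeff p L f i •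
    fun z => iotaL p L (binomQ p z i) with hT
  set Q : Polynomial L := ∑ i ∈ Finset.range M, Polynomial.C (mahlerCoeff p L f i) * B i with hQ
  have hTQ : LPn Q.natDegree 0 T := fun a => ⟨Q, le_rfl, fun z _ => by
    rw [hT, hQ, Polynomial.eval_finsetSum, Finset.sum_apply]
    exact Finset.sum_congr rfl fun i _ => by simp [hB']⟩
  have hTc : ∀ n, mahlerCoeff p L T n = if n < M then mahlerCoeff p L f n else 0 := by
    intro n
    rw [hT, mahlerCoeff_sum]
    simp only [mahlerCoeff_smul, mahlerCoeff_binomQ, mul_ite, mul_one, mul_zero]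
    rw [Finset.sum_ite_eq]
    simp
  obtain ⟨B0, hB0⟩ := hTQ.exists_bound
  have hB00 : 0 ≤ B0 := (norm_nonneg _).trans (hB0 0)
  obtain ⟨C1, hC1, hC1'⟩ := exists_crBd_of_LPn (r := (d : ℝ) + 1) p L (by positivity) Q.natDegree
  obtain ⟨C2, hC2, hC2'⟩ := exists_crBd_of_LPn p L hr (max Q.natDegree d)
  obtain ⟨C3, hC3, hC3'⟩ := exists_crBd_of_LPn p L hr Q.natDegree
  have hTr : IsCr p L r T := (hC3' 0 T B0 hTQ hB0).1
  have hT1 := hC1' 0 T B0 hTQ hB0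
  set C := C1 * (p : ℝ) ^ (((0 : ℕ) : ℝ) * ((d : ℝ) + 1)) * B0 with hCdef
  have hC : 0 ≤ C := by positivity
  choose g hg hgT using fun n => hT1.exists_LPn_approx (by positivity) le_rfl n
  have hsmall : Tendsto (fun n : ℕ => C2 * (p : ℝ) ^ ((n : ℝ) * r) *
      (C * (p : ℝ) ^ (-((n : ℝ) * ((d : ℝ) + 1))))) atTop (𝓝 0) := by
    have h1 : Tendsto (fun n : ℕ => C2 * C * ((p : ℝ) ^ (r - (d + 1))) ^ n) atTop
        (𝓝 (C2 * C * 0)) := by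
      refine (tendsto_pow_atTop_nhds_zero_of_lt_one (by positivity) ?_).const_mul _
      exact Real.rpow_lt_one_of_one_lt_of_neg one_lt_p (by linarith)
    rw [mul_zero] at h1
    refine h1.congr fun n => ?_
    rw [← Real.rpow_natCast, ← Real.rpow_mul hp.le,
      show (r - (d + 1)) * (n : ℝ) = (n : ℝ) * r + -((n : ℝ) * ((d : ℝ) + 1)) by ring,
      Real.rpow_add hp]
    ring
  obtain ⟨n, hn⟩ := (hsmall.eventually_le_const hε).exists
  refine ⟨n, g n, hg n, ?_⟩
  have h1 : CrBd r (f - T) ε := by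
    refine ⟨?_, fun n => ?_⟩
    · have := hf.add (hTr.smul (-1))
      simpa [sub_eq_add_neg] using this
    · rw [mahlerCoeff_sub, hTc]
      split_ifs with h
      · simpa using hε.le
      · rw [sub_zero]; exact hM n (by omega)
  have h2 : CrBd r (T - g n) ε :=
    (hC2' n _ _ ((hTQ.mono (le_max_left _ _) (Nat.zero_le n)).sub
      ((hg n).mono (le_max_right _ _) le_rfl)) (hgT n)).mono hn
  simpa using h1.add h2

/-- The numerical conditions on `α` and `χ = α p / β`, in terms of `r = val α` and `d = k - 2`. -/
structure Good (p : ℕ) {L : Type} [NontriviallyNormedField L] (α χ : L) (d : ℕ)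
    (r : ℝ) : Prop where
  norm_alpha : ‖α‖ = (p : ℝ) ^ (-r)
  norm_chi : ‖χ‖ = (p : ℝ) ^ ((d : ℝ) - 2 * r)
  r_pos : 0 < r
  r_lt : r < d + 1

section charts

variable {α χ : L} {d : ℕ}

lemma Good.alpha_ne_zero (h : Good p α χ d r) : α ≠ 0 := by
  have := p_pos (p := p)
  rw [← norm_pos_iff, h.norm_alpha]; positivity

lemma Good.chi_ne_zero (h : Good p α χ d r) : χ ≠ 0 := by
  have := p_pos (p := p)
  rw [← norm_pos_iff, h.norm_chi]; positivity

lemma Good.norm_alpha_zpow (h : Good p α χ d r) (n : ℤ) : ‖α ^ n‖ = (p : ℝ) ^ (-r * n) := by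
  rw [norm_zpow, h.norm_alpha, ← Real.rpow_intCast, ← Real.rpow_mul p_pos.le]

lemma Good.norm_chi_zpow (h : Good p α χ d r) (n : ℤ) :
    ‖χ ^ n‖ = (p : ℝ) ^ (((d : ℝ) - 2 * r) * n) := by
  rw [norm_zpow, h.norm_chi, ← Real.rpow_intCast, ← Real.rpow_mul p_pos.le]

/-- The product `(s z + t)^(d-j) (u z + w)^j` as a polynomial over `L`. -/
def linPoly (d j : ℕ) (s t u w : ℤ_[p]) : Polynomial L :=
  (Polynomial.C (iotaL p L s) * Polynomial.X + Polynomial.C (iotaL p L t)) ^ (d - j) *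
    (Polynomial.C (iotaL p L u) * Polynomial.X + Polynomial.C (iotaL p L w)) ^ j

lemma natDegree_linPoly {j : ℕ} (hj : j ≤ d) (s t u w : ℤ_[p]) :
    (linPoly d j s t u w : Polynomial L).natDegree ≤ d := by
  refine Polynomial.natDegree_mul_le.trans ?_
  have h1 : ∀ (a b : L) (n : ℕ),
      ((Polynomial.C a * Polynomial.X + Polynomial.C b) ^ n).natDegree ≤ n := fun a b n => by
    refine Polynomial.natDegree_pow_le.trans ?_
    calc _ ≤ n * 1 := Nat.mul_le_mul le_rfl Polynomial.natDegree_linear_le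
      _ = n := mul_one n
  have h2 := h1 (iotaL p L s) (iotaL p L t) (d - j)
  have h3 := h1 (iotaL p L u) (iotaL p L w) j
  omega

lemma eval_linPoly (j : ℕ) (s t u w z : ℤ_[p]) :
    (linPoly d j s t u w : Polynomial L).eval (iotaL p L (z : ℚ_[p])) =
      iotaL p L ((s * z + t : ℤ_[p]) : ℚ_[p]) ^ (d - j) *
        iotaL p L ((u * z + w : ℤ_[p]) : ℚ_[p]) ^ j := by
  simp [linPoly, iotaL]

lemma LPn.of_ite {d N : ℕ} {P : Polynomial L} (hP : P.natDegree ≤ d) {c : ℤ_[p] → Prop}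
    (hc : ∀ a z : ℤ_[p], ‖z - a‖ ≤ (p : ℝ) ^ (-(N : ℤ)) → c a → c z) :
    LPn d N (fun z => if c z then P.eval (iotaL p L (z : ℚ_[p])) else 0) := by
  intro a
  by_cases h : c a
  · exact ⟨P, hP, fun z hz => if_pos (hc a z hz h)⟩
  · refine ⟨0, by simp, fun z hz => ?_⟩
    dsimp only
    rw [if_neg fun h' => h (hc z a (by rwa [norm_sub_rev]) h'), Polynomial.eval_zero]

lemma norm_affine_sub_le (s t : ℤ_[p]) {a z : ℤ_[p]} {ρ : ℝ} (h : ‖z - a‖ ≤ ρ) :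
    ‖(s * z + t) - (s * a + t)‖ ≤ ρ := by
  rw [show (s * z + t) - (s * a + t) = s * (z - a) by ring, norm_mul]
  calc _ ≤ 1 * ‖z - a‖ := by gcongr; exact PadicInt.norm_le_one s
    _ ≤ ρ := by linarith

lemma norm_iotaL_coe_le_one (z : ℤ_[p]) : ‖iotaL p L (z : ℚ_[p])‖ ≤ 1 := by
  rw [norm_iotaL]; exact z.2

lemma norm_iotaL_coe (z : ℤ_[p]) : ‖iotaL p L (z : ℚ_[p])‖ = ‖z‖ := by
  rw [norm_iotaL]; rfl

/-- `ℓ^(d-j) m^j` on the region `‖m‖ ≤ p^(-ν)`. -/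
def nearFun (L : Type) [NontriviallyNormedField L] [NormedAlgebra ℚ_[p] L] (d j ν : ℕ)
    (s t u w : ℤ_[p]) : ℤ_[p] → L := fun z =>
  if ‖u * z + w‖ ≤ (p : ℝ) ^ (-(ν : ℤ)) then
    (linPoly d j s t u w : Polynomial L).eval (iotaL p L (z : ℚ_[p])) else 0

/-- `χ^(val ℓ) ℓ^(d-j) m^j` on the annulus `‖ℓ‖ = p^(-l)`. -/
def annFun (χ : L) (d j l : ℕ) (s t u w : ℤ_[p]) : ℤ_[p] → L := fun z =>
  if ‖s * z + t‖ = (p : ℝ) ^ (-(l : ℤ)) then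
    (Polynomial.C (χ ^ l) * linPoly d j s t u w).eval (iotaL p L (z : ℚ_[p])) else 0

/-- `χ^(val ℓ) ℓ^(d-j) m^j` on the region `0 < ‖ℓ‖ < p^(-ν)`. -/
def tailFun (χ : L) (d j ν : ℕ) (s t u w : ℤ_[p]) : ℤ_[p] → L := fun z =>
  if s * z + t ≠ 0 ∧ ‖s * z + t‖ < (p : ℝ) ^ (-(ν : ℤ)) then
    (Polynomial.C (χ ^ (s * z + t).valuation) * linPoly d j s t u w).eval
      (iotaL p L (z : ℚ_[p])) else 0

lemma LPn.nearFun {j : ℕ} (hj : j ≤ d) (ν : ℕ) (s t u w : ℤ_[p]) :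
    LPn d ν (nearFun L d j ν s t u w) := by
  refine LPn.of_ite (natDegree_linPoly hj s t u w) fun a z hz ha => ?_
  have := norm_add_le_of_le (norm_affine_sub_le u w hz) ha
  rwa [sub_add_cancel] at this

lemma norm_nearFun_le (j ν : ℕ) (s t u w z : ℤ_[p]) :
    ‖nearFun L d j ν s t u w z‖ ≤ (p : ℝ) ^ (-((ν : ℝ) * j)) := by
  have hp := p_pos (p := p)
  rw [Paper.nearFun]
  split_ifs with h
  · rw [eval_linPoly, norm_mul, norm_pow, norm_pow]
    calc _ ≤ 1 ^ (d - j) * ((p : ℝ) ^ (-(ν : ℤ))) ^ j := by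
          gcongr
          · exact norm_iotaL_coe_le_one _
          · rw [norm_iotaL_coe]; exact h
      _ = _ := by
        rw [one_pow, one_mul, ← Real.rpow_natCast, ← Real.rpow_intCast, ← Real.rpow_mul hp.le]
        push_cast; ring_nf
  · rw [norm_zero]; positivity

lemma LPn.annFun {j : ℕ} (hj : j ≤ d) (l : ℕ) (s t u w : ℤ_[p]) :
    LPn d (l + 1) (annFun χ d j l s t u w) := by
  refine LPn.of_ite ((Polynomial.natDegree_C_mul_le _ _).trans (natDegree_linPoly hj s t u w))
    fun a z hz ha => ?_
  rw [← ha]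
  have h1 := norm_affine_sub_le s t hz
  have h2 : (p : ℝ) ^ (-((l + 1 : ℕ) : ℤ)) < (p : ℝ) ^ (-(l : ℤ)) :=
    zpow_lt_zpow_right₀ one_lt_p (by push_cast; omega)
  have h3 := IsUltrametricDist.norm_add_eq_max_of_norm_ne_norm
    (x := (s * z + t) - (s * a + t)) (y := s * a + t) (by rw [ha]; exact (h1.trans_lt h2).ne)
  rw [sub_add_cancel] at h3
  rw [h3, max_eq_right]
  rw [ha]; exact h1.trans h2.le

lemma norm_annFun_le (h : Good p α χ d r) {j : ℕ} (hj : j ≤ d) (l : ℕ) (s t u w z : ℤ_[p]) :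
    ‖annFun χ d j l s t u w z‖ ≤ (p : ℝ) ^ ((l : ℝ) * ((j : ℝ) - 2 * r)) := by
  have hp := p_pos (p := p)
  rw [Paper.annFun]
  split_ifs with hz
  · rw [Polynomial.eval_mul, Polynomial.eval_C, eval_linPoly, ← zpow_natCast χ, norm_mul,
      h.norm_chi_zpow, norm_mul, norm_pow, norm_pow, norm_iotaL_coe, hz]
    calc _ ≤ (p : ℝ) ^ (((d : ℝ) - 2 * r) * ((l : ℤ) : ℝ)) *
          (((p : ℝ) ^ (-(l : ℤ))) ^ (d - j) * 1 ^ j) := by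
          gcongr
          exact norm_iotaL_coe_le_one _
      _ = _ := by
        rw [one_pow, mul_one, ← Real.rpow_natCast, ← Real.rpow_intCast, ← Real.rpow_mul hp.le,
          ← Real.rpow_add hp, Nat.cast_sub hj]
        push_cast; ring_nf
  · rw [norm_zero]; positivity

lemma tailFun_hasLimit (χ : L) (d j ν : ℕ) (s t u w z : ℤ_[p]) :
    Tendsto (fun M => ∑ l ∈ Finset.range M, annFun χ d j (ν + 1 + l) s t u w z) atTop
      (𝓝 (tailFun χ d j ν s t u w z)) := by
  by_cases hc : s * z + t ≠ 0 ∧ ‖s * z + t‖ < (p : ℝ) ^ (-(ν : ℤ))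
  · obtain ⟨h0, h1⟩ := hc
    rw [PadicInt.norm_eq_zpow_neg_valuation h0] at h1
    have h2 := (zpow_lt_zpow_iff_right₀ (one_lt_p (p := p))).1 h1
    obtain ⟨l0, hl0⟩ := Nat.exists_eq_add_of_le (show ν + 1 ≤ (s * z + t).valuation by omega)
    refine tendsto_const_nhds.congr' ?_
    filter_upwards [eventually_gt_atTop l0] with M hM
    rw [Finset.sum_eq_single_of_mem l0 (Finset.mem_range.2 hM)]
    · rw [tailFun, annFun, ← hl0, if_pos (PadicInt.norm_eq_zpow_neg_valuation h0),
        if_pos ⟨h0, by rw [PadicInt.norm_eq_zpow_neg_valuation h0]; exact h1⟩]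
    · intro l _ hne
      rw [annFun, if_neg]
      rw [PadicInt.norm_eq_zpow_neg_valuation h0]
      intro h3
      have h4 := zpow_right_injective₀ (p_pos (p := p)) (one_lt_p (p := p)).ne' h3
      omega
  · refine tendsto_const_nhds.congr fun M => ?_
    rw [tailFun, if_neg hc]
    symm
    refine Finset.sum_eq_zero fun l _ => ?_
    rw [annFun, if_neg]
    intro h3
    apply hc
    have hp : (0 : ℝ) < (p : ℝ) ^ (-((ν + 1 + l : ℕ) : ℤ)) := zpow_pos p_pos _
    refine ⟨fun h0 => ?_, ?_⟩
    · rw [h0, norm_zero] at h3; linarith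
    · rw [h3]
      exact zpow_lt_zpow_right₀ one_lt_p (by push_cast; omega)

lemma exists_chart_bounds (h : Good p α χ d r) :
    ∃ C : ℝ, 0 < C ∧ ∀ (s t u w : ℤ_[p]) (j : ℕ), j ≤ d →
      (∀ ν, CrBd r (nearFun L d j ν s t u w) (C * (p : ℝ) ^ ((ν : ℝ) * (r - j)))) ∧
      (∀ l, CrBd r (annFun χ d j l s t u w) (C * (p : ℝ) ^ (-((l : ℝ) * (r - j))))) ∧
      ((j : ℝ) < r → ∀ ν, CrBd r (tailFun χ d j ν s t u w)
        (C * (p : ℝ) ^ (-((ν : ℝ) * (r - j))))) := by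
  have hp := p_pos (p := p)
  obtain ⟨C, hC, hC'⟩ := exists_crBd_of_LPn p L h.r_pos.le d
  have hpr : 1 ≤ (p : ℝ) ^ r := Real.one_le_rpow one_lt_p.le h.r_pos.le
  have hann : ∀ (s t u w : ℤ_[p]) (j : ℕ), j ≤ d → ∀ l, CrBd r (annFun χ d j l s t u w)
      (C * (p : ℝ) ^ r * (p : ℝ) ^ (-((l : ℝ) * (r - j)))) := by
    intro s t u w j hj l
    refine (hC' (l + 1) _ _ (LPn.annFun hj l s t u w)
      (norm_annFun_le h hj l s t u w)).mono (le_of_eq ?_)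
    rw [mul_assoc, mul_assoc, ← Real.rpow_add hp, ← Real.rpow_add hp]
    push_cast; ring_nf
  refine ⟨C * (p : ℝ) ^ r, by positivity, fun s t u w j hj => ⟨fun ν => ?_, hann s t u w j hj,
    fun hjr ν => ?_⟩⟩
  · refine (hC' ν _ _ (LPn.nearFun hj ν s t u w) (norm_nearFun_le j ν s t u w)).mono ?_
    rw [mul_assoc, ← Real.rpow_add hp]
    calc _ = C * 1 * (p : ℝ) ^ ((ν : ℝ) * (r - j)) := by ring_nf
      _ ≤ _ := by gcongr
  · have hanti : ∀ a b : ℕ, a ≤ b →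
        (p : ℝ) ^ (-((b : ℝ) * (r - j))) ≤ (p : ℝ) ^ (-((a : ℝ) * (r - j))) := by
      intro a b hab
      refine Real.rpow_le_rpow_of_exponent_le one_lt_p.le (neg_le_neg ?_)
      exact mul_le_mul_of_nonneg_right (by exact_mod_cast hab) (by linarith)
    refine CrBd.of_tendsto h.r_pos.le
      (G := fun M => ∑ l ∈ Finset.range M, annFun χ d j (ν + 1 + l) s t u w)
      (ε := fun M => C * (p : ℝ) ^ r * (p : ℝ) ^ (-((M : ℝ) * (r - j)))) ?_ (fun M => ?_)
      (fun M M' hM => ?_) (fun z => ?_)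
    · have h1 : Tendsto (fun M : ℕ => C * (p : ℝ) ^ r * ((p : ℝ) ^ (-(r - j))) ^ M) atTop
          (𝓝 (C * (p : ℝ) ^ r * 0)) := by
        refine (tendsto_pow_atTop_nhds_zero_of_lt_one (by positivity) ?_).const_mul _
        exact Real.rpow_lt_one_of_one_lt_of_neg one_lt_p (by linarith)
      rw [mul_zero] at h1
      refine h1.congr fun M => ?_
      rw [← Real.rpow_natCast, ← Real.rpow_mul hp.le]
      ring_nf
    · refine CrBd.sum _ (by positivity) fun l _ => (hann s t u w j hj _).mono ?_
      exact mul_le_mul_of_nonneg_left (hanti _ _ (by omega)) (by positivity)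
    · have : (∑ l ∈ Finset.range M', annFun χ d j (ν + 1 + l) s t u w) -
          ∑ l ∈ Finset.range M, annFun χ d j (ν + 1 + l) s t u w =
          ∑ l ∈ Finset.range M' \ Finset.range M, annFun χ d j (ν + 1 + l) s t u w := by
        rw [← Finset.sum_sdiff (Finset.range_mono hM), add_sub_cancel_right]
      simp only [this]
      refine CrBd.sum _ (by positivity) fun l hl => (hann s t u w j hj _).mono ?_
      simp only [Finset.mem_sdiff, Finset.mem_range, not_lt] at hl
      exact mul_le_mul_of_nonneg_left (hanti _ _ (by omega)) (by positivity)
    · simpa only [Finset.sum_apply] using tailFun_hasLimit χ d j ν s t u w z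

end charts

section model

variable {α χ : L} {d : ℕ}

/-- The action of a `2 × 2` matrix on functions of two variables. -/
def act (α : L) (a b c e : ℚ_[p]) (F : ℚ_[p] → ℚ_[p] → L) : ℚ_[p] → ℚ_[p] → L := fun x y =>
  α ^ (-(a * e - b * c).valuation) * F (a * x + b * y) (c * x + e * y)

lemma valuation_eq_of_norm_eq {x y : ℚ_[p]} (h : ‖x‖ = ‖y‖) : x.valuation = y.valuation := by
  by_cases hx : x = 0
  · have hy : y = 0 := by rw [← norm_eq_zero, ← h, hx, norm_zero]
    rw [hx, hy]
  · have hy : y ≠ 0 := by rw [← norm_ne_zero_iff, ← h]; exact norm_ne_zero_iff.2 hx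
    rw [Padic.norm_eq_zpow_neg_valuation hx, Padic.norm_eq_zpow_neg_valuation hy] at h
    have := zpow_right_injective₀ (p_pos (p := p)) (one_lt_p (p := p)).ne' h
    omega

lemma valuation_eq_zero_of_norm {x : ℚ_[p]} (h : ‖x‖ = 1) : x.valuation = 0 := by
  have := valuation_eq_of_norm_eq (p := p) (x := x) (y := 1) (by simpa using h)
  simpa using this

lemma act_act (hα : α ≠ 0) {a b c e a' b' c' e' : ℚ_[p]} (h : a * e - b * c ≠ 0)
    (h' : a' * e' - b' * c' ≠ 0) (F : ℚ_[p] → ℚ_[p] → L) :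
    act α a b c e (act α a' b' c' e' F) =
      act α (a' * a + b' * c) (a' * b + b' * e) (c' * a + e' * c) (c' * b + e' * e) F := by
  funext x y
  simp only [act]
  rw [show (a' * a + b' * c) * (c' * b + e' * e) - (a' * b + b' * e) * (c' * a + e' * c) =
    (a * e - b * c) * (a' * e' - b' * c') by ring, Padic.valuation_mul h h', neg_add,
    zpow_add₀ hα, ← mul_assoc]
  congr 2 <;> ring

lemma act_one (F : ℚ_[p] → ℚ_[p] → L) : act α 1 0 0 1 F = F := by
  funext x y
  simp [act]

lemma act_add (a b c e : ℚ_[p]) (F G : ℚ_[p] → ℚ_[p] → L) :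
    act α a b c e (F + G) = act α a b c e F + act α a b c e G := by
  funext x y
  simp [act, mul_add]

lemma act_sub (a b c e : ℚ_[p]) (F G : ℚ_[p] → ℚ_[p] → L) :
    act α a b c e (F - G) = act α a b c e F - act α a b c e G := by
  funext x y
  simp [act, mul_sub]

lemma act_zero (a b c e : ℚ_[p]) : act α a b c e (0 : ℚ_[p] → ℚ_[p] → L) = 0 := by
  funext x y
  simp [act]

lemma act_smul (a b c e : ℚ_[p]) (k : L) (F : ℚ_[p] → ℚ_[p] → L) :
    act α a b c e (k • F) = k • act α a b c e F := by
  funext x y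
  simp [act, mul_left_comm]

/-- `χ^(val ℓ) ℓ^(d-j) m^j` where `‖m‖ ≤ ‖ℓ‖`, `ℓ ≠ 0`. -/
def Phi (χ : L) (d j : ℕ) : ℚ_[p] → ℚ_[p] → L := fun m ℓ =>
  if ℓ ≠ 0 ∧ ‖m‖ ≤ ‖ℓ‖ then χ ^ ℓ.valuation * iotaL p L ℓ ^ (d - j) * iotaL p L m ^ j else 0

/-- `χ^(val ℓ) ℓ^(d-j) m^j` where `‖m‖ ≤ p^n ‖ℓ‖`, `ℓ ≠ 0`. -/
def EFun (χ : L) (d j : ℕ) (n : ℤ) : ℚ_[p] → ℚ_[p] → L := fun m ℓ =>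
  if ℓ ≠ 0 ∧ ‖m‖ ≤ (p : ℝ) ^ n * ‖ℓ‖ then
    χ ^ ℓ.valuation * iotaL p L ℓ ^ (d - j) * iotaL p L m ^ j else 0

/-- `χ^(val ℓ) ℓ^(d-j) m^j` where `ℓ ≠ 0`. -/
def Psi (χ : L) (d j : ℕ) : ℚ_[p] → ℚ_[p] → L := fun m ℓ =>
  if ℓ ≠ 0 then χ ^ ℓ.valuation * iotaL p L ℓ ^ (d - j) * iotaL p L m ^ j else 0

/-- Homogeneity of weight `t ↦ χ^(val t) t^d`. -/
def Hom (χ : L) (d : ℕ) (F : ℚ_[p] → ℚ_[p] → L) : Prop :=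
  F 0 0 = 0 ∧ ∀ t : ℚ_[p], t ≠ 0 → ∀ x y, F (t * x) (t * y) =
    χ ^ t.valuation * iotaL p L t ^ d * F x y

/-- The chart of `F` at `0`. -/
def ch1 (F : ℚ_[p] → ℚ_[p] → L) : ℤ_[p] → L := fun z => F ((p : ℚ_[p]) * (z : ℚ_[p])) 1

/-- The chart of `F` at infinity. -/
def ch2 (F : ℚ_[p] → ℚ_[p] → L) : ℤ_[p] → L := fun z => F 1 (z : ℚ_[p])

/-- Both charts of `F` are of class `C^r` with norm at most `C`. -/
def BBd (r : ℝ) (F : ℚ_[p] → ℚ_[p] → L) (C : ℝ) : Prop := CrBd r (ch1 F) C ∧ CrBd r (ch2 F) C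

lemma BBd.add {F G : ℚ_[p] → ℚ_[p] → L} {C : ℝ} (hF : BBd r F C) (hG : BBd r G C) :
    BBd r (F + G) C := ⟨hF.1.add hG.1, hF.2.add hG.2⟩

lemma BBd.smul {F : ℚ_[p] → ℚ_[p] → L} {C : ℝ} (c : L) (hF : BBd r F C) :
    BBd r (c • F) (‖c‖ * C) := ⟨hF.1.smul c, hF.2.smul c⟩

lemma BBd.mono {F : ℚ_[p] → ℚ_[p] → L} {C C' : ℝ} (hF : BBd r F C) (h : C ≤ C') :
    BBd r F C' := ⟨hF.1.mono h, hF.2.mono h⟩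

lemma BBd.zero {C : ℝ} (hC : 0 ≤ C) : BBd r (0 : ℚ_[p] → ℚ_[p] → L) C :=
  ⟨CrBd.zero hC, CrBd.zero hC⟩

lemma EFun_eq_sum_annFun (j ν : ℕ) {s t u w z : ℤ_[p]}
    (h : ‖s * z + t‖ = 1 ∨ ‖u * z + w‖ = 1) :
    EFun χ d j ν ((u * z + w : ℤ_[p]) : ℚ_[p]) ((s * z + t : ℤ_[p]) : ℚ_[p]) =
      ∑ l ∈ Finset.range (ν + 1), annFun χ d j l s t u w z := by
  have hp := p_pos (p := p)
  have hp1 := one_lt_p (p := p)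
  by_cases h0 : s * z + t = 0
  · rw [EFun, if_neg (by simp [h0])]
    symm
    refine Finset.sum_eq_zero fun l _ => ?_
    rw [annFun, if_neg]
    rw [h0, norm_zero]
    exact (zpow_pos hp _).ne
  set v := (s * z + t).valuation with hv
  have hn : ‖s * z + t‖ = (p : ℝ) ^ (-(v : ℤ)) := PadicInt.norm_eq_zpow_neg_valuation h0
  have h0' : ((s * z + t : ℤ_[p]) : ℚ_[p]) ≠ 0 := fun h => h0 (Subtype.ext h)
  have hcond : ‖((u * z + w : ℤ_[p]) : ℚ_[p])‖ ≤
      (p : ℝ) ^ (ν : ℤ) * ‖((s * z + t : ℤ_[p]) : ℚ_[p])‖ ↔ v ≤ ν := by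
    rw [← PadicInt.norm_def, ← PadicInt.norm_def, hn, ← zpow_add₀ hp.ne']
    constructor
    · intro h1
      rcases h with h | h
      · rw [hn, zpow_eq_one_iff_right₀ hp.le hp1.ne'] at h
        omega
      · rw [h] at h1
        by_contra h2
        have := zpow_lt_one_of_neg₀ hp1 (show (ν : ℤ) + -(v : ℤ) < 0 by omega)
        linarith
    · intro h1
      exact (PadicInt.norm_le_one _).trans (one_le_zpow₀ hp1.le (by omega))
  have hval : ((s * z + t : ℤ_[p]) : ℚ_[p]).valuation = v := by
    rw [hv, PadicInt.valuation_coe]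
  have hann : ∀ l, annFun χ d j l s t u w z = if l = v then
      χ ^ v * (iotaL p L ((s * z + t : ℤ_[p]) : ℚ_[p]) ^ (d - j) *
        iotaL p L ((u * z + w : ℤ_[p]) : ℚ_[p]) ^ j) else 0 := by
    intro l
    rw [annFun, hn]
    have : (p : ℝ) ^ (-(v : ℤ)) = (p : ℝ) ^ (-(l : ℤ)) ↔ l = v := by
      constructor
      · intro h3
        have := zpow_right_injective₀ hp hp1.ne' h3
        omega
      · rintro rfl; rfl
    by_cases hl : l = v
    · rw [if_pos hl, if_pos (this.2 hl), Polynomial.eval_mul, Polynomial.eval_C, eval_linPoly, hl]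
    · rw [if_neg hl, if_neg (fun h => hl (this.1 h))]
  simp only [hann]
  rw [Finset.sum_ite_eq' (Finset.range (ν + 1)) v]
  by_cases hvν : v ≤ ν
  · rw [if_pos (Finset.mem_range.2 (by omega)), EFun, if_pos ⟨h0', hcond.2 hvν⟩, hval,
      zpow_natCast, mul_assoc]
  · rw [if_neg (by simpa using hvν), EFun, if_neg (fun h => hvν (hcond.1 h.2))]

lemma EFun_eq_nearFun (j ν : ℕ) (hν : 1 ≤ ν) {s t u w z : ℤ_[p]}
    (h : ‖s * z + t‖ = 1 ∨ ‖u * z + w‖ = 1) :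
    EFun χ d j (-(ν : ℤ)) ((u * z + w : ℤ_[p]) : ℚ_[p]) ((s * z + t : ℤ_[p]) : ℚ_[p]) =
      nearFun L d j ν s t u w z := by
  have hp := p_pos (p := p)
  have hp1 := one_lt_p (p := p)
  have hlt : (p : ℝ) ^ (-(ν : ℤ)) < 1 := zpow_lt_one_of_neg₀ hp1 (by omega)
  by_cases hc : ‖u * z + w‖ ≤ (p : ℝ) ^ (-(ν : ℤ))
  · have h1 : ‖s * z + t‖ = 1 := h.resolve_right (by linarith)
    have h1' : ‖((s * z + t : ℤ_[p]) : ℚ_[p])‖ = 1 := h1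
    rw [EFun, if_pos ⟨by rw [← norm_ne_zero_iff, h1']; norm_num, by
      rw [h1', mul_one]; exact hc⟩, nearFun, if_pos hc, eval_linPoly,
      valuation_eq_zero_of_norm h1', zpow_zero, one_mul]
  · rw [nearFun, if_neg hc, EFun, if_neg]
    rintro ⟨-, h2⟩
    apply hc
    refine le_trans (by exact h2) ?_
    have : ‖((s * z + t : ℤ_[p]) : ℚ_[p])‖ ≤ 1 := PadicInt.norm_le_one (s * z + t)
    exact mul_le_of_le_one_right (zpow_pos hp _).le this

lemma Psi_eq_EFun_add_tailFun (j ν : ℕ) {s t u w z : ℤ_[p]}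
    (h : ‖s * z + t‖ = 1 ∨ ‖u * z + w‖ = 1) :
    Psi χ d j ((u * z + w : ℤ_[p]) : ℚ_[p]) ((s * z + t : ℤ_[p]) : ℚ_[p]) =
      EFun χ d j ν ((u * z + w : ℤ_[p]) : ℚ_[p]) ((s * z + t : ℤ_[p]) : ℚ_[p]) +
        tailFun χ d j ν s t u w z := by
  have hp := p_pos (p := p)
  have hp1 := one_lt_p (p := p)
  by_cases h0 : s * z + t = 0
  · rw [EFun, if_neg (by simp [h0]), Psi, if_neg (by simp [h0]), tailFun, if_neg (by simp [h0]),
      add_zero]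
  have h0' : ((s * z + t : ℤ_[p]) : ℚ_[p]) ≠ 0 := fun h => h0 (Subtype.ext h)
  have hpν : (p : ℝ) ^ (ν : ℤ) * (p : ℝ) ^ (-(ν : ℤ)) = 1 := by
    rw [← zpow_add₀ hp.ne', add_neg_cancel, zpow_zero]
  have hpν0 : (0 : ℝ) < (p : ℝ) ^ (ν : ℤ) := zpow_pos hp _
  have hlt : (p : ℝ) ^ (-(ν : ℤ)) ≤ 1 := zpow_le_one_of_nonpos₀ hp1.le (by omega)
  have hcond : ‖((u * z + w : ℤ_[p]) : ℚ_[p])‖ ≤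
      (p : ℝ) ^ (ν : ℤ) * ‖((s * z + t : ℤ_[p]) : ℚ_[p])‖ ↔
      ¬ ‖s * z + t‖ < (p : ℝ) ^ (-(ν : ℤ)) := by
    rw [← PadicInt.norm_def, ← PadicInt.norm_def, not_lt]
    constructor
    · intro h1
      rcases h with h | h
      · rw [h]; exact hlt
      · rw [h, ← hpν] at h1
        exact le_of_mul_le_mul_left h1 hpν0
    · intro h1
      refine (PadicInt.norm_le_one _).trans ?_
      rw [← hpν]
      exact mul_le_mul_of_nonneg_left h1 hpν0.le
  rw [Psi, if_pos h0', EFun, tailFun]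
  by_cases hc : ‖s * z + t‖ < (p : ℝ) ^ (-(ν : ℤ))
  · rw [if_neg (fun h => hcond.1 h.2 hc), if_pos ⟨h0, hc⟩, zero_add, Polynomial.eval_mul,
      Polynomial.eval_C, eval_linPoly, PadicInt.valuation_coe, zpow_natCast, mul_assoc]
  · rw [if_pos ⟨h0', hcond.2 hc⟩, if_neg (fun h => hc h.2), add_zero]

/-- A property of functions holds for both charts of a unimodular transform of `G` as soon as it
holds for every unimodular affine substitution. -/
lemma chart_of_unimodular {R : (ℤ_[p] → L) → Prop} (G : ℚ_[p] → ℚ_[p] → L)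
    (hR : ∀ s t u w : ℤ_[p], (∀ z : ℤ_[p], ‖s * z + t‖ = 1 ∨ ‖u * z + w‖ = 1) →
      R fun z => G ((u * z + w : ℤ_[p]) : ℚ_[p]) ((s * z + t : ℤ_[p]) : ℚ_[p]))
    {s t u w : ℤ_[p]} (h : ‖s * w - t * u‖ = 1) :
    R (ch1 (act α (u : ℚ_[p]) w s t G)) ∧ R (ch2 (act α (u : ℚ_[p]) w s t G)) := by
  have hv : ((u : ℚ_[p]) * t - w * s).valuation = 0 := by
    refine valuation_eq_zero_of_norm ?_
    have : ((u : ℚ_[p]) * t - w * s) = ((-(s * w - t * u) : ℤ_[p]) : ℚ_[p]) := by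
      push_cast; ring
    rw [this, ← PadicInt.norm_def, norm_neg, h]
  have hmax : ∀ s t u w : ℤ_[p], ‖s * w - t * u‖ = 1 → ∀ x y : ℤ_[p], ‖x‖ = 1 ∨ ‖y‖ = 1 →
      ‖s * x + t * y‖ = 1 ∨ ‖u * x + w * y‖ = 1 := by
    intro s t u w h x y hxy
    have hlt : ∀ a b : ℤ_[p], ‖b‖ ≠ 1 → ‖a * b‖ < 1 := by
      intro a b hb
      rw [norm_mul]
      have h1 := PadicInt.norm_le_one a
      have h2 := lt_of_le_of_ne (PadicInt.norm_le_one b) hb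
      calc _ ≤ 1 * ‖b‖ := by gcongr
        _ < 1 := by linarith
    have hsub : ∀ a b : ℤ_[p], ‖a‖ < 1 → ‖b‖ < 1 → ‖a - b‖ < 1 := by
      intro a b ha hb
      rw [sub_eq_add_neg]
      exact (IsUltrametricDist.norm_add_le_max _ _).trans_lt (max_lt ha (by rwa [norm_neg]))
    by_contra! hcon
    have hx : ‖x‖ < 1 := by
      have : (s * w - t * u) * x = w * (s * x + t * y) - t * (u * x + w * y) := by ring
      have h2 : ‖(s * w - t * u) * x‖ = ‖x‖ := by rw [norm_mul, h, one_mul]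
      rw [← h2, this]
      exact hsub _ _ (hlt _ _ hcon.1) (hlt _ _ hcon.2)
    have hy : ‖y‖ < 1 := by
      have : (s * w - t * u) * y = s * (u * x + w * y) - u * (s * x + t * y) := by ring
      have h2 : ‖(s * w - t * u) * y‖ = ‖y‖ := by rw [norm_mul, h, one_mul]
      rw [← h2, this]
      exact hsub _ _ (hlt _ _ hcon.2) (hlt _ _ hcon.1)
    rcases hxy with h | h <;> linarith
  constructor
  · have := hR (s * p) t (u * p) w fun z => by
      have := hmax s t u w h (p * z) 1 (Or.inr (by simp))
      simpa [mul_assoc] using this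
    convert this using 2 with z
    simp [ch1, act, hv, mul_assoc]
  · have := hR t s w u fun z => by
      have := hmax s t u w h 1 z (Or.inl (by simp))
      simpa [add_comm] using this
    convert this using 2 with z
    simp [ch2, act, hv, add_comm]

end model

section normalForm

variable {α χ : L} {d : ℕ}

lemma norm_sub_mul_eq {m ℓ u : ℚ_[p]} (hℓ : ℓ ≠ 0) (h : ‖m‖ ≤ ‖ℓ‖) (hu : ‖u‖ < 1) :
    ‖ℓ - u * m‖ = ‖ℓ‖ := by
  refine Padic.norm_eq_of_norm_sub_lt_right ?_
  rw [show ℓ - u * m - ℓ = -(u * m) by ring, norm_neg, norm_mul]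
  have h0 : 0 < ‖ℓ‖ := norm_pos_iff.2 hℓ
  calc ‖u‖ * ‖m‖ ≤ ‖u‖ * ‖ℓ‖ := by gcongr
    _ < 1 * ‖ℓ‖ := by gcongr
    _ = ‖ℓ‖ := one_mul _

lemma norm_sub_mul_le {m ℓ u : ℚ_[p]} (h : ‖m‖ ≤ ‖ℓ‖) (hu : ‖u‖ ≤ 1) :
    ‖m - u * ℓ‖ ≤ ‖ℓ‖ := by
  rw [sub_eq_add_neg]
  refine (IsUltrametricDist.norm_add_le_max _ _).trans (max_le h ?_)
  rw [norm_neg, norm_mul]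
  exact mul_le_of_le_one_left (norm_nonneg _) hu

lemma Phi_eq_sum_sub_mul_right {j : ℕ} (hj : j ≤ d) {u : ℚ_[p]} (hu : ‖u‖ ≤ 1) (m ℓ : ℚ_[p]) :
    Phi χ d j m ℓ = ∑ i ∈ Finset.range (j + 1),
      (iotaL p L u ^ (j - i) * (j.choose i : L)) * Phi χ d i (m - u * ℓ) ℓ := by
  by_cases h : ℓ ≠ 0 ∧ ‖m‖ ≤ ‖ℓ‖
  · rw [Phi, if_pos h]
    have hm : iotaL p L m = iotaL p L (m - u * ℓ) + iotaL p L u * iotaL p L ℓ := by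
      rw [iotaL_sub, iotaL_mul]; ring
    rw [hm, add_pow, Finset.mul_sum]
    refine Finset.sum_congr rfl fun i hi => ?_
    have hi' : i ≤ j := by simpa [Nat.lt_succ_iff] using hi
    rw [Phi, if_pos ⟨h.1, norm_sub_mul_le h.2 hu⟩, show d - i = (d - j) + (j - i) by omega,
      pow_add, mul_pow]
    ring
  · rw [Phi, if_neg h]
    symm
    refine Finset.sum_eq_zero fun i _ => ?_
    rw [Phi, if_neg, mul_zero]
    rintro ⟨h1, h2⟩
    refine h ⟨h1, ?_⟩
    have := norm_sub_mul_le h2 (u := -u) (by rwa [norm_neg])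
    rwa [show m - u * ℓ - -u * ℓ = m by ring] at this

lemma Phi_eq_sum_sub_mul_left (j : ℕ) {u : ℚ_[p]} (hu : ‖u‖ < 1) (m ℓ : ℚ_[p]) :
    Phi χ d j m ℓ = ∑ i ∈ Finset.range (d - j + 1),
      (iotaL p L u ^ i * ((d - j).choose i : L)) * Phi χ d (j + i) m (ℓ - u * m) := by
  by_cases h : ℓ ≠ 0 ∧ ‖m‖ ≤ ‖ℓ‖
  · have hn := norm_sub_mul_eq h.1 h.2 hu
    rw [Phi, if_pos h]
    have hm : iotaL p L ℓ = iotaL p L u * iotaL p L m + iotaL p L (ℓ - u * m) := by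
      rw [iotaL_sub, iotaL_mul]; ring
    rw [hm, add_pow, Finset.mul_sum, Finset.sum_mul]
    refine Finset.sum_congr rfl fun i hi => ?_
    rw [Phi, if_pos ⟨by rw [← norm_ne_zero_iff, hn]; exact norm_ne_zero_iff.2 h.1, hn ▸ h.2⟩,
      valuation_eq_of_norm_eq hn, ← Nat.sub_sub, pow_add, mul_pow]
    ring
  · rw [Phi, if_neg h]
    symm
    refine Finset.sum_eq_zero fun i _ => ?_
    rw [Phi, if_neg, mul_zero]
    rintro ⟨h1, h2⟩
    have hn := norm_sub_mul_eq h1 h2 (u := -u) (by rwa [norm_neg])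
    rw [show ℓ - u * m - -u * m = ℓ by ring] at hn
    exact h ⟨by rw [← norm_ne_zero_iff, hn]; exact norm_ne_zero_iff.2 h1, hn ▸ h2⟩

lemma norm_iotaL_pow_mul_choose_le {u : ℚ_[p]} (hu : ‖u‖ ≤ 1) (i n m : ℕ) :
    ‖iotaL p L u ^ i * (n.choose m : L)‖ ≤ 1 := by
  rw [norm_mul, norm_pow, norm_iotaL]
  have h1 : ‖((n.choose m : ℕ) : L)‖ ≤ 1 := by
    simpa using norm_intCast_le_one (L := L) p (n.choose m)
  exact mul_le_one₀ (pow_le_one₀ (norm_nonneg _) hu) (norm_nonneg _) h1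

variable {Q : Set (ℚ_[p] → ℚ_[p] → L)}

lemma act_mem_of_sub_mul_right (hQ : IsOMod (L := L) Q) {a b c e u : ℚ_[p]} (hu : ‖u‖ ≤ 1)
    (h : ∀ j ≤ d, act α (a - u * c) (b - u * e) c e (Phi χ d j) ∈ Q) {j : ℕ} (hj : j ≤ d) :
    act α a b c e (Phi χ d j) ∈ Q := by
  have : act α a b c e (Phi χ d j) = ∑ i ∈ Finset.range (j + 1),
      (iotaL p L u ^ (j - i) * (j.choose i : L)) •
        act α (a - u * c) (b - u * e) c e (Phi χ d i) := by
    funext x y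
    simp only [act, Finset.sum_apply, Pi.smul_apply, smul_eq_mul]
    rw [Phi_eq_sum_sub_mul_right hj hu, Finset.mul_sum]
    refine Finset.sum_congr rfl fun i _ => ?_
    rw [show (a - u * c) * e - (b - u * e) * c = a * e - b * c by ring,
      show (a - u * c) * x + (b - u * e) * y = a * x + b * y - u * (c * x + e * y) by ring]
    ring
  rw [this]
  refine hQ.sum_mem _ _ fun i hi => hQ.smul_mem _ (norm_iotaL_pow_mul_choose_le hu _ _ _) _ (h i ?_)
  have : i ≤ j := by simpa [Nat.lt_succ_iff] using hi
  omega

lemma act_mem_of_sub_mul_left (hQ : IsOMod (L := L) Q) {a b c e u : ℚ_[p]} (hu : ‖u‖ < 1)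
    (h : ∀ j ≤ d, act α a b (c - u * a) (e - u * b) (Phi χ d j) ∈ Q) {j : ℕ} (hj : j ≤ d) :
    act α a b c e (Phi χ d j) ∈ Q := by
  have : act α a b c e (Phi χ d j) = ∑ i ∈ Finset.range (d - j + 1),
      (iotaL p L u ^ i * ((d - j).choose i : L)) •
        act α a b (c - u * a) (e - u * b) (Phi χ d (j + i)) := by
    funext x y
    simp only [act, Finset.sum_apply, Pi.smul_apply, smul_eq_mul]
    rw [Phi_eq_sum_sub_mul_left j hu, Finset.mul_sum]
    refine Finset.sum_congr rfl fun i _ => ?_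
    rw [show a * (e - u * b) - b * (c - u * a) = a * e - b * c by ring,
      show (c - u * a) * x + (e - u * b) * y = c * x + e * y - u * (a * x + b * y) by ring]
    ring
  rw [this]
  refine hQ.sum_mem _ _ fun i hi =>
    hQ.smul_mem _ (norm_iotaL_pow_mul_choose_le hu.le _ _ _) _ (h _ ?_)
  have : i ≤ d - j := by simpa [Nat.lt_succ_iff] using hi
  omega

/-- An `𝒪_L`-module containing all `act A Φ_j` with `A` the product of a diagonal matrix and a
unimodular one contains them all. -/
lemma act_mem_of_unimodular (hQ : IsOMod (L := L) Q)
    (h : ∀ s t u w : ℤ_[p], ‖s * w - t * u‖ = 1 → ∀ l m : ℚ_[p], l ≠ 0 → m ≠ 0 → ∀ j ≤ d,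
      act α (m * (u : ℚ_[p])) (m * w) (l * s) (l * t) (Phi χ d j) ∈ Q)
    {a b c e : ℚ_[p]} (hdet : a * e - b * c ≠ 0) {j : ℕ} (hj : j ≤ d) :
    act α a b c e (Phi χ d j) ∈ Q := by
  have hle : ∀ {x y : ℚ_[p]}, ‖x‖ ≤ ‖y‖ → ‖x / y‖ ≤ 1 := fun {x y} hxy => by
    rw [norm_div]; exact div_le_one_of_le₀ hxy (norm_nonneg _)
  have hdvd : ∀ {x y : ℚ_[p]}, ‖x‖ ≤ ‖y‖ → y ≠ 0 → ∃ w : ℤ_[p], y * (w : ℚ_[p]) = x :=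
    fun {x y} hxy hy => ⟨⟨x / y, hle hxy⟩, mul_div_cancel₀ x hy⟩
  have hlt : ∀ {x y : ℚ_[p]}, ‖x‖ < ‖y‖ → ‖x / y‖ < 1 := fun {x y} hxy => by
    rw [norm_div]; exact (div_lt_one ((norm_nonneg _).trans_lt hxy)).2 hxy
  have hne : ∀ {x y : ℚ_[p]}, ‖x‖ < ‖y‖ → y ≠ 0 := fun {x y} hxy =>
    norm_pos_iff.1 ((norm_nonneg _).trans_lt hxy)
  by_cases h1 : ‖b‖ ≤ ‖a‖ ∧ ‖c‖ < ‖a‖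
  · have ha := hne h1.2
    refine act_mem_of_sub_mul_left hQ (hlt h1.2) (fun j hj => ?_) hj
    obtain ⟨v, hv⟩ := hdvd h1.1 ha
    have := h 0 1 1 v (by simp) (e - c / a * b) a
      (fun h0 => hdet (by
        rw [show a * e - b * c = a * (e - c / a * b) by field_simp, h0, mul_zero])) ha j hj
    simpa [hv, div_mul_cancel₀, *] using this
  by_cases h2 : ‖a‖ ≤ ‖b‖ ∧ ‖e‖ < ‖b‖
  · have hb := hne h2.2
    refine act_mem_of_sub_mul_left hQ (hlt h2.2) (fun j hj => ?_) hj
    obtain ⟨v, hv⟩ := hdvd h2.1 hb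
    have := h 1 0 v 1 (by simp) (c - e / b * a) b
      (fun h0 => hdet (by
        rw [show a * e - b * c = -(b * (c - e / b * a)) by field_simp; ring, h0, mul_zero,
          neg_zero])) hb j hj
    simpa [hv, div_mul_cancel₀, *] using this
  by_cases h3 : ‖e‖ ≤ ‖c‖
  · have hc : c ≠ 0 := by
      rintro rfl
      rw [norm_zero, norm_le_zero_iff] at h3
      exact hdet (by rw [h3]; ring)
    have hac : ‖a‖ ≤ ‖c‖ := by
      by_contra! h4
      rcases le_total ‖b‖ ‖a‖ with h5 | h5
      · exact h1 ⟨h5, h4⟩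
      · exact h2 ⟨h5, h3.trans_lt (h4.trans_le h5)⟩
    refine act_mem_of_sub_mul_right hQ (hle hac) (fun j hj => ?_) hj
    obtain ⟨v, hv⟩ := hdvd h3 hc
    have := h 1 v 0 1 (by simp) c (b - a / c * e) hc
      (fun h0 => hdet (by
        rw [show a * e - b * c = -(c * (b - a / c * e)) by field_simp; ring, h0, mul_zero,
          neg_zero])) j hj
    simpa [hv, div_mul_cancel₀, *] using this
  · have he := hne (not_le.1 h3)
    have hbe : ‖b‖ ≤ ‖e‖ := by
      by_contra! h4
      rcases le_total ‖a‖ ‖b‖ with h5 | h5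
      · exact h2 ⟨h5, h4⟩
      · exact h1 ⟨h5, (not_le.1 h3).trans (h4.trans_le h5)⟩
    refine act_mem_of_sub_mul_right hQ (hle hbe) (fun j hj => ?_) hj
    obtain ⟨v, hv⟩ := hdvd (not_le.1 h3).le he
    have := h v 1 1 0 (by simp) e (a - b / e * c) he
      (fun h0 => hdet (by
        rw [show a * e - b * c = e * (a - b / e * c) by field_simp, h0, mul_zero])) j hj
    simpa [hv, div_mul_cancel₀, *] using this

lemma norm_eq_rpow {x : ℚ_[p]} (hx : x ≠ 0) : ‖x‖ = (p : ℝ) ^ (-(x.valuation : ℝ)) := by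
  rw [Padic.norm_eq_zpow_neg_valuation hx, ← Real.rpow_intCast]
  push_cast; rfl

/-- A diagonal rescaling of `Φ_j` is a multiple of `E_{n,j}` by a scalar of known norm. -/
lemma exists_act_Phi_eq (h : Good p α χ d r) {j : ℕ} (hj : j ≤ d) {l m : ℚ_[p]} (hl : l ≠ 0)
    (hm : m ≠ 0) : ∃ κ : L, ‖κ‖ = (p : ℝ) ^ (((m.valuation - l.valuation : ℤ) : ℝ) * (r - j)) ∧
      ∀ s t u w : ℤ_[p], ‖s * w - t * u‖ = 1 →
        act α (m * (u : ℚ_[p])) (m * w) (l * s) (l * t) (Phi χ d j) =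
          κ • act α (u : ℚ_[p]) w s t (EFun χ d j (m.valuation - l.valuation)) := by
  have hp := p_pos (p := p)
  refine ⟨α ^ (-(m.valuation + l.valuation)) * (χ ^ l.valuation * iotaL p L l ^ (d - j) *
    iotaL p L m ^ j), ?_, fun s t u w hst => ?_⟩
  · rw [norm_mul, norm_mul, norm_mul, h.norm_alpha_zpow, h.norm_chi_zpow, norm_pow, norm_pow,
      norm_iotaL, norm_iotaL, norm_eq_rpow hl, norm_eq_rpow hm, ← Real.rpow_natCast,
      ← Real.rpow_natCast, ← Real.rpow_mul hp.le, ← Real.rpow_mul hp.le, ← Real.rpow_add hp,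
      ← Real.rpow_add hp, ← Real.rpow_add hp, Nat.cast_sub hj]
    congr 1
    push_cast
    ring
  · have hdet : ‖(u : ℚ_[p]) * t - w * s‖ = 1 := by
      have : ((u : ℚ_[p]) * t - w * s) = ((-(s * w - t * u) : ℤ_[p]) : ℚ_[p]) := by
        push_cast; ring
      rw [this, ← PadicInt.norm_def, norm_neg, hst]
    have hdet0 : (u : ℚ_[p]) * t - w * s ≠ 0 := norm_ne_zero_iff.1 (by rw [hdet]; norm_num)
    funext x y
    simp only [act, Pi.smul_apply, smul_eq_mul]
    rw [show m * u * (l * t) - m * w * (l * s) = m * (l * ((u : ℚ_[p]) * t - w * s)) by ring,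
      Padic.valuation_mul hm (mul_ne_zero hl hdet0), Padic.valuation_mul hl hdet0,
      valuation_eq_zero_of_norm hdet, add_zero, neg_zero, zpow_zero, one_mul,
      show m * u * x + m * w * y = m * (u * x + w * y) by ring,
      show l * s * x + l * t * y = l * (s * x + t * y) by ring]
    set A : ℚ_[p] := u * x + w * y
    set B : ℚ_[p] := s * x + t * y
    have hiff : (l * B ≠ 0 ∧ ‖m * A‖ ≤ ‖l * B‖) ↔
        (B ≠ 0 ∧ ‖A‖ ≤ (p : ℝ) ^ (m.valuation - l.valuation) * ‖B‖) := by
      refine and_congr (by simp [hl]) ?_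
      have hml : (p : ℝ) ^ (m.valuation - l.valuation) = ‖l‖ / ‖m‖ := by
        rw [Padic.norm_eq_zpow_neg_valuation hl, Padic.norm_eq_zpow_neg_valuation hm,
          ← zpow_sub₀ hp.ne']
        congr 1; ring
      rw [hml, norm_mul, norm_mul, div_mul_eq_mul_div, le_div_iff₀ (norm_pos_iff.2 hm), mul_comm]
    rw [Phi, EFun]
    by_cases hc : l * B ≠ 0 ∧ ‖m * A‖ ≤ ‖l * B‖
    · rw [if_pos hc, if_pos (hiff.1 hc), Padic.valuation_mul hl (hiff.1 hc).1,
        zpow_add₀ h.chi_ne_zero, iotaL_mul, iotaL_mul, mul_pow, mul_pow]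
      ring
    · rw [if_neg hc, if_neg (fun h => hc (hiff.2 h)), mul_zero, mul_zero]

end normalForm

section lattice

variable {α χ : L} {d : ℕ}

/-- The transforms of the functions `Φ_j`, `j ≤ d`. -/
def PhiGen (α χ : L) (d : ℕ) : Set (ℚ_[p] → ℚ_[p] → L) :=
  {F | ∃ (a b c e : ℚ_[p]) (j : ℕ), a * e - b * c ≠ 0 ∧ j ≤ d ∧ F = act α a b c e (Phi χ d j)}

/-- The homogeneous model of the locally algebraic representation. -/
def PiF (p : ℕ) [Fact p.Prime] {L : Type} [NontriviallyNormedField L] [NormedAlgebra ℚ_[p] L]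
    (α χ : L) (d : ℕ) : Submodule L (ℚ_[p] → ℚ_[p] → L) := Submodule.span L (PhiGen α χ d)

/-- The `𝒪_L`-module generated by the transforms of the functions `Φ_j`. -/
def LamF (p : ℕ) [Fact p.Prime] {L : Type} [NontriviallyNormedField L] [NormedAlgebra ℚ_[p] L]
    (α χ : L) (d : ℕ) : Set (ℚ_[p] → ℚ_[p] → L) :=
  {F | ∀ S : Set (ℚ_[p] → ℚ_[p] → L), IsOMod (L := L) S → PhiGen α χ d ⊆ S → F ∈ S}

lemma isOMod_LamF : IsOMod (L := L) (LamF p α χ d) where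
  zero_mem := fun _ hS _ => hS.zero_mem
  add_mem := fun f hf g hg S hS h => hS.add_mem f (hf S hS h) g (hg S hS h)
  smul_mem := fun c hc f hf S hS h => hS.smul_mem c hc f (hf S hS h)

lemma PhiGen_subset_LamF : PhiGen α χ d ⊆ LamF p α χ d := fun _ hF _ _ h => h hF

lemma act_Phi_mem_LamF {a b c e : ℚ_[p]} {j : ℕ} (h : a * e - b * c ≠ 0) (hj : j ≤ d) :
    act α a b c e (Phi χ d j) ∈ LamF p α χ d := PhiGen_subset_LamF ⟨a, b, c, e, j, h, hj, rfl⟩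

lemma isOMod_submodule {V : Type} [AddCommGroup V] [Module L V] (W : Submodule L V) :
    IsOMod (L := L) (W : Set V) where
  zero_mem := W.zero_mem
  add_mem := fun _ hf _ hg => W.add_mem hf hg
  smul_mem := fun c _ _ hf => W.smul_mem c hf

lemma LamF_subset_PiF {F : ℚ_[p] → ℚ_[p] → L} (hF : F ∈ LamF p α χ d) : F ∈ PiF p α χ d :=
  hF _ (isOMod_submodule _) Submodule.subset_span

lemma isOMod_act_preimage {S : Set (ℚ_[p] → ℚ_[p] → L)} (hS : IsOMod (L := L) S)
    (a b c e : ℚ_[p]) : IsOMod (L := L) {F | act α a b c e F ∈ S} where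
  zero_mem := by simpa [act_zero] using hS.zero_mem
  add_mem := fun f hf g hg => by
    simp only [Set.mem_ofPred_eq, act_add] at *
    exact hS.add_mem _ hf _ hg
  smul_mem := fun c hc f hf => by
    simp only [Set.mem_ofPred_eq, act_smul] at *
    exact hS.smul_mem _ hc _ hf

lemma act_mem_PhiGen (hα : α ≠ 0) {a b c e : ℚ_[p]} (h : a * e - b * c ≠ 0)
    {F : ℚ_[p] → ℚ_[p] → L} (hF : F ∈ PhiGen α χ d) : act α a b c e F ∈ PhiGen α χ d := by
  obtain ⟨a', b', c', e', j, h', hj, rfl⟩ := hF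
  refine ⟨_, _, _, _, j, ?_, hj, act_act hα h h' _⟩
  rw [show (a' * a + b' * c) * (c' * b + e' * e) - (a' * b + b' * e) * (c' * a + e' * c) =
    (a * e - b * c) * (a' * e' - b' * c') by ring]
  exact mul_ne_zero h h'

lemma act_mem_LamF (hα : α ≠ 0) {a b c e : ℚ_[p]} (h : a * e - b * c ≠ 0)
    {F : ℚ_[p] → ℚ_[p] → L} (hF : F ∈ LamF p α χ d) : act α a b c e F ∈ LamF p α χ d :=
  hF _ (isOMod_act_preimage isOMod_LamF a b c e)
    fun _ hG => PhiGen_subset_LamF (act_mem_PhiGen hα h hG)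

lemma exists_forall_smul_mem_LamF {F : ℚ_[p] → ℚ_[p] → L} (hF : F ∈ PiF p α χ d) :
    ∃ δ : ℝ, 0 < δ ∧ ∀ c : L, ‖c‖ ≤ δ → c • F ∈ LamF p α χ d := by
  induction hF using Submodule.span_induction with
  | mem F hF => exact ⟨1, one_pos, fun c hc => isOMod_LamF.smul_mem c hc _ (PhiGen_subset_LamF hF)⟩
  | zero => exact ⟨1, one_pos, fun c _ => by rw [smul_zero]; exact isOMod_LamF.zero_mem⟩
  | add F G _ _ hF hG =>
    obtain ⟨δ, hδ, h⟩ := hF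
    obtain ⟨δ', hδ', h'⟩ := hG
    refine ⟨min δ δ', lt_min hδ hδ', fun c hc => ?_⟩
    rw [smul_add]
    exact isOMod_LamF.add_mem _ (h c (hc.trans (min_le_left _ _))) _
      (h' c (hc.trans (min_le_right _ _)))
  | smul a F _ hF =>
    obtain ⟨δ, hδ, h⟩ := hF
    refine ⟨δ / (‖a‖ + 1), by positivity, fun c hc => ?_⟩
    rw [smul_smul]
    refine h _ ?_
    rw [norm_mul]
    rw [le_div_iff₀ (by positivity)] at hc
    nlinarith [norm_nonneg a, norm_nonneg c]

lemma Hom.add {F G : ℚ_[p] → ℚ_[p] → L} (hF : Hom χ d F) (hG : Hom χ d G) : Hom χ d (F + G) :=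
  ⟨by simp [hF.1, hG.1], fun t ht x y => by simp [hF.2 t ht, hG.2 t ht, mul_add]⟩

lemma Hom.smul {F : ℚ_[p] → ℚ_[p] → L} (c : L) (hF : Hom χ d F) : Hom χ d (c • F) :=
  ⟨by simp [hF.1], fun t ht x y => by simp [hF.2 t ht, mul_left_comm]⟩

lemma Hom.zero : Hom χ d (0 : ℚ_[p] → ℚ_[p] → L) := ⟨rfl, fun t _ x y => by simp⟩

lemma Hom.sub {F G : ℚ_[p] → ℚ_[p] → L} (hF : Hom χ d F) (hG : Hom χ d G) : Hom χ d (F - G) := by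
  have := hF.add (hG.smul (-1))
  simpa [sub_eq_add_neg] using this

lemma Hom.act {F : ℚ_[p] → ℚ_[p] → L} (hF : Hom χ d F) (a b c e : ℚ_[p]) :
    Hom χ d (act α a b c e F) := by
  refine ⟨by simp [Paper.act, hF.1], fun t ht x y => ?_⟩
  simp only [Paper.act]
  rw [show a * (t * x) + b * (t * y) = t * (a * x + b * y) by ring,
    show c * (t * x) + e * (t * y) = t * (c * x + e * y) by ring, hF.2 t ht]
  ring

lemma hom_Psi (hχ : χ ≠ 0) {j : ℕ} (hj : j ≤ d) : Hom χ d (Psi χ d j : ℚ_[p] → ℚ_[p] → L) := by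
  refine ⟨by simp [Psi], fun t ht x y => ?_⟩
  rw [Psi, Psi]
  by_cases hy : y = 0
  · simp [hy]
  · rw [if_pos (mul_ne_zero ht hy), if_pos hy, Padic.valuation_mul ht hy, zpow_add₀ hχ, iotaL_mul,
      iotaL_mul, mul_pow, mul_pow, show iotaL p L t ^ d = iotaL p L t ^ (d - j) * iotaL p L t ^ j by
        rw [← pow_add]; congr 1; omega]
    ring

lemma hom_Phi (hχ : χ ≠ 0) {j : ℕ} (hj : j ≤ d) : Hom χ d (Phi χ d j : ℚ_[p] → ℚ_[p] → L) := by
  have h : ∀ x y : ℚ_[p], (Phi χ d j x y : L) = if ‖x‖ ≤ ‖y‖ then Psi χ d j x y else 0 := by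
    intro x y
    rw [Phi, Psi]
    split_ifs <;> tauto
  refine ⟨by simp [Phi], fun t ht x y => ?_⟩
  have hiff : ‖t * x‖ ≤ ‖t * y‖ ↔ ‖x‖ ≤ ‖y‖ := by
    rw [norm_mul, norm_mul, mul_le_mul_iff_right₀ (norm_pos_iff.2 ht)]
  rw [h, h, (hom_Psi hχ hj).2 t ht]
  simp only [hiff]
  split_ifs <;> simp

lemma hom_of_mem_PiF (hχ : χ ≠ 0) {F : ℚ_[p] → ℚ_[p] → L} (hF : F ∈ PiF p α χ d) :
    Hom χ d F := by
  induction hF using Submodule.span_induction with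
  | mem F hF =>
    obtain ⟨a, b, c, e, j, -, hj, rfl⟩ := hF
    exact (hom_Phi hχ hj).act a b c e
  | zero => exact Hom.zero
  | add F G _ _ hF hG => exact hF.add hG
  | smul a F _ hF => exact hF.smul a

lemma LPn.sum {ι : Type*} (s : Finset ι) {N : ℕ} {f : ι → ℤ_[p] → L}
    (h : ∀ i ∈ s, LPn d N (f i)) : LPn d N (∑ i ∈ s, f i) := by
  induction s using Finset.induction_on with
  | empty => simpa using LPn.zero d N
  | insert a s ha ih =>
    rw [Finset.sum_insert ha]
    exact (h a (by simp)).add (ih fun i hi => h i (by simp [hi]))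

/-- Both charts of an element of `PiF` are locally polynomial. -/
lemma exists_LPn_of_mem_PiF (h : Good p α χ d r) {F : ℚ_[p] → ℚ_[p] → L}
    (hF : F ∈ PiF p α χ d) : ∃ N, LPn d N (ch1 F) ∧ LPn d N (ch2 F) := by
  have hadd : ∀ F G : ℚ_[p] → ℚ_[p] → L, (∃ N, LPn d N (ch1 F) ∧ LPn d N (ch2 F)) →
      (∃ N, LPn d N (ch1 G) ∧ LPn d N (ch2 G)) →
      ∃ N, LPn d N (ch1 (F + G)) ∧ LPn d N (ch2 (F + G)) := by
    rintro F G ⟨N, h1, h2⟩ ⟨N', h1', h2'⟩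
    refine ⟨max N N', ?_, ?_⟩
    · exact (h1.mono le_rfl (le_max_left _ _)).add (h1'.mono le_rfl (le_max_right _ _))
    · exact (h2.mono le_rfl (le_max_left _ _)).add (h2'.mono le_rfl (le_max_right _ _))
  have hsmul : ∀ (c : L) (F : ℚ_[p] → ℚ_[p] → L), (∃ N, LPn d N (ch1 F) ∧ LPn d N (ch2 F)) →
      ∃ N, LPn d N (ch1 (c • F)) ∧ LPn d N (ch2 (c • F)) := by
    rintro c F ⟨N, h1, h2⟩
    exact ⟨N, h1.smul c, h2.smul c⟩
  have hzero : ∃ N, LPn d N (ch1 (0 : ℚ_[p] → ℚ_[p] → L)) ∧ LPn d N (ch2 (0 : ℚ_[p] → ℚ_[p] → L)) :=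
    ⟨0, LPn.zero _ _, LPn.zero _ _⟩
  induction hF using Submodule.span_induction with
  | mem F hF =>
    obtain ⟨a, b, c, e, j, hdet, hj, rfl⟩ := hF
    refine act_mem_of_unimodular (Q := {F | ∃ N, LPn d N (ch1 F) ∧ LPn d N (ch2 F)})
      ⟨hzero, fun F hF G hG => hadd F G hF hG, fun c _ F hF => hsmul c F hF⟩ ?_ hdet hj
    intro s t u w hst l m hl hm j hj
    obtain ⟨κ, -, hκ⟩ := exists_act_Phi_eq h hj hl hm
    rw [hκ s t u w hst]
    refine hsmul _ _ ?_
    by_cases hn : 0 ≤ m.valuation - l.valuation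
    · obtain ⟨ν, hν⟩ := Int.eq_ofNat_of_zero_le hn
      rw [hν]
      refine ⟨ν + 1, chart_of_unimodular (R := LPn d (ν + 1)) _ (fun s t u w hz => ?_) hst⟩
      have : (fun z : ℤ_[p] => EFun χ d j ν ((u * z + w : ℤ_[p]) : ℚ_[p])
          ((s * z + t : ℤ_[p]) : ℚ_[p])) =
          ∑ l ∈ Finset.range (ν + 1), annFun χ d j l s t u w := by
        funext z
        rw [EFun_eq_sum_annFun j ν (hz z), Finset.sum_apply]
      rw [this]
      refine LPn.sum _ fun l hl => (LPn.annFun hj l s t u w).mono le_rfl ?_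
      have := Finset.mem_range.1 hl
      omega
    · obtain ⟨ν, hν⟩ := Int.eq_ofNat_of_zero_le (show 0 ≤ -(m.valuation - l.valuation) by omega)
      rw [show m.valuation - l.valuation = -(ν : ℤ) by omega]
      refine ⟨ν, chart_of_unimodular (R := LPn d ν) _ (fun s t u w hz => ?_) hst⟩
      have : (fun z : ℤ_[p] => EFun χ d j (-(ν : ℤ)) ((u * z + w : ℤ_[p]) : ℚ_[p])
          ((s * z + t : ℤ_[p]) : ℚ_[p])) = nearFun L d j ν s t u w := by
        funext z
        rw [EFun_eq_nearFun j ν (by omega) (hz z)]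
      rw [this]
      exact LPn.nearFun hj ν s t u w
  | zero => exact hzero
  | add F G _ _ hF hG => exact hadd F G hF hG
  | smul a F _ hF => exact hsmul a F hF

/-- The span of the unimodular transforms of the functions `Ψ_i`, `i < r`. -/
def SpecF (p : ℕ) [Fact p.Prime] {L : Type} [NontriviallyNormedField L] [NormedAlgebra ℚ_[p] L]
    (α χ : L) (d : ℕ) (r : ℝ) : Submodule L (ℚ_[p] → ℚ_[p] → L) :=
  Submodule.span L {F | ∃ (s t u w : ℤ_[p]) (i : ℕ), ‖s * w - t * u‖ = 1 ∧ (i : ℝ) < r ∧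
    F = act α (u : ℚ_[p]) w s t (Psi χ d i)}

lemma Good.le_of_lt (h : Good p α χ d r) {i : ℕ} (hi : (i : ℝ) < r) : i ≤ d := by
  have : (i : ℝ) < d + 1 := hi.trans h.r_lt
  exact_mod_cast Nat.lt_succ_iff.1 (by exact_mod_cast this)

lemma hom_of_mem_SpecF (h : Good p α χ d r) {F : ℚ_[p] → ℚ_[p] → L} (hF : F ∈ SpecF p α χ d r) :
    Hom χ d F := by
  induction hF using Submodule.span_induction with
  | mem F hF =>
    obtain ⟨s, t, u, w, i, -, hi, rfl⟩ := hF
    exact (hom_Psi h.chi_ne_zero (h.le_of_lt hi)).act _ _ _ _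
  | zero => exact Hom.zero
  | add F G _ _ hF hG => exact hF.add hG
  | smul a F _ hF => exact hF.smul a

lemma exists_tail_bound (h : Good p α χ d r) : ∃ C : ℝ, 0 < C ∧
    ∀ s t u w : ℤ_[p], ‖s * w - t * u‖ = 1 → ∀ i : ℕ, (i : ℝ) < r → ∀ ν : ℕ,
      BBd r (act α (u : ℚ_[p]) w s t (Psi χ d i) - act α (u : ℚ_[p]) w s t (EFun χ d i ν))
        (C * (p : ℝ) ^ (-((ν : ℝ) * (r - i)))) := by
  obtain ⟨C, hC, hb⟩ := exists_chart_bounds h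
  refine ⟨C, hC, fun s t u w hst i hi ν => ?_⟩
  rw [← act_sub]
  refine chart_of_unimodular (R := fun f => CrBd r f (C * (p : ℝ) ^ (-((ν : ℝ) * (r - i))))) _
    (fun s t u w hz => ?_) hst
  convert (hb s t u w i (h.le_of_lt hi)).2.2 hi ν using 2 with z
  rw [Pi.sub_apply, Pi.sub_apply, Psi_eq_EFun_add_tailFun i ν (hz z), add_sub_cancel_left]

/-- Up to special functions, `LamF` is bounded. -/
lemma exists_BBd_sub_of_mem_LamF (h : Good p α χ d r) : ∃ C : ℝ, 0 < C ∧
    ∀ F ∈ LamF p α χ d, ∃ G ∈ SpecF p α χ d r, BBd r (F - G) C := by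
  have hp := p_pos (p := p)
  obtain ⟨C₁, hC₁, hb⟩ := exists_chart_bounds h
  obtain ⟨C₂, hC₂, ht⟩ := exists_tail_bound h
  set C := max C₁ C₂ with hCdef
  have hC : 0 < C := lt_max_of_lt_left hC₁
  refine ⟨C, hC, fun F hF => ?_⟩
  have hO : IsOMod (L := L) {F | ∃ G ∈ SpecF p α χ d r, BBd r (F - G) C} := by
    refine ⟨⟨0, zero_mem _, by rw [sub_zero]; exact BBd.zero hC.le⟩, ?_, ?_⟩
    · rintro F ⟨G, hG, hb⟩ F' ⟨G', hG', hb'⟩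
      refine ⟨G + G', add_mem hG hG', ?_⟩
      rw [add_sub_add_comm]
      exact hb.add hb'
    · rintro c hc F ⟨G, hG, hb⟩
      refine ⟨c • G, Submodule.smul_mem _ c hG, ?_⟩
      rw [← smul_sub]
      exact (hb.smul c).mono (mul_le_of_le_one_left hC.le hc)
  refine hF _ hO ?_
  rintro F ⟨a, b, c, e, j, hdet, hj, rfl⟩
  refine act_mem_of_unimodular hO ?_ hdet hj
  intro s t u w hst l m hl hm j hj
  obtain ⟨κ, hκn, hκ⟩ := exists_act_Phi_eq h hj hl hm
  rw [hκ s t u w hst]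
  by_cases hn : 0 ≤ m.valuation - l.valuation
  · obtain ⟨ν, hν⟩ := Int.eq_ofNat_of_zero_le hn
    rw [hν] at hκn ⊢
    by_cases hjr : (j : ℝ) < r
    · refine ⟨κ • act α (u : ℚ_[p]) w s t (Psi χ d j), Submodule.smul_mem _ _
        (Submodule.subset_span ⟨s, t, u, w, j, hst, hjr, rfl⟩), ?_⟩
      have := ((ht s t u w hst j hjr ν).smul (-κ))
      rw [← smul_sub, ← neg_sub, smul_neg, ← neg_smul]
      refine this.mono ?_
      rw [norm_neg, hκn, mul_left_comm, ← Real.rpow_add hp]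
      simp [hCdef]
    · refine ⟨0, zero_mem _, ?_⟩
      rw [sub_zero, ← act_smul]
      refine chart_of_unimodular (R := fun f => CrBd r f C) _ (fun s t u w hz => ?_) hst
      have : (fun z : ℤ_[p] => (κ • EFun χ d j ν) ((u * z + w : ℤ_[p]) : ℚ_[p])
          ((s * z + t : ℤ_[p]) : ℚ_[p])) =
          ∑ l ∈ Finset.range (ν + 1), κ • annFun χ d j l s t u w := by
        funext z
        rw [Pi.smul_apply, Pi.smul_apply, EFun_eq_sum_annFun j ν (hz z), Finset.sum_apply,
          Finset.smul_sum]
        rfl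
      rw [this]
      refine CrBd.sum _ hC.le fun l hl => (((hb s t u w j hj).2.1 l).smul κ).mono ?_
      have hl' : (l : ℝ) ≤ ν := by
        have := Finset.mem_range.1 hl
        exact_mod_cast (by omega : l ≤ ν)
      rw [hκn, mul_left_comm, ← Real.rpow_add hp]
      refine (mul_le_of_le_one_right hC₁.le ?_).trans (le_max_left _ _)
      refine Real.rpow_le_one_of_one_le_of_nonpos one_lt_p.le ?_
      push_cast
      nlinarith
  · obtain ⟨ν, hν⟩ := Int.eq_ofNat_of_zero_le (show 0 ≤ -(m.valuation - l.valuation) by omega)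
    rw [show m.valuation - l.valuation = -(ν : ℤ) by omega] at hκn ⊢
    refine ⟨0, zero_mem _, ?_⟩
    rw [sub_zero, ← act_smul]
    refine chart_of_unimodular (R := fun f => CrBd r f C) _ (fun s t u w hz => ?_) hst
    have : (fun z : ℤ_[p] => (κ • EFun χ d j (-(ν : ℤ))) ((u * z + w : ℤ_[p]) : ℚ_[p])
        ((s * z + t : ℤ_[p]) : ℚ_[p])) = κ • nearFun L d j ν s t u w := by
      funext z
      rw [Pi.smul_apply, Pi.smul_apply, EFun_eq_nearFun j ν (by omega) (hz z)]
      rfl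
    rw [this]
    refine (((hb s t u w j hj).1 ν).smul κ).mono ?_
    rw [hκn, mul_left_comm, ← Real.rpow_add hp]
    push_cast
    rw [neg_mul, neg_add_cancel, Real.rpow_zero, mul_one]
    exact le_max_left _ _

lemma tendsto_rpow_neg_mul {s : ℝ} (hs : 0 < s) (C : ℝ) :
    Tendsto (fun ν : ℕ => C * (p : ℝ) ^ (-((ν : ℝ) * s))) atTop (𝓝 0) := by
  have hp := p_pos (p := p)
  have h : ∀ ν : ℕ, (p : ℝ) ^ (-((ν : ℝ) * s)) = ((p : ℝ) ^ (-s)) ^ ν := fun ν => by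
    rw [← Real.rpow_natCast, ← Real.rpow_mul hp.le]
    congr 1; ring
  simp only [h]
  simpa using (tendsto_pow_atTop_nhds_zero_of_lt_one (by positivity)
    (Real.rpow_lt_one_of_one_lt_of_neg one_lt_p (by linarith))).const_mul C

/-- Special functions are limits of elements of `LamF`. -/
lemma exists_mem_LamF_BBd_sub (h : Good p α χ d r) {G : ℚ_[p] → ℚ_[p] → L}
    (hG : G ∈ SpecF p α χ d r) {ε : ℝ} (hε : 0 < ε) :
    ∃ U ∈ LamF p α χ d, BBd r (G - U) ε := by
  have hp := p_pos (p := p)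
  suffices H : ∀ c : L, ∃ U ∈ LamF p α χ d, BBd r (c • G - U) ε by simpa using H 1
  induction hG using Submodule.span_induction with
  | mem F hF =>
    obtain ⟨s, t, u, w, i, hst, hi, rfl⟩ := hF
    intro c
    obtain ⟨C, hC, ht⟩ := exists_tail_bound h
    have hri : 0 < r - i := by linarith
    have h1 := (tendsto_rpow_neg_mul (p := p) hri (‖c‖ * C)).eventually_le_const hε
    have h2 := (tendsto_rpow_neg_mul (p := p) hri ‖c‖).eventually_le_const one_pos
    obtain ⟨ν, h1, h2⟩ := (h1.and h2).exists
    have hp0 : (p : ℚ_[p]) ≠ 0 := by exact_mod_cast (Fact.out : p.Prime).ne_zero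
    obtain ⟨κ, hκn, hκ⟩ := exists_act_Phi_eq h (h.le_of_lt hi) one_ne_zero (pow_ne_zero ν hp0)
    have hval : ((p : ℚ_[p]) ^ ν).valuation - (1 : ℚ_[p]).valuation = ν := by simp
    rw [hval] at hκ hκn
    have hκ0 : κ ≠ 0 := norm_pos_iff.1 (by rw [hκn]; positivity)
    refine ⟨c • act α (u : ℚ_[p]) w s t (EFun χ d i ν), ?_, ?_⟩
    · have := hκ s t u w hst
      have h3 : c • act α (u : ℚ_[p]) w s t (EFun χ d i ν) = (c * κ⁻¹) •
          act α ((p : ℚ_[p]) ^ ν * (u : ℚ_[p])) ((p : ℚ_[p]) ^ ν * w)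
            (1 * (s : ℚ_[p])) (1 * (t : ℚ_[p])) (Phi χ d i) := by
        rw [this, smul_smul, mul_assoc, inv_mul_cancel₀ hκ0, mul_one]
      rw [h3]
      refine isOMod_LamF.smul_mem _ ?_ _ (act_Phi_mem_LamF ?_ (h.le_of_lt hi))
      · rw [norm_mul, norm_inv, hκn, ← Real.rpow_neg hp.le]
        exact_mod_cast h2
      · have hdet : (u : ℚ_[p]) * t - w * s ≠ 0 := by
          have h4 : ((u : ℚ_[p]) * t - w * s) = ((-(s * w - t * u) : ℤ_[p]) : ℚ_[p]) := by
            push_cast; ring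
          rw [← norm_ne_zero_iff, h4, ← PadicInt.norm_def, norm_neg, hst]
          norm_num
        rw [show (p : ℚ_[p]) ^ ν * (u : ℚ_[p]) * (1 * (t : ℚ_[p])) - (p : ℚ_[p]) ^ ν * w * (1 * s) =
          (p : ℚ_[p]) ^ ν * ((u : ℚ_[p]) * t - w * s) by ring]
        exact mul_ne_zero (pow_ne_zero _ hp0) hdet
    · rw [← smul_sub]
      refine ((ht s t u w hst i hi ν).smul c).mono ?_
      rw [← mul_assoc]
      exact h1
  | zero => exact fun c => ⟨0, isOMod_LamF.zero_mem, by simpa using BBd.zero hε.le⟩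
  | add F G _ _ hF hG =>
    intro c
    obtain ⟨U, hU, hb⟩ := hF c
    obtain ⟨V, hV, hb'⟩ := hG c
    refine ⟨U + V, isOMod_LamF.add_mem _ hU _ hV, ?_⟩
    rw [smul_add, add_sub_add_comm]
    exact hb.add hb'
  | smul a F _ hF =>
    intro c
    rw [smul_smul]
    exact hF (c * a)

end lattice

section lifts

variable {α χ : L} {d : ℕ}

lemma p_ne_zero' : (p : ℚ_[p]) ≠ 0 := by exact_mod_cast (Fact.out : p.Prime).ne_zero

/-- The retraction of `ℚ_p` to `ℤ_p` sending non-integral elements to `0`. -/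
def toZ (x : ℚ_[p]) : ℤ_[p] := if h : ‖x‖ ≤ 1 then ⟨x, h⟩ else 0

lemma coe_toZ {x : ℚ_[p]} (h : ‖x‖ ≤ 1) : (toZ x : ℚ_[p]) = x :=
  congrArg Subtype.val (dif_pos h : toZ x = ⟨x, h⟩)

lemma toZ_coe (z : ℤ_[p]) : toZ (z : ℚ_[p]) = z :=
  Subtype.ext (coe_toZ (PadicInt.norm_le_one z))

lemma norm_div_p_le_iff (x : ℚ_[p]) {y : ℚ_[p]} (hy : y ≠ 0) :
    ‖x / p‖ ≤ ‖y‖ ↔ ‖x‖ < ‖y‖ := by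
  have hp := p_pos (p := p)
  rw [Padic.norm_eq_zpow_neg_valuation hy, Padic.norm_le_pow_iff_norm_lt_pow_add_one, norm_div,
    Padic.norm_p, div_inv_eq_mul, zpow_add₀ hp.ne', zpow_one, mul_lt_mul_iff_left₀ hp]

/-- The homogeneous function supported on `‖x‖ ≤ ‖y‖` with `liftF u z 1 = u z`. -/
def liftF (χ : L) (d : ℕ) (u : ℤ_[p] → L) : ℚ_[p] → ℚ_[p] → L := fun x y =>
  if y ≠ 0 ∧ ‖x‖ ≤ ‖y‖ then χ ^ y.valuation * iotaL p L y ^ d * u (toZ (x / y)) else 0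

lemma liftF_add (u v : ℤ_[p] → L) : liftF χ d (u + v) = liftF χ d u + liftF χ d v := by
  funext x y
  simp only [liftF, Pi.add_apply]
  split_ifs <;> simp [mul_add]

lemma liftF_smul (c : L) (u : ℤ_[p] → L) : liftF χ d (c • u) = c • liftF χ d u := by
  funext x y
  simp only [liftF, Pi.smul_apply, smul_eq_mul]
  split_ifs <;> simp [mul_left_comm]

lemma liftF_zero : liftF χ d (0 : ℤ_[p] → L) = 0 := by
  funext x y
  simp [liftF]

lemma hom_liftF (hχ : χ ≠ 0) (u : ℤ_[p] → L) : Hom χ d (liftF χ d u) := by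
  refine ⟨by simp [liftF], fun t ht x y => ?_⟩
  have hiff : (t * y ≠ 0 ∧ ‖t * x‖ ≤ ‖t * y‖) ↔ (y ≠ 0 ∧ ‖x‖ ≤ ‖y‖) := by
    rw [norm_mul, norm_mul, mul_le_mul_iff_right₀ (norm_pos_iff.2 ht)]
    simp [ht]
  simp only [liftF, hiff]
  by_cases h : y ≠ 0 ∧ ‖x‖ ≤ ‖y‖
  · rw [if_pos h, if_pos h, Padic.valuation_mul ht h.1, zpow_add₀ hχ, iotaL_mul, mul_pow,
      mul_div_mul_left _ _ ht]
    ring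
  · rw [if_neg h, if_neg h, mul_zero]

lemma liftF_atom (a : ℤ_[p]) (n : ℕ) {j : ℕ} (hj : j ≤ d) : liftF χ d (atom α a n j) =
    act α ((p : ℚ_[p]) ^ (-(n : ℤ))) (-(a * (p : ℚ_[p]) ^ (-(n : ℤ)))) 0 1 (Phi χ d j) := by
  have hp := p_pos (p := p)
  funext x y
  have hval : ((p : ℚ_[p]) ^ (-(n : ℤ)) * 1 - -(a * (p : ℚ_[p]) ^ (-(n : ℤ))) * 0).valuation =
      -(n : ℤ) := by simp
  rw [act, hval, neg_neg, zpow_natCast, zero_mul, zero_add, one_mul]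
  set m : ℚ_[p] := (p : ℚ_[p]) ^ (-(n : ℤ)) * x + -(a * (p : ℚ_[p]) ^ (-(n : ℤ))) * y with hm
  by_cases hy : y = 0
  · simp [liftF, Phi, hy]
  have hmy : m = (x / y - a) / (p : ℚ_[p]) ^ n * y := by
    rw [hm, zpow_neg, zpow_natCast]
    field_simp
    ring
  have hmn : ‖m‖ ≤ ‖y‖ ↔ ‖x / y - a‖ ≤ (p : ℝ) ^ (-(n : ℤ)) := by
    rw [hmy, norm_mul, mul_le_iff_le_one_left (norm_pos_iff.2 hy), norm_div, norm_pow,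
      Padic.norm_p, div_le_one (by positivity), inv_pow, zpow_neg, zpow_natCast]
  have ha : ‖(a : ℚ_[p])‖ ≤ 1 := PadicInt.norm_le_one a
  have hn1 : (p : ℝ) ^ (-(n : ℤ)) ≤ 1 := zpow_le_one_of_nonpos₀ one_lt_p.le (by omega)
  by_cases hc : ‖m‖ ≤ ‖y‖
  · have h1 : ‖x / y‖ ≤ 1 := by
      rw [show x / y = (x / y - a) + a by ring]
      exact (IsUltrametricDist.norm_add_le_max _ _).trans (max_le ((hmn.1 hc).trans hn1) ha)
    have h2 : ‖x‖ ≤ ‖y‖ := by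
      rwa [norm_div, div_le_one (norm_pos_iff.2 hy)] at h1
    have h3 : ‖toZ (x / y) - a‖ ≤ (p : ℝ) ^ (-(n : ℤ)) := by
      rw [PadicInt.norm_def, PadicInt.coe_sub, coe_toZ h1]; exact hmn.1 hc
    rw [liftF, if_pos ⟨hy, h2⟩, Phi, if_pos ⟨hy, hc⟩, atom, if_pos h3, coe_toZ h1, hmy, iotaL_mul,
      iotaL_div, iotaL_pow, iotaL_natCast, mul_pow, show iotaL p L y ^ d =
        iotaL p L y ^ (d - j) * iotaL p L y ^ j by rw [← pow_add]; congr 1; omega]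
    ring
  · rw [Phi, if_neg (fun h => hc h.2), mul_zero, liftF]
    split_ifs with h
    · have h1 : ‖x / y‖ ≤ 1 := by
        rw [norm_div]; exact div_le_one_of_le₀ h.2 (norm_nonneg _)
      rw [atom, if_neg, mul_zero]
      rw [PadicInt.norm_def, PadicInt.coe_sub, coe_toZ h1]
      exact fun h => hc (hmn.2 h)
    · rfl

/-- The homogeneous function with first chart `u` and second chart `0`. -/
def lift1 (χ : L) (d : ℕ) (u : ℤ_[p] → L) : ℚ_[p] → ℚ_[p] → L := fun x y => liftF χ d u (x / p) y

/-- The homogeneous function with first chart `0` and second chart `u`. -/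
def lift2 (χ : L) (d : ℕ) (u : ℤ_[p] → L) : ℚ_[p] → ℚ_[p] → L := fun x y => liftF χ d u y x

lemma lift1_eq (hα : α ≠ 0) (u : ℤ_[p] → L) :
    lift1 χ d u = act α (p : ℚ_[p])⁻¹ 0 0 1 (liftF χ d (α⁻¹ • u)) := by
  funext x y
  rw [liftF_smul]
  simp [lift1, act, div_eq_inv_mul, hα]

lemma lift2_eq (u : ℤ_[p] → L) : lift2 χ d u = act α 0 1 1 0 (liftF χ d u) := by
  funext x y
  have : (-1 : ℚ_[p]).valuation = 0 := valuation_eq_zero_of_norm (by simp)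
  simp [lift2, act, this]

lemma ch1_lift1 (u : ℤ_[p] → L) : ch1 (lift1 χ d u) = u := by
  funext z
  have h : ‖(z : ℚ_[p])‖ ≤ 1 := PadicInt.norm_le_one z
  simp [ch1, lift1, liftF, mul_div_cancel_left₀ _ (p_ne_zero' (p := p)), iotaL_one, toZ_coe]
  exact fun h' => absurd h (not_le.2 h')

lemma ch2_lift1 (u : ℤ_[p] → L) : ch2 (lift1 χ d u) = 0 := by
  funext z
  rw [ch2, lift1, liftF, if_neg]
  · rfl
  · rintro ⟨h0, h⟩
    rw [norm_div_p_le_iff _ h0, norm_one] at h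
    exact absurd (PadicInt.norm_le_one z) (not_le.2 h)

lemma ch1_lift2 (u : ℤ_[p] → L) : ch1 (lift2 χ d u) = 0 := by
  funext z
  rw [ch1, lift2, liftF, if_neg]
  · rfl
  · rintro ⟨-, h⟩
    have h1 : ‖(z : ℚ_[p])‖ ≤ 1 := PadicInt.norm_le_one z
    have h2 : (p : ℝ)⁻¹ < 1 := inv_lt_one_of_one_lt₀ one_lt_p
    rw [norm_one, norm_mul, Padic.norm_p] at h
    have := mul_le_of_le_one_right (inv_nonneg.2 (p_pos (p := p)).le) h1
    linarith

lemma ch2_lift2 (u : ℤ_[p] → L) : ch2 (lift2 χ d u) = u := by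
  funext z
  have h : ‖(z : ℚ_[p])‖ ≤ 1 := PadicInt.norm_le_one z
  simp [ch2, lift2, liftF, iotaL_one, toZ_coe]
  exact fun h' => absurd h (not_le.2 h')

lemma hom_lift1 (hχ : χ ≠ 0) (u : ℤ_[p] → L) : Hom χ d (lift1 χ d u) := by
  refine ⟨by simp [lift1, liftF], fun t ht x y => ?_⟩
  simp only [lift1]
  rw [mul_div_assoc, (hom_liftF hχ u).2 t ht]

lemma hom_lift2 (hχ : χ ≠ 0) (u : ℤ_[p] → L) : Hom χ d (lift2 χ d u) :=
  ⟨by simp [lift2, liftF], fun t ht x y => (hom_liftF hχ u).2 t ht y x⟩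

/-- A homogeneous function is determined by its charts. -/
lemma Hom.eq_lift {F : ℚ_[p] → ℚ_[p] → L} (hF : Hom χ d F) :
    F = lift1 χ d (ch1 F) + lift2 χ d (ch2 F) := by
  funext x y
  rw [Pi.add_apply, Pi.add_apply, lift1, lift2, liftF, liftF]
  by_cases h : ‖x‖ < ‖y‖
  · have hy : y ≠ 0 := norm_pos_iff.1 ((norm_nonneg _).trans_lt h)
    have h1 := (norm_div_p_le_iff x hy).2 h
    have h2 : ‖x / p / y‖ ≤ 1 := by
      rw [norm_div]; exact div_le_one_of_le₀ h1 (norm_nonneg _)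
    rw [if_pos ⟨hy, h1⟩, if_neg (fun h3 => absurd h3.2 (not_le.2 h)), add_zero, ch1, coe_toZ h2,
      ← hF.2 y hy]
    congr 1
    · field_simp [p_ne_zero' (p := p)]
    · rw [mul_one]
  · rw [if_neg (fun h3 => h ((norm_div_p_le_iff x h3.1).1 h3.2)), zero_add]
    by_cases hx : x = 0
    · have hy : y = 0 := by
        rw [hx, norm_zero, norm_pos_iff, not_not] at h; exact h
      rw [if_neg (fun h => h.1 hx), hx, hy, hF.1]
    · have h2 : ‖y / x‖ ≤ 1 := by
        rw [norm_div]; exact div_le_one_of_le₀ (not_lt.1 h) (norm_nonneg _)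
      rw [if_pos ⟨hx, not_lt.1 h⟩, ch2, coe_toZ h2, ← hF.2 x hx, mul_one, mul_div_cancel₀ _ hx]

lemma isOMod_liftF_preimage : IsOMod (L := L) {u : ℤ_[p] → L | liftF χ d u ∈ LamF p α χ d} where
  zero_mem := by
    rw [Set.mem_ofPred_eq, liftF_zero]; exact isOMod_LamF.zero_mem
  add_mem := fun f hf g hg => by
    rw [Set.mem_ofPred_eq, liftF_add]; exact isOMod_LamF.add_mem _ hf _ hg
  smul_mem := fun c hc f hf => by
    rw [Set.mem_ofPred_eq, liftF_smul]; exact isOMod_LamF.smul_mem _ hc _ hf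

lemma liftF_atom_mem (a : ℤ_[p]) (n j : ℕ) (hj : j ≤ d) :
    liftF χ d (atom α a n j) ∈ LamF p α χ d := by
  rw [liftF_atom a n hj]
  refine act_Phi_mem_LamF ?_ hj
  rw [mul_one, mul_zero, sub_zero]
  exact zpow_ne_zero _ p_ne_zero'

lemma lift1_mem_LamF (hα : α ≠ 0) {u : ℤ_[p] → L} (h : liftF χ d (α⁻¹ • u) ∈ LamF p α χ d) :
    lift1 χ d u ∈ LamF p α χ d := by
  rw [lift1_eq hα]
  exact act_mem_LamF hα (by simp [(Fact.out : p.Prime).ne_zero]) h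

lemma lift2_mem_LamF (hα : α ≠ 0) {u : ℤ_[p] → L} (h : liftF χ d u ∈ LamF p α χ d) :
    lift2 χ d u ∈ LamF p α χ d := by
  rw [lift2_eq (α := α)]
  exact act_mem_LamF hα (by simp) h

/-- Small elements of `PiF` belong to `LamF`. -/
lemma exists_smul_mem_LamF (h : Good p α χ d r) : ∃ K : ℝ, 0 < K ∧
    ∀ (F : ℚ_[p] → ℚ_[p] → L) (C : ℝ) (c : L), F ∈ PiF p α χ d → BBd r F C → ‖c‖ * K * C ≤ 1 →
      c • F ∈ LamF p α χ d := by
  have hp := p_pos (p := p)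
  have hα := h.alpha_ne_zero
  obtain ⟨K, hK, hKc⟩ := exists_LPn_crBd_mem p L α h.norm_alpha h.r_pos.le d h.r_lt.le
  have hpr : 1 ≤ (p : ℝ) ^ r := Real.one_le_rpow one_lt_p.le h.r_pos.le
  refine ⟨K * (p : ℝ) ^ r, by positivity, fun F C c hF hb hc => ?_⟩
  obtain ⟨N, hN1, hN2⟩ := exists_LPn_of_mem_PiF h hF
  have hC := hb.1.nonneg
  rw [((hom_of_mem_PiF h.chi_ne_zero hF).smul c).eq_lift]
  refine isOMod_LamF.add_mem _ (lift1_mem_LamF hα ?_) _ (lift2_mem_LamF hα ?_)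
  · have := hKc _ (isOMod_liftF_preimage (χ := χ)) (liftF_atom_mem (χ := χ)) N (ch1 F) C (α⁻¹ * c) hN1 hb.1 (by
      rw [norm_mul, norm_inv, h.norm_alpha, ← Real.rpow_neg hp.le, neg_neg]
      linarith)
    rw [mul_smul] at this
    exact this
  · refine hKc _ (isOMod_liftF_preimage (χ := χ)) (liftF_atom_mem (χ := χ)) N (ch2 F) C c hN2 hb.2 (le_trans ?_ hc)
    rw [← mul_assoc (‖c‖)]
    have : 0 ≤ ‖c‖ * K * C := by positivity
    nlinarith

lemma liftF_mem_PiF (h : Good p α χ d r) {N : ℕ} {u : ℤ_[p] → L} (hu : LPn d N u) :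
    liftF χ d u ∈ PiF p α χ d := by
  have hp := p_pos (p := p)
  obtain ⟨K, hK, hKc⟩ := exists_LPn_mem p L α h.norm_alpha d
  obtain ⟨M, hM⟩ := hu.exists_bound
  have hM0 : 0 ≤ M := (norm_nonneg _).trans (hM 0)
  obtain ⟨c, hc0, hc⟩ := NormedField.exists_norm_lt L
    (show 0 < 1 / (K * M * (p : ℝ) ^ ((N : ℝ) * r) + 1) by positivity)
  have := hKc _ isOMod_liftF_preimage (liftF_atom_mem (χ := χ)) N u M c hu hM (by
    rw [lt_div_iff₀ (by positivity)] at hc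
    nlinarith)
  rw [Set.mem_ofPred_eq, liftF_smul] at this
  have h2 := Submodule.smul_mem (PiF p α χ d) c⁻¹ (LamF_subset_PiF this)
  rwa [smul_smul, inv_mul_cancel₀ (norm_pos_iff.1 hc0), one_smul] at h2

lemma act_mem_PiF (hα : α ≠ 0) {a b c e : ℚ_[p]} (h : a * e - b * c ≠ 0)
    {F : ℚ_[p] → ℚ_[p] → L} (hF : F ∈ PiF p α χ d) : act α a b c e F ∈ PiF p α χ d := by
  induction hF using Submodule.span_induction with
  | mem F hF => exact Submodule.subset_span (act_mem_PhiGen hα h hF)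
  | zero => rw [act_zero]; exact zero_mem _
  | add F G _ _ hF hG => rw [act_add]; exact add_mem hF hG
  | smul k F _ hF => rw [act_smul]; exact Submodule.smul_mem _ k hF

lemma lift1_mem_PiF (h : Good p α χ d r) {N : ℕ} {u : ℤ_[p] → L} (hu : LPn d N u) :
    lift1 χ d u ∈ PiF p α χ d := by
  rw [lift1_eq h.alpha_ne_zero]
  exact act_mem_PiF h.alpha_ne_zero (by simp [(Fact.out : p.Prime).ne_zero]) (liftF_mem_PiF h (hu.smul _))

lemma lift2_mem_PiF (h : Good p α χ d r) {N : ℕ} {u : ℤ_[p] → L} (hu : LPn d N u) :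
    lift2 χ d u ∈ PiF p α χ d := by
  rw [lift2_eq (α := α)]
  exact act_mem_PiF h.alpha_ne_zero (by simp) (liftF_mem_PiF h hu)

end lifts

section restriction

variable {k : ℕ} {α β χ : L} {d : ℕ}

/-- The parameters `(χ, d, r) = (αp/β, k - 2, val α)` attached to `(k, α, β)`. -/
structure Data (p : ℕ) [Fact p.Prime] {L : Type} [NontriviallyNormedField L]
    [NormedAlgebra ℚ_[p] L] (k : ℕ) (α β χ : L) (d : ℕ) (r : ℝ) : Prop
    extends Good p α χ d r where
  chi_eq : χ = α * (p : L) / β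
  d_eq : d = k - 2
  r_eq : r = valL p L α

/-- A homogeneous function whose charts are of class `C^r`. -/
def Nice (χ : L) (d : ℕ) (r : ℝ) (F : ℚ_[p] → ℚ_[p] → L) : Prop :=
  Hom χ d F ∧ IsCr p L r (ch1 F) ∧ IsCr p L r (ch2 F)

lemma Nice.add {F G : ℚ_[p] → ℚ_[p] → L} (hF : Nice χ d r F) (hG : Nice χ d r G) :
    Nice χ d r (F + G) := ⟨hF.1.add hG.1, hF.2.1.add hG.2.1, hF.2.2.add hG.2.2⟩

lemma Nice.smul {F : ℚ_[p] → ℚ_[p] → L} (c : L) (hF : Nice χ d r F) : Nice χ d r (c • F) :=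
  ⟨hF.1.smul c, hF.2.1.smul c, hF.2.2.smul c⟩

lemma Nice.sub {F G : ℚ_[p] → ℚ_[p] → L} (hF : Nice χ d r F) (hG : Nice χ d r G) :
    Nice χ d r (F - G) := by
  have := hF.add (hG.smul (-1))
  simpa [sub_eq_add_neg] using this

lemma BBd.nice {F : ℚ_[p] → ℚ_[p] → L} {C : ℝ} (hb : BBd r F C) (hF : Hom χ d F) :
    Nice χ d r F := ⟨hF, hb.1.1, hb.2.1⟩

lemma nice_zero : Nice χ d r (0 : ℚ_[p] → ℚ_[p] → L) := (BBd.zero le_rfl).nice Hom.zero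

lemma LPn.isCr (hr : 0 ≤ r) {N : ℕ} {f : ℤ_[p] → L} (hf : LPn d N f) : IsCr p L r f := by
  obtain ⟨C, -, hC⟩ := exists_crBd_of_LPn p L hr d
  obtain ⟨M, hM⟩ := hf.exists_bound
  exact (hC N f M hf hM).1

lemma nice_of_mem_PiF (h : Good p α χ d r) {F : ℚ_[p] → ℚ_[p] → L} (hF : F ∈ PiF p α χ d) :
    Nice χ d r F := by
  obtain ⟨N, h1, h2⟩ := exists_LPn_of_mem_PiF h hF
  exact ⟨hom_of_mem_PiF h.chi_ne_zero hF, h1.isCr h.r_pos.le, h2.isCr h.r_pos.le⟩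

/-- Restriction of a homogeneous function to the affine line. -/
def res (F : ℚ_[p] → ℚ_[p] → L) : ℚ_[p] → L := fun z => F z 1

lemma res_add (F G : ℚ_[p] → ℚ_[p] → L) : res (F + G) = res F + res G := rfl

lemma res_sub (F G : ℚ_[p] → ℚ_[p] → L) : res (F - G) = res F - res G := rfl

lemma res_smul (c : L) (F : ℚ_[p] → ℚ_[p] → L) : res (c • F) = c • res F := rfl

lemma res_zero : res (0 : ℚ_[p] → ℚ_[p] → L) = 0 := rfl

/-- Restriction as a linear map. -/
def resHom : (ℚ_[p] → ℚ_[p] → L) →ₗ[L] (ℚ_[p] → L) where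
  toFun := res
  map_add' := res_add
  map_smul' := res_smul

lemma Ext2.unique (hr : 0 < valL p L α) {f : ℚ_[p] → L} {g g' : ℤ_[p] → L}
    (h : Ext2 p L k α β f g) (h' : Ext2 p L k α β f g') : g = g' := by
  have hne : ∀ z : ℤ_[p], z ≠ 0 → g z = g' z := fun z hz => by rw [h.2 z hz, h'.2 z hz]
  funext z
  by_cases hz : z = 0
  · have ht : Tendsto (fun n : ℕ => (p : ℤ_[p]) ^ n) atTop (𝓝 0) :=
      tendsto_pow_atTop_nhds_zero_of_norm_lt_one
        (by rw [PadicInt.norm_p]; exact inv_lt_one_of_one_lt₀ one_lt_p)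
    have h1 := ((h.1.continuous hr.le).tendsto 0).comp ht
    have h2 := ((h'.1.continuous hr.le).tendsto 0).comp ht
    rw [hz]
    refine tendsto_nhds_unique h1 (h2.congr fun n => (hne _ ?_).symm)
    exact pow_ne_zero _ (by exact_mod_cast (Fact.out : p.Prime).ne_zero)
  · exact hne z hz

lemma ext2_eq (hr : 0 < valL p L α) {f : ℚ_[p] → L} {g : ℤ_[p] → L}
    (h : Ext2 p L k α β f g) : ext2 p L k α β f = g := by
  have he : ∃ g : ℤ_[p] → L, Ext2 p L k α β f g := ⟨g, h⟩
  rw [ext2, dif_pos he]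
  exact he.choose_spec.unique hr h

lemma Nice.ext2 (h : Data p k α β χ d r) {F : ℚ_[p] → ℚ_[p] → L} (hF : Nice χ d r F) :
    Ext2 p L k α β (res F) (ch2 F) := by
  refine ⟨h.r_eq ▸ hF.2.2, fun z hz => ?_⟩
  have hz' : (z : ℚ_[p]) ≠ 0 := by simpa using hz
  rw [← h.chi_eq, ← h.d_eq, res, ← hF.1.2 _ hz', mul_inv_cancel₀ hz', mul_one, ch2]

lemma Nice.memB (h : Data p k α β χ d r) {F : ℚ_[p] → ℚ_[p] → L} (hF : Nice χ d r F) :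
    MemB p L k α β (res F) :=
  ⟨h.r_eq ▸ hF.2.1, _, hF.ext2 h⟩

lemma Nice.ext2_res (h : Data p k α β χ d r) {F : ℚ_[p] → ℚ_[p] → L} (hF : Nice χ d r F) :
    Paper.ext2 p L k α β (res F) = ch2 F :=
  ext2_eq (h.r_eq ▸ h.r_pos) (hF.ext2 h)

lemma Nice.bBd_iff (h : Data p k α β χ d r) {F : ℚ_[p] → ℚ_[p] → L} (hF : Nice χ d r F) {C : ℝ} :
    BBd r F C ↔ bNorm p L k α β (res F) ≤ C := by
  rw [bNorm, hF.ext2_res h, ← h.r_eq, max_le_iff]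
  exact ⟨fun hb => ⟨hb.1.crNorm_le, hb.2.crNorm_le⟩, fun hb =>
    ⟨hF.2.1.crBd_of_crNorm_le h.r_pos.le hb.1, hF.2.2.crBd_of_crNorm_le h.r_pos.le hb.2⟩⟩

lemma Nice.eq_zero (h : Data p k α β χ d r) {F : ℚ_[p] → ℚ_[p] → L} (hF : Nice χ d r F)
    (h0 : res F = 0) : F = 0 := by
  have h1 : ch1 F = 0 := by
    funext z
    exact congrFun h0 _
  have h2 : ch2 F = 0 := by
    refine (hF.ext2 h).unique (h.r_eq ▸ h.r_pos) ?_
    rw [h0]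
    have : Nice χ d r (0 : ℚ_[p] → ℚ_[p] → L) := nice_zero
    exact this.ext2 h
  rw [hF.1.eq_lift, h1, h2]
  funext x y
  simp [lift1, lift2, liftF_zero]

lemma Nice.res_injective (h : Data p k α β χ d r) {F G : ℚ_[p] → ℚ_[p] → L} (hF : Nice χ d r F)
    (hG : Nice χ d r G) (he : res F = res G) : F = G :=
  sub_eq_zero.1 ((hF.sub hG).eq_zero h (by rw [res_sub, he, sub_self]))

lemma ch1_add (F G : ℚ_[p] → ℚ_[p] → L) : ch1 (F + G) = ch1 F + ch1 G := rfl

lemma ch2_add (F G : ℚ_[p] → ℚ_[p] → L) : ch2 (F + G) = ch2 F + ch2 G := rfl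

lemma ch1_lift (u v : ℤ_[p] → L) : ch1 (lift1 χ d u + lift2 χ d v) = u := by
  rw [ch1_add, ch1_lift1, ch1_lift2, add_zero]

lemma ch2_lift (u v : ℤ_[p] → L) : ch2 (lift1 χ d u + lift2 χ d v) = v := by
  rw [ch2_add, ch2_lift1, ch2_lift2, zero_add]

lemma nice_lift (hχ : χ ≠ 0) {u v : ℤ_[p] → L} (hu : IsCr p L r u) (hv : IsCr p L r v) :
    Nice χ d r (lift1 χ d u + lift2 χ d v) :=
  ⟨(hom_lift1 hχ u).add (hom_lift2 hχ v), by rwa [ch1_lift], by rwa [ch2_lift]⟩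

/-- A function on the affine line is the restriction of the function glued from its charts. -/
lemma res_lift (hχ : χ ≠ 0) {f : ℚ_[p] → L} {g : ℤ_[p] → L} (hg : ∀ z : ℤ_[p], z ≠ 0 →
    g z = χ ^ (z : ℚ_[p]).valuation * iotaL p L (z : ℚ_[p]) ^ d * f (z : ℚ_[p])⁻¹) :
    res (lift1 χ d (fun z : ℤ_[p] => f ((p : ℚ_[p]) * (z : ℚ_[p]))) + lift2 χ d g) = f := by
  funext z
  rw [res, Pi.add_apply, Pi.add_apply, lift1, lift2, liftF, liftF]
  by_cases hz : ‖z‖ < 1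
  · have h1 : ‖z / p‖ ≤ ‖(1 : ℚ_[p])‖ := (norm_div_p_le_iff z one_ne_zero).2 (by simpa using hz)
    rw [if_pos ⟨one_ne_zero, h1⟩, if_neg (fun h => absurd h.2 (by simpa using hz)),
      Padic.valuation_one, zpow_zero, iotaL_one, one_pow, div_one,
      coe_toZ (by simpa using h1), mul_div_cancel₀ _ p_ne_zero']
    simp
  · have hz0 : z ≠ 0 := by
      rintro rfl; simp at hz
    have h1 : ‖1 / z‖ ≤ 1 := by
      rw [norm_div, norm_one]; exact div_le_one_of_le₀ (not_lt.1 hz) (norm_nonneg _)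
    have h2 : ((toZ (1 / z) : ℤ_[p]) : ℚ_[p]) = z⁻¹ := by rw [coe_toZ h1, one_div]
    have h3 : toZ (1 / z) ≠ 0 := fun h => by
      rw [h, PadicInt.coe_zero] at h2
      exact inv_ne_zero hz0 h2.symm
    rw [if_neg (fun h => hz (by simpa using (norm_div_p_le_iff z one_ne_zero).1 h.2)),
      if_pos ⟨hz0, by simpa using hz⟩, hg _ h3, h2, inv_inv, Padic.valuation_inv, iotaL_inv,
      zero_add]
    have h4 : χ ^ z.valuation ≠ 0 := zpow_ne_zero _ hχ
    have h5 : iotaL p L z ^ d ≠ 0 := pow_ne_zero _ (by simpa [iotaL_eq_zero] using hz0)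
    rw [zpow_neg, inv_pow]
    field_simp

/-- Every element of `B(α)` is the restriction of a homogeneous function. -/
lemma exists_nice_of_memB (h : Data p k α β χ d r) {f : ℚ_[p] → L} (hf : MemB p L k α β f) :
    ∃ F : ℚ_[p] → ℚ_[p] → L, Nice χ d r F ∧ res F = f := by
  obtain ⟨h1, g, h2, h3⟩ := hf
  refine ⟨_, nice_lift h.chi_ne_zero (h.r_eq ▸ h1) (h.r_eq ▸ h2), res_lift h.chi_ne_zero ?_⟩
  rw [h.chi_eq, h.d_eq]
  exact h3

/-- The action on `B(α)` in the homogeneous model. -/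
lemma Nice.gAct_res (h : Data p k α β χ d r) {F : ℚ_[p] → ℚ_[p] → L} (hF : Nice χ d r F)
    {m : Matrix (Fin 2) (Fin 2) ℚ_[p]} (hm : det2 p m ≠ 0) :
    gAct p L k α β m (res F) = res (act α (m 1 1) (-(m 0 1)) (-(m 1 0)) (m 0 0) F) := by
  funext z
  have hdet : m 1 1 * m 0 0 - -(m 0 1) * -(m 1 0) = det2 p m := by rw [det2]; ring
  have hR : res (act α (m 1 1) (-(m 0 1)) (-(m 1 0)) (m 0 0) F) z =
      α ^ (-(det2 p m).valuation) * F (m 1 1 * z + -(m 0 1)) (-(m 1 0) * z + m 0 0) := by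
    rw [res, act, hdet, mul_one, mul_one]
  rw [gAct, ← h.chi_eq, ← h.d_eq, hR, hF.ext2_res h]
  split_ifs with h0
  · have hc : m 1 0 ≠ 0 := by
      intro hc
      rw [hc, neg_zero, zero_mul, zero_add] at h0
      exact hm (by rw [det2, hc, h0]; ring)
    have hz : m 1 1 * z + -(m 0 1) = det2 p m / m 1 0 := by
      rw [det2, eq_div_iff hc]
      linear_combination (-(m 1 1)) * h0
    rw [mul_assoc, mul_assoc, ← mul_assoc (χ ^ _), h0, hz]
    have := hF.1.2 (det2 p m / m 1 0) (div_ne_zero hm hc) 1 0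
    rw [mul_one, mul_zero] at this
    rw [this, ch2, PadicInt.coe_zero]
  · rw [mul_assoc, mul_assoc, ← mul_assoc (χ ^ _), res, ← hF.1.2 _ h0, mul_div_cancel₀ _ h0,
      mul_one, sub_eq_add_neg]

end restriction

section special

variable {k : ℕ} {α β χ : L} {d : ℕ}

lemma Psi_expand (hχ : χ ≠ 0) {j : ℕ} (hj : j ≤ d) (u w : ℚ_[p]) {t : ℚ_[p]} (ht : t ≠ 0)
    (m l : ℚ_[p]) : Psi χ d j (u * l + w * m) (t * l) = ∑ i ∈ Finset.range (j + 1),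
      (χ ^ t.valuation * iotaL p L t ^ (d - j) * (j.choose i : L) * iotaL p L u ^ (j - i) *
        iotaL p L w ^ i) * Psi χ d i m l := by
  by_cases hl : l = 0
  · simp [Psi, hl]
  rw [Psi, if_pos (mul_ne_zero ht hl), Padic.valuation_mul ht hl, zpow_add₀ hχ, iotaL_mul, iotaL_add,
    add_comm (iotaL p L (u * l)), iotaL_mul, iotaL_mul, mul_pow, add_pow, Finset.mul_sum]
  refine Finset.sum_congr rfl fun i hi => ?_
  have hij : i ≤ j := Nat.lt_succ_iff.1 (Finset.mem_range.1 hi)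
  rw [Psi, if_pos hl, show d - i = (d - j) + (j - i) by omega, mul_pow, mul_pow, pow_add]
  ring

lemma Psi_mem_SpecF {i : ℕ} (hi : (i : ℝ) < r) :
    (Psi χ d i : ℚ_[p] → ℚ_[p] → L) ∈ SpecF p α χ d r := by
  refine Submodule.subset_span ⟨0, 1, 1, 0, i, by simp, hi, ?_⟩
  rw [PadicInt.coe_one, PadicInt.coe_zero, act_one]

lemma act_eq_of_norm_det {a b c e : ℚ_[p]} (h : ‖a * e - b * c‖ = 1) (F : ℚ_[p] → ℚ_[p] → L) :
    act α a b c e F = fun x y => F (a * x + b * y) (c * x + e * y) := by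
  funext x y
  rw [act, valuation_eq_zero_of_norm h, neg_zero, zpow_zero, one_mul]

lemma exists_mem_SpecF_of_mem_span (h : Data p k α β χ d r) {f : ℚ_[p] → L}
    (hf : f ∈ Submodule.span L (lGen p L k α β)) : ∃ G ∈ SpecF p α χ d r, res G = f := by
  induction hf using Submodule.span_induction with
  | zero => exact ⟨0, zero_mem _, rfl⟩
  | add f g _ _ hf hg =>
    obtain ⟨F, hF, rfl⟩ := hf
    obtain ⟨G, hG, rfl⟩ := hg
    exact ⟨F + G, add_mem hF hG, rfl⟩
  | smul c f _ hf =>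
    obtain ⟨F, hF, rfl⟩ := hf
    exact ⟨c • F, Submodule.smul_mem _ c hF, rfl⟩
  | mem f hf =>
    obtain ⟨j, hj, hf⟩ := hf
    rw [← h.r_eq] at hj
    have hjd : j ≤ d := h.le_of_lt hj
    rcases hf with rfl | ⟨a, rfl⟩
    · refine ⟨_, Psi_mem_SpecF hj, ?_⟩
      funext z
      simp [res, Psi, monomialFun, iotaL_one]
    · have hspec : ∀ z, specFun p L k α β a j z = Psi χ d j 1 (z - a) := fun z => by
        simp only [specFun, Psi, ← h.chi_eq, ← h.d_eq, iotaL_one, one_pow, mul_one, sub_ne_zero, ne_eq]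
        by_cases hz : z = a <;> simp [hz]
      by_cases ha : ‖a‖ ≤ 1
      · obtain ⟨w, rfl⟩ : ∃ w : ℤ_[p], (w : ℚ_[p]) = a := ⟨toZ a, coe_toZ ha⟩
        refine ⟨_, Submodule.subset_span ⟨1, -w, 0, 1, j, by simp, hj, rfl⟩, ?_⟩
        rw [act_eq_of_norm_det (by simp)]
        funext z
        rw [hspec]
        simp [res, sub_eq_add_neg]
      · have ha0 : a ≠ 0 := by rintro rfl; simp at ha
        have hai : ‖a⁻¹‖ ≤ 1 := by rw [norm_inv]; exact inv_le_one_of_one_le₀ (not_le.1 ha).le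
        obtain ⟨w, hw⟩ : ∃ w : ℤ_[p], (w : ℚ_[p]) = a⁻¹ := ⟨toZ a⁻¹, coe_toZ hai⟩
        refine ⟨∑ i ∈ Finset.range (j + 1), (χ ^ (-a).valuation * iotaL p L (-a) ^ (d - j) *
          (j.choose i : L) * iotaL p L (1 : ℚ_[p]) ^ (j - i) * iotaL p L a⁻¹ ^ i) •
            act α ((1 : ℤ_[p]) : ℚ_[p]) (0 : ℤ_[p]) ((-w : ℤ_[p]) : ℚ_[p]) (1 : ℤ_[p]) (Psi χ d i),
          Submodule.sum_mem _ fun i hi => Submodule.smul_mem _ _ (Submodule.subset_span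
            ⟨-w, 1, 1, 0, i, by simp, lt_of_le_of_lt ?_ hj, rfl⟩), ?_⟩
        · exact_mod_cast Nat.lt_succ_iff.1 (Finset.mem_range.1 hi)
        · funext z
          rw [hspec, show (1 : ℚ_[p]) = 1 * (1 - a⁻¹ * z) + a⁻¹ * z by ring,
            show z - a = -a * (1 - a⁻¹ * z) by field_simp; ring,
            Psi_expand h.chi_ne_zero hjd _ _ (neg_ne_zero.2 ha0), res, Finset.sum_apply,
            Finset.sum_apply]
          refine Finset.sum_congr rfl fun i _ => ?_
          rw [act_eq_of_norm_det (by simp), Pi.smul_apply, Pi.smul_apply, smul_eq_mul]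
          congr 2
          · simp
          · simp
          · simp only [PadicInt.coe_neg, hw, PadicInt.coe_one]; ring

lemma res_mem_span_of_mem_SpecF (h : Data p k α β χ d r) {G : ℚ_[p] → ℚ_[p] → L}
    (hG : G ∈ SpecF p α χ d r) : res G ∈ Submodule.span L (lGen p L k α β) := by
  induction hG using Submodule.span_induction with
  | zero => exact zero_mem _
  | add F G _ _ hF hG => exact add_mem hF hG
  | smul c F _ hF => exact Submodule.smul_mem _ c hF
  | mem F hF =>
    obtain ⟨s, t, u, w, i, hdet, hi, rfl⟩ := hF
    have hid := h.le_of_lt hi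
    by_cases hs : (s : ℚ_[p]) = 0
    · have hs' : s = 0 := by simpa using hs
      have ht : (t : ℚ_[p]) ≠ 0 := by
        intro ht
        have ht' : t = 0 := by simpa using ht
        simp [hs', ht'] at hdet
      have : res (act α (u : ℚ_[p]) w s t (Psi χ d i)) = ∑ l ∈ Finset.range (i + 1),
          (α ^ (-((u : ℚ_[p]) * t - w * s).valuation) * (χ ^ (t : ℚ_[p]).valuation *
            iotaL p L (t : ℚ_[p]) ^ (d - i) * (i.choose l : L) * iotaL p L (w : ℚ_[p]) ^ (i - l) *
            iotaL p L (u : ℚ_[p]) ^ l)) • monomialFun p L l := by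
        funext z
        rw [res, act, Finset.sum_apply, hs, zero_mul, zero_add, add_comm (_ * z),
          Psi_expand h.chi_ne_zero hid _ _ ht, Finset.mul_sum]
        refine Finset.sum_congr rfl fun l _ => ?_
        simp [Psi, monomialFun, iotaL_one, mul_assoc]
      rw [this]
      refine Submodule.sum_mem _ fun l hl => Submodule.smul_mem _ _ (Submodule.subset_span
        ⟨l, lt_of_le_of_lt ?_ (h.r_eq ▸ hi), Or.inl rfl⟩)
      exact_mod_cast Nat.lt_succ_iff.1 (Finset.mem_range.1 hl)
    · have : res (act α (u : ℚ_[p]) w s t (Psi χ d i)) = ∑ l ∈ Finset.range (i + 1),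
          (α ^ (-((u : ℚ_[p]) * t - w * s).valuation) * (χ ^ (s : ℚ_[p]).valuation *
            iotaL p L (s : ℚ_[p]) ^ (d - i) * (i.choose l : L) * iotaL p L (u : ℚ_[p]) ^ (i - l) *
            iotaL p L ((w : ℚ_[p]) - u * t / s) ^ l)) • specFun p L k α β (-(t : ℚ_[p]) / s) l := by
        funext z
        rw [res, act, Finset.sum_apply, show (u : ℚ_[p]) * z + w * 1 =
            u * (z - -(t : ℚ_[p]) / s) + ((w : ℚ_[p]) - u * t / s) * 1 by ring,
          show (s : ℚ_[p]) * z + t * 1 = s * (z - -(t : ℚ_[p]) / s) by field_simp; ring,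
          Psi_expand h.chi_ne_zero hid _ _ hs, Finset.mul_sum]
        refine Finset.sum_congr rfl fun l _ => ?_
        rw [Pi.smul_apply, smul_eq_mul, mul_assoc (α ^ _)]
        congr 2
        simp only [specFun, Psi, ← h.chi_eq, ← h.d_eq, iotaL_one, one_pow, mul_one, sub_ne_zero, ne_eq]
        by_cases hz : z = -(t : ℚ_[p]) / s <;> simp [hz]
      rw [this]
      refine Submodule.sum_mem _ fun l hl => Submodule.smul_mem _ _ (Submodule.subset_span
        ⟨l, lt_of_le_of_lt ?_ (h.r_eq ▸ hi), Or.inr ⟨_, rfl⟩⟩)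
      exact_mod_cast Nat.lt_succ_iff.1 (Finset.mem_range.1 hl)

lemma nice_of_mem_SpecF (h : Good p α χ d r) {G : ℚ_[p] → ℚ_[p] → L}
    (hG : G ∈ SpecF p α χ d r) : Nice χ d r G := by
  obtain ⟨U, hU, hb⟩ := exists_mem_LamF_BBd_sub h hG one_pos
  have hN := nice_of_mem_PiF h (LamF_subset_PiF hU)
  have := (hb.nice ((hom_of_mem_SpecF h hG).sub hN.1)).add hN
  rwa [sub_add_cancel] at this

/-- Membership in `L(α)` in the homogeneous model. -/
lemma Nice.memLalpha_iff (h : Data p k α β χ d r) {F : ℚ_[p] → ℚ_[p] → L} (hF : Nice χ d r F) :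
    MemLalpha p L k α β (res F) ↔
      ∀ ε : ℝ, 0 < ε → ∃ G ∈ SpecF p α χ d r, BBd r (F - G) ε := by
  constructor
  · rintro ⟨-, hA⟩ ε hε
    obtain ⟨g, hg, hgε⟩ := hA ε hε
    obtain ⟨G, hG, rfl⟩ := exists_mem_SpecF_of_mem_span h hg
    exact ⟨G, hG, ((hF.sub (nice_of_mem_SpecF h.toGood hG)).bBd_iff h).2 hgε.le⟩
  · refine fun hA => ⟨hF.memB h, fun ε hε => ?_⟩
    obtain ⟨G, hG, hb⟩ := hA (ε / 2) (half_pos hε)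
    refine ⟨res G, res_mem_span_of_mem_SpecF h hG, lt_of_le_of_lt ?_ (half_lt_self hε)⟩
    exact ((hF.sub (nice_of_mem_SpecF h.toGood hG)).bBd_iff h).1 hb

end special

section locally_algebraic

variable {k : ℕ} {α β χ : L} {d : ℕ}

/-- A locally constant function on `ℤ_p` is uniformly locally constant. -/
lemma exists_uniform_level {u : ℤ_[p] → L}
    (hu : ∀ x : ℤ_[p], ∃ n : ℕ, ∀ y : ℤ_[p], ‖y - x‖ ≤ (p : ℝ) ^ (-(n : ℤ)) → u y = u x) :
    ∃ N : ℕ, ∀ x y : ℤ_[p], ‖y - x‖ ≤ (p : ℝ) ^ (-(N : ℤ)) → u y = u x := by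
  have hp := p_pos (p := p)
  choose n hn using hu
  obtain ⟨δ, hδ, hb⟩ := lebesgue_number_lemma_of_metric (isCompact_univ (X := ℤ_[p]))
    (c := fun x => Metric.ball x ((p : ℝ) ^ (-(n x : ℤ)))) (fun x => Metric.isOpen_ball)
    (fun x _ => Set.mem_iUnion.2 ⟨x, Metric.mem_ball_self (by positivity)⟩)
  obtain ⟨N, hN⟩ := PadicInt.exists_pow_neg_lt p hδ
  refine ⟨N, fun x y hxy => ?_⟩
  obtain ⟨i, hi⟩ := hb x (Set.mem_univ x)
  have key : ∀ w : ℤ_[p], ‖w - x‖ ≤ (p : ℝ) ^ (-(N : ℤ)) → u w = u i := fun w hw => by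
    have : w ∈ Metric.ball x δ := by
      rw [Metric.mem_ball, dist_eq_norm]; exact hw.trans_lt hN
    have := hi this
    rw [Metric.mem_ball, dist_eq_norm] at this
    exact hn i w this.le
  rw [key y hxy, key x (by simp)]

lemma LPn_poly_mul {N : ℕ} {P : Polynomial L} (hP : P.natDegree ≤ d) {u : ℤ_[p] → L}
    (hu : ∀ x y : ℤ_[p], ‖y - x‖ ≤ (p : ℝ) ^ (-(N : ℤ)) → u y = u x) :
    LPn d N (fun z : ℤ_[p] => P.eval (iotaL p L (z : ℚ_[p])) * u z) := fun a =>
  ⟨Polynomial.C (u a) * P, (Polynomial.natDegree_C_mul_le _ _).trans hP, fun z hz => by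
    rw [Polynomial.eval_mul, Polynomial.eval_C, ← hu a z hz, mul_comm]⟩

lemma norm_eq_of_norm_sub_lt {x y : ℚ_[p]} (h : ‖x - y‖ < ‖y‖) : ‖x‖ = ‖y‖ := by
  have := IsUltrametricDist.norm_add_eq_max_of_norm_ne_norm h.ne
  rw [sub_add_cancel, max_eq_right h.le] at this
  exact this

lemma Phi_zero_eq_of_close {m l m₀ l₀ : ℚ_[p]} (hm : ‖m - m₀‖ < max ‖m₀‖ ‖l₀‖)
    (hl : ‖l - l₀‖ < max ‖m₀‖ ‖l₀‖) : (Phi χ 0 0 m l : L) = Phi χ 0 0 m₀ l₀ := by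
  rcases le_or_gt ‖m₀‖ ‖l₀‖ with h | h
  · rw [max_eq_right h] at hm hl
    have hl' := norm_eq_of_norm_sub_lt hl
    have hl0 : l₀ ≠ 0 := norm_pos_iff.1 ((norm_nonneg _).trans_lt hl)
    have hl1 : l ≠ 0 := by rw [← norm_ne_zero_iff, hl']; exact norm_ne_zero_iff.2 hl0
    have hm' : ‖m‖ ≤ ‖l‖ := by
      rw [hl', show m = (m - m₀) + m₀ by ring]
      exact (IsUltrametricDist.norm_add_le_max _ _).trans (max_le hm.le h)
    rw [Phi, Phi, if_pos ⟨hl1, hm'⟩, if_pos ⟨hl0, h⟩, valuation_eq_of_norm_eq hl']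
    simp
  · rw [max_eq_left h.le] at hm hl
    have hm' := norm_eq_of_norm_sub_lt hm
    have hl' : ‖l‖ < ‖m‖ := by
      rw [hm', show l = (l - l₀) + l₀ by ring]
      exact (IsUltrametricDist.norm_add_le_max _ _).trans_lt (max_lt hl h)
    rw [Phi, Phi, if_neg (fun hh => absurd hh.2 (not_le.2 hl')),
      if_neg (fun hh => absurd hh.2 (not_le.2 h))]

lemma locConst_Phi_zero {a b c e : ℚ_[p]} (h : a * e - b * c ≠ 0) :
    LocConst p L fun z => Phi χ 0 0 (a * z + b) (c * z + e) := by
  have hp := p_pos (p := p)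
  intro x
  have hM : 0 < max ‖a * x + b‖ ‖c * x + e‖ := by
    by_contra hM
    rw [not_lt, max_le_iff, norm_le_zero_iff, norm_le_zero_iff] at hM
    exact h (by linear_combination a * hM.2 - c * hM.1)
  obtain ⟨n, hn⟩ := PadicInt.exists_pow_neg_lt p
    (show 0 < max ‖a * x + b‖ ‖c * x + e‖ / (max ‖a‖ ‖c‖ + 1) by positivity)
  rw [lt_div_iff₀ (by positivity)] at hn
  refine ⟨n, fun y hy => Phi_zero_eq_of_close ?_ ?_⟩
  · rw [show a * y + b - (a * x + b) = (y - x) * a by ring, norm_mul]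
    refine lt_of_le_of_lt ?_ hn
    gcongr
    linarith [le_max_left ‖a‖ ‖c‖]
  · rw [show c * y + e - (c * x + e) = (y - x) * c by ring, norm_mul]
    refine lt_of_le_of_lt ?_ hn
    gcongr
    linarith [le_max_right ‖a‖ ‖c‖]

lemma natDegree_linear_pow_mul_le (a b c e : L) {j : ℕ} (hj : j ≤ d) :
    ((Polynomial.C a * Polynomial.X + Polynomial.C b) ^ j *
      (Polynomial.C c * Polynomial.X + Polynomial.C e) ^ (d - j)).natDegree ≤ d := by
  refine Polynomial.natDegree_mul_le.trans ?_
  have h1 := Polynomial.natDegree_pow_le_of_le j (Polynomial.natDegree_linear_le (a := a) (b := b))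
  have h2 := Polynomial.natDegree_pow_le_of_le (d - j)
    (Polynomial.natDegree_linear_le (a := c) (b := e))
  omega

lemma res_mem_piRep (h : Data p k α β χ d r) {F : ℚ_[p] → ℚ_[p] → L} (hF : F ∈ PiF p α χ d) :
    res F ∈ piRep p L k α β := by
  induction hF using Submodule.span_induction with
  | zero => exact zero_mem _
  | add F G _ _ hF hG => exact add_mem hF hG
  | smul c F _ hF => exact Submodule.smul_mem _ c hF
  | mem F hF =>
    obtain ⟨a, b, c, e, j, hdet, hj, rfl⟩ := hF
    have : res (act α a b c e (Phi χ d j)) = α ^ (-(a * e - b * c).valuation) • fun z =>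
        Polynomial.eval (iotaL p L z) ((Polynomial.C (iotaL p L a) * Polynomial.X +
          Polynomial.C (iotaL p L b)) ^ j * (Polynomial.C (iotaL p L c) * Polynomial.X +
          Polynomial.C (iotaL p L e)) ^ (d - j)) * Phi χ 0 0 (a * z + b) (c * z + e) := by
      funext z
      rw [res, act, Pi.smul_apply, smul_eq_mul, Phi, Phi, mul_one, mul_one]
      split_ifs
      · rw [Polynomial.eval_mul, Polynomial.eval_pow, Polynomial.eval_pow, iotaL_add, iotaL_add,
          iotaL_mul, iotaL_mul]
        simp only [Polynomial.eval_add, Polynomial.eval_mul, Polynomial.eval_C, Polynomial.eval_X]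
        ring
      · simp
    rw [this]
    refine Submodule.smul_mem _ _ (Submodule.subset_span ⟨_, _, ?_,
      ⟨locConst_Phi_zero hdet, fun z => Phi χ 0 0 (b * z + a) (e * z + c), ?_, fun z hz => ?_⟩, rfl⟩)
    · rw [← h.d_eq]; exact natDegree_linear_pow_mul_le _ _ _ _ hj
    · exact locConst_Phi_zero fun h0 => hdet (by linear_combination -h0)
    · have := (hom_Phi (p := p) (d := 0) h.chi_ne_zero le_rfl).2 z hz (a * z⁻¹ + b) (c * z⁻¹ + e)
      rw [← h.chi_eq]
      rw [pow_zero, mul_one] at this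
      rw [← this, show z * (a * z⁻¹ + b) = b * z + a by field_simp; ring,
        show z * (c * z⁻¹ + e) = e * z + c by field_simp; ring]

lemma eval_reflect {P : Polynomial L} (hP : P.natDegree ≤ d) {x : L} (hx : x ≠ 0) :
    (Polynomial.reflect d P).eval x = x ^ d * P.eval x⁻¹ := by
  let _ : Invertible x⁻¹ := invertibleOfNonzero (inv_ne_zero hx)
  have := Polynomial.eval₂_reflect_mul_pow (RingHom.id L) x⁻¹ d P hP
  rw [invOf_eq_inv, inv_inv] at this
  rw [Polynomial.eval, Polynomial.eval, ← this, mul_left_comm, ← mul_pow, mul_inv_cancel₀ hx,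
    one_pow, mul_one]

lemma exists_mem_PiF_of_mem_piRep (h : Data p k α β χ d r) {f : ℚ_[p] → L}
    (hf : f ∈ piRep p L k α β) : ∃ F ∈ PiF p α χ d, res F = f := by
  have hp := p_pos (p := p)
  induction hf using Submodule.span_induction with
  | zero => exact ⟨0, zero_mem _, rfl⟩
  | add f g _ _ hf hg =>
    obtain ⟨F, hF, rfl⟩ := hf
    obtain ⟨G, hG, rfl⟩ := hg
    exact ⟨F + G, add_mem hF hG, rfl⟩
  | smul c f _ hf =>
    obtain ⟨F, hF, rfl⟩ := hf
    exact ⟨c • F, Submodule.smul_mem _ c hF, rfl⟩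
  | mem f hf =>
    obtain ⟨P, u, hP, ⟨hu, v, hv, huv⟩, rfl⟩ := hf
    rw [← h.d_eq] at hP
    rw [← h.chi_eq] at huv
    obtain ⟨N₁, hN₁⟩ := exists_uniform_level (u := fun z : ℤ_[p] => u ((p : ℚ_[p]) * (z : ℚ_[p])))
      (fun x => by
        obtain ⟨n, hn⟩ := hu ((p : ℚ_[p]) * (x : ℚ_[p]))
        refine ⟨n, fun y hy => hn _ ?_⟩
        rw [← mul_sub, norm_mul, ← PadicInt.coe_sub, ← PadicInt.norm_def, Padic.norm_p]
        refine le_trans (mul_le_of_le_one_left (norm_nonneg _) ?_) hy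
        exact inv_le_one_of_one_le₀ one_lt_p.le)
    obtain ⟨N₂, hN₂⟩ := exists_uniform_level (u := fun z : ℤ_[p] => v (z : ℚ_[p]))
      (fun x => by
        obtain ⟨n, hn⟩ := hv (x : ℚ_[p])
        exact ⟨n, fun y hy => hn _ (by rwa [← PadicInt.coe_sub, ← PadicInt.norm_def])⟩)
    have hQ : (P.comp (Polynomial.C (p : L) * Polynomial.X)).natDegree ≤ d := by
      refine Polynomial.natDegree_comp_le.trans ?_
      have : (Polynomial.C (p : L) * Polynomial.X).natDegree ≤ 1 :=
        (Polynomial.natDegree_C_mul_le _ _).trans Polynomial.natDegree_X_le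
      nlinarith
    have hR : (Polynomial.reflect d P).natDegree ≤ d := by
      refine (Polynomial.natDegree_reflect_le).trans (by simp [hP])
    have h1 := lift1_mem_PiF h.toGood (LPn_poly_mul hQ hN₁)
    have h2 := lift2_mem_PiF h.toGood (LPn_poly_mul hR hN₂)
    refine ⟨_, add_mem h1 h2, ?_⟩
    have := res_lift (d := d) h.chi_ne_zero (f := fun z => P.eval (iotaL p L z) * u z)
      (g := fun z : ℤ_[p] => (Polynomial.reflect d P).eval (iotaL p L (z : ℚ_[p])) *
        v (z : ℚ_[p])) (fun z hz => by
        have hz' : (z : ℚ_[p]) ≠ 0 := by simpa using hz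
        rw [huv _ hz', eval_reflect hP (by simpa [iotaL_eq_zero] using hz'), iotaL_inv]
        ring)
    rw [← this]
    congr 3
    funext z
    rw [Polynomial.eval_comp, iotaL_mul, iotaL_natCast]
    simp

end locally_algebraic

section lattices

variable {k : ℕ} {α β χ : L} {d : ℕ}

lemma Phi_mem_PhiGen {j : ℕ} (hj : j ≤ d) : (Phi χ d j : ℚ_[p] → ℚ_[p] → L) ∈ PhiGen α χ d :=
  ⟨1, 0, 0, 1, j, by simp, hj, (act_one _).symm⟩

lemma Phi_mem_PiF {j : ℕ} (hj : j ≤ d) : (Phi χ d j : ℚ_[p] → ℚ_[p] → L) ∈ PiF p α χ d :=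
  Submodule.subset_span (Phi_mem_PhiGen hj)

lemma res_act_eq_gAct (h : Data p k α β χ d r) {F : ℚ_[p] → ℚ_[p] → L} (hF : Nice χ d r F)
    {a b c e : ℚ_[p]} (hdet : a * e - b * c ≠ 0) : det2 p !![e, -b; -c, a] ≠ 0 ∧
      res (act α a b c e F) = gAct p L k α β !![e, -b; -c, a] (res F) := by
  have hd : det2 p !![e, -b; -c, a] ≠ 0 := by
    have : det2 p !![e, -b; -c, a] = a * e - b * c := by simp [det2]; ring
    rwa [this]
  refine ⟨hd, ?_⟩
  rw [hF.gAct_res h hd]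
  simp

/-- A stable lattice contains a multiple of `LamF`. -/
lemma IsLatticeStable.exists_smul_LamF (h : Data p k α β χ d r) {Λ : Set (ℚ_[p] → L)}
    (hΛ : IsLatticeStable p L k α β Λ) :
    ∃ c : L, c ≠ 0 ∧ ∀ F ∈ LamF p α χ d, c • res F ∈ Λ := by
  obtain ⟨-, h0, hadd, hsmul, hgen, -, hstab⟩ := hΛ
  have hind : ∀ n : ℕ, ∃ c : L, c ≠ 0 ∧ ∀ j < n, j ≤ d →
      c • res (Phi χ d j : ℚ_[p] → ℚ_[p] → L) ∈ Λ := by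
    intro n
    induction n with
    | zero => exact ⟨1, one_ne_zero, fun j hj => absurd hj (Nat.not_lt_zero j)⟩
    | succ n ih =>
      obtain ⟨c, hc, hcΛ⟩ := ih
      by_cases hn : n ≤ d
      · obtain ⟨c', hc', hc'Λ⟩ := hgen _ (res_mem_piRep h (Phi_mem_PiF (α := α) hn))
        obtain ⟨t, ht0, ht⟩ := NormedField.exists_norm_lt L
          (lt_min (norm_pos_iff.2 hc) (norm_pos_iff.2 hc'))
        have key : ∀ (b : L) (f : ℚ_[p] → L), b ≠ 0 → ‖t‖ ≤ ‖b‖ → b • f ∈ Λ → t • f ∈ Λ := by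
          intro b f hb htb hf
          have := hsmul (t / b) (by rw [norm_div]; exact div_le_one_of_le₀ htb (norm_nonneg _)) _ hf
          rwa [smul_smul, div_mul_cancel₀ _ hb] at this
        refine ⟨t, norm_pos_iff.1 ht0, fun j hj hjd => ?_⟩
        rcases Nat.lt_succ_iff_lt_or_eq.1 hj with hj | rfl
        · exact key c _ hc (ht.le.trans (min_le_left _ _)) (hcΛ j hj hjd)
        · exact key c' _ hc' (ht.le.trans (min_le_right _ _)) hc'Λ
      · exact ⟨c, hc, fun j hj hjd => hcΛ j (by omega) hjd⟩
  obtain ⟨c, hc, hcΛ⟩ := hind (d + 1)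
  refine ⟨c, hc, fun F hF => ?_⟩
  refine hF {F | c • res F ∈ Λ} ⟨?_, ?_, ?_⟩ ?_
  · rw [Set.mem_ofPred_eq, res_zero, smul_zero]; exact h0
  · intro F hF G hG
    rw [Set.mem_ofPred_eq, res_add, smul_add]; exact hadd _ hF _ hG
  · intro b hb F hF
    rw [Set.mem_ofPred_eq, res_smul, smul_comm]; exact hsmul b hb _ hF
  · rintro _ ⟨a, b, e, g, j, hdet, hj, rfl⟩
    have hN := (nice_of_mem_PiF h.toGood (Phi_mem_PiF (α := α) (χ := χ) hj)).smul c
    obtain ⟨h1, h2⟩ := res_act_eq_gAct h hN hdet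
    rw [Set.mem_ofPred_eq, ← res_smul, ← act_smul, h2]
    exact hstab _ h1 _ (hcΛ j (by omega) hj)

lemma res_Phi_zero_ne_zero : res (Phi χ d 0 : ℚ_[p] → ℚ_[p] → L) ≠ 0 := by
  intro h
  have := congrFun h 0
  simp [res, Phi, iotaL_one] at this

/-- If `π(α)` contains a stable lattice, then `B(α)/L(α)` is nonzero. -/
lemma IsLatticeStable.exists_not_memLalpha (h : Data p k α β χ d r) {Λ : Set (ℚ_[p] → L)}
    (hΛ : IsLatticeStable p L k α β Λ) :
    ∃ f, MemB p L k α β f ∧ ¬MemLalpha p L k α β f := by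
  by_contra! hall
  obtain ⟨c₀, hc₀, hc⟩ := hΛ.exists_smul_LamF h
  obtain ⟨K, hK, hKc⟩ := exists_smul_mem_LamF h.toGood
  have hall' : ∀ F ∈ PiF p α χ d, F ∈ LamF p α χ d := fun F hF => by
    have hN := nice_of_mem_PiF h.toGood hF
    obtain ⟨G, hG, hb⟩ := (hN.memLalpha_iff h).1 (hall _ (hN.memB h)) (1 / K) (by positivity)
    obtain ⟨U, hU, hb'⟩ := exists_mem_LamF_BBd_sub h.toGood hG (show 0 < 1 / K by positivity)
    have hFU := hb.add hb'
    rw [sub_add_sub_cancel] at hFU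
    have := hKc _ _ 1 (sub_mem hF (LamF_subset_PiF hU)) hFU
      (by rw [norm_one, one_mul, mul_one_div, div_self hK.ne'])
    rw [one_smul] at this
    have := isOMod_LamF.add_mem _ this _ hU
    rwa [sub_add_cancel] at this
  refine hΛ.2.2.2.2.2.1 _ (res_mem_piRep h (Phi_mem_PiF (α := α) (Nat.zero_le d)))
    res_Phi_zero_ne_zero fun c => ?_
  have := hc _ (hall' _ (Submodule.smul_mem _ (c₀⁻¹ * c) (Phi_mem_PiF (Nat.zero_le d))))
  rwa [res_smul, smul_smul, mul_inv_cancel_left₀ hc₀] at this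

/-- If `LamF` contains no line, it gives a stable lattice in `π(α)`. -/
lemma isLatticeStable_res_LamF (h : Data p k α β χ d r)
    (hline : ∀ F ∈ PiF p α χ d, (∀ c : L, c • F ∈ LamF p α χ d) → F = 0) :
    IsLatticeStable p L k α β (Set.image res (LamF p α χ d)) := by
  refine ⟨?_, ⟨0, isOMod_LamF.zero_mem, rfl⟩, ?_, ?_, ?_, ?_, ?_⟩
  · rintro _ ⟨F, hF, rfl⟩
    exact res_mem_piRep h (LamF_subset_PiF hF)
  · rintro _ ⟨F, hF, rfl⟩ _ ⟨G, hG, rfl⟩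
    exact ⟨F + G, isOMod_LamF.add_mem _ hF _ hG, rfl⟩
  · rintro c hc _ ⟨F, hF, rfl⟩
    exact ⟨c • F, isOMod_LamF.smul_mem c hc _ hF, rfl⟩
  · intro f hf
    obtain ⟨F, hF, rfl⟩ := exists_mem_PiF_of_mem_piRep h hf
    obtain ⟨δ, hδ, hc⟩ := exists_forall_smul_mem_LamF hF
    obtain ⟨c, hc0, hcδ⟩ := NormedField.exists_norm_lt L hδ
    exact ⟨c, norm_pos_iff.1 hc0, c • F, hc c hcδ.le, rfl⟩
  · intro f hf hf0 hc
    obtain ⟨F, hF, rfl⟩ := exists_mem_PiF_of_mem_piRep h hf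
    refine hf0 ?_
    rw [hline F hF, res_zero]
    intro c
    obtain ⟨G, hG, hGe⟩ := hc c
    have := (nice_of_mem_PiF h.toGood (LamF_subset_PiF hG)).res_injective h
      ((nice_of_mem_PiF h.toGood hF).smul c) hGe
    rwa [← this]
  · rintro m hm _ ⟨F, hF, rfl⟩
    refine ⟨_, act_mem_LamF h.alpha_ne_zero ?_ hF,
      ((nice_of_mem_PiF h.toGood (LamF_subset_PiF hF)).gAct_res h hm).symm⟩
    have : m 1 1 * m 0 0 - -(m 0 1) * -(m 1 0) = det2 p m := by rw [det2]; ring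
    rwa [this]

/-- If `LamF` is everything, then `L(α) = B(α)`. -/
lemma memLalpha_of_forall_mem_LamF (h : Data p k α β χ d r)
    (hall : ∀ F ∈ PiF p α χ d, F ∈ LamF p α χ d) {f : ℚ_[p] → L} (hf : MemB p L k α β f) :
    MemLalpha p L k α β f := by
  obtain ⟨F, hF, rfl⟩ := exists_nice_of_memB h hf
  rw [hF.memLalpha_iff h]
  intro ε hε
  obtain ⟨N₁, u, hu, hub⟩ := hF.2.1.exists_LPn_crBd_sub h.r_pos.le h.r_lt hε
  obtain ⟨N₂, v, hv, hvb⟩ := hF.2.2.exists_LPn_crBd_sub h.r_pos.le h.r_lt hε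
  have hU := add_mem (lift1_mem_PiF h.toGood hu) (lift2_mem_PiF h.toGood hv)
  have hFU : BBd r (F - (lift1 χ d u + lift2 χ d v)) ε := by
    constructor
    · rw [show ch1 (F - (lift1 χ d u + lift2 χ d v)) =
        ch1 F - ch1 (lift1 χ d u + lift2 χ d v) from rfl, ch1_lift]
      exact hub
    · rw [show ch2 (F - (lift1 χ d u + lift2 χ d v)) =
        ch2 F - ch2 (lift1 χ d u + lift2 χ d v) from rfl, ch2_lift]
      exact hvb
  obtain ⟨C, hC, hCb⟩ := exists_BBd_sub_of_mem_LamF h.toGood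
  obtain ⟨c, hc0, hcε⟩ := NormedField.exists_norm_lt L (show 0 < ε / C by positivity)
  have hc : c ≠ 0 := norm_pos_iff.1 hc0
  obtain ⟨G, hG, hb⟩ := hCb _ (hall _ (Submodule.smul_mem _ c⁻¹ hU))
  refine ⟨c • G, Submodule.smul_mem _ c hG, ?_⟩
  have := (hb.smul c).mono (C' := ε) (by rw [lt_div_iff₀ hC] at hcε; exact hcε.le)
  rw [smul_sub, smul_smul, mul_inv_cancel₀ hc, one_smul] at this
  have := hFU.add this
  rwa [sub_add_sub_cancel] at this

end lattices

section line

variable {k : ℕ} {α β χ : L} {d : ℕ}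

/-- Properties of a space of functions on the affine line coming from a subrepresentation of the
locally algebraic representation. -/
structure AffRep (χ : L) (d : ℕ) (V : Submodule L (ℚ_[p] → L)) : Prop where
  trans : ∀ f ∈ V, ∀ b : ℚ_[p], (fun z => f (z + b)) ∈ V
  scale : ∀ f ∈ V, ∀ t : ℚ_[p], t ≠ 0 → (fun z => f (t * z)) ∈ V
  inv : ∀ f ∈ V, (∃ R : ℝ, ∀ z : ℚ_[p], R < ‖z‖ → f z = 0) →
    (fun z => if z = 0 then 0 else χ ^ z.valuation * iotaL p L z ^ d * f z⁻¹) ∈ V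
  level : ∀ f ∈ V, ∃ N : ℕ, ∀ z : ℚ_[p], ∃ P : Polynomial L, P.natDegree ≤ d ∧
    ∀ y : ℚ_[p], ‖y - z‖ ≤ (p : ℝ) ^ (-(N : ℤ)) → f y = P.eval (iotaL p L y)
  infty : ∀ f ∈ V, ∃ (R : ℝ) (Q : Polynomial L), ∀ y : ℚ_[p], R < ‖y‖ →
    f y = χ ^ y.valuation * Q.eval (iotaL p L y)

/-- The largest subspace contained in `LamF`. -/
def lineF (p : ℕ) [Fact p.Prime] {L : Type} [NontriviallyNormedField L] [NormedAlgebra ℚ_[p] L]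
    [IsUltrametricDist L] [CompleteSpace L]
    (α χ : L) (d : ℕ) : Submodule L (ℚ_[p] → ℚ_[p] → L) where
  carrier := {F | ∀ c : L, c • F ∈ LamF p α χ d}
  zero_mem' := fun c => by rw [smul_zero]; exact isOMod_LamF.zero_mem
  add_mem' := fun {F G} hF hG c => by rw [smul_add]; exact isOMod_LamF.add_mem _ (hF c) _ (hG c)
  smul_mem' := fun a F hF c => by rw [smul_smul]; exact hF (c * a)

lemma lineF_subset_LamF {F : ℚ_[p] → ℚ_[p] → L} (hF : F ∈ lineF p α χ d) : F ∈ LamF p α χ d := by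
  simpa using hF 1

lemma lineF_le_PiF {F : ℚ_[p] → ℚ_[p] → L} (hF : F ∈ lineF p α χ d) : F ∈ PiF p α χ d :=
  LamF_subset_PiF (lineF_subset_LamF hF)

lemma act_mem_lineF (hα : α ≠ 0) {a b c e : ℚ_[p]} (h : a * e - b * c ≠ 0)
    {F : ℚ_[p] → ℚ_[p] → L} (hF : F ∈ lineF p α χ d) : act α a b c e F ∈ lineF p α χ d := fun k => by
  rw [← act_smul]; exact act_mem_LamF hα h (hF k)

lemma iotaL_ne_zero {x : ℚ_[p]} (hx : x ≠ 0) : iotaL p L x ≠ 0 := by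
  simpa [iotaL_eq_zero] using hx

/-- A homogeneous function at `(z, 1)` in terms of its chart at infinity. -/
lemma Hom.res_eq {F : ℚ_[p] → ℚ_[p] → L} (hF : Hom χ d F) {z : ℚ_[p]} (hz : z ≠ 0) :
    res F z = χ ^ z.valuation * iotaL p L z ^ d * F 1 z⁻¹ := by
  rw [← hF.2 z hz, mul_one, mul_inv_cancel₀ hz, res]

lemma exists_level_of_LPn {F : ℚ_[p] → ℚ_[p] → L} (hF : Hom χ d F) {N : ℕ} (h1 : LPn d N (ch1 F))
    (h2 : LPn d N (ch2 F)) (z : ℚ_[p]) : ∃ P : Polynomial L, P.natDegree ≤ d ∧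
      ∀ y : ℚ_[p], ‖y - z‖ ≤ (p : ℝ) ^ (-((N + 1 : ℕ) : ℤ)) → res F y = P.eval (iotaL p L y) := by
  have hp := p_pos (p := p)
  have hpN : (p : ℝ) ^ (-((N + 1 : ℕ) : ℤ)) = (p : ℝ) ^ (-(N : ℤ)) * (p : ℝ)⁻¹ := by
    rw [Nat.cast_add, neg_add, zpow_add₀ hp.ne', Nat.cast_one, zpow_neg_one]
  have hN1 : (p : ℝ) ^ (-(N : ℤ)) ≤ 1 := zpow_le_one_of_nonpos₀ one_lt_p.le (by omega)
  have hinv : (p : ℝ)⁻¹ < 1 := inv_lt_one_of_one_lt₀ one_lt_p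
  have hlt : (p : ℝ) ^ (-((N + 1 : ℕ) : ℤ)) < 1 := by
    rw [hpN]; nlinarith [inv_pos.2 hp]
  by_cases hz : ‖z‖ < 1
  · have hdiv : ∀ y : ℚ_[p], ‖y‖ < 1 → ‖y / p‖ ≤ 1 := fun y hy => by
      have := (norm_div_p_le_iff y one_ne_zero).2 (by simpa using hy)
      simpa using this
    obtain ⟨P, hP, hPe⟩ := h1 (toZ (z / p))
    refine ⟨P.comp (Polynomial.C (p : L)⁻¹ * Polynomial.X), ?_, fun y hy => ?_⟩
    · refine Polynomial.natDegree_comp_le.trans ?_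
      have : (Polynomial.C (p : L)⁻¹ * Polynomial.X).natDegree ≤ 1 :=
        (Polynomial.natDegree_C_mul_le _ _).trans Polynomial.natDegree_X_le
      nlinarith
    · have hy1 : ‖y‖ < 1 := by
        rw [show y = (y - z) + z by ring]
        exact (IsUltrametricDist.norm_add_le_max _ _).trans_lt (max_lt (hy.trans_lt hlt) hz)
      have := hPe (toZ (y / p)) (by
        rw [PadicInt.norm_def, PadicInt.coe_sub, coe_toZ (hdiv y hy1), coe_toZ (hdiv z hz),
          ← sub_div, norm_div, Padic.norm_p, div_inv_eq_mul]
        rw [hpN, ← div_eq_mul_inv, le_div_iff₀ hp] at hy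
        exact hy)
      rw [ch1, coe_toZ (hdiv y hy1), mul_div_cancel₀ _ p_ne_zero'] at this
      rw [res, this, Polynomial.eval_comp, iotaL_div, iotaL_natCast, Polynomial.eval_mul,
        Polynomial.eval_C, Polynomial.eval_X, div_eq_inv_mul]
  · rw [not_lt] at hz
    have hz0 : z ≠ 0 := norm_pos_iff.1 (zero_lt_one.trans_le hz)
    have hzi : ‖z⁻¹‖ ≤ 1 := by rw [norm_inv]; exact inv_le_one_of_one_le₀ hz
    obtain ⟨P, hP, hPe⟩ := h2 (toZ z⁻¹)
    refine ⟨Polynomial.C (χ ^ z.valuation) * Polynomial.reflect d P,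
      (Polynomial.natDegree_C_mul_le _ _).trans (Polynomial.natDegree_reflect_le.trans
        (by simp [hP])), fun y hy => ?_⟩
    have hyz : ‖y‖ = ‖z‖ := norm_eq_of_norm_sub_lt (hy.trans_lt (hlt.trans_le hz))
    have hy0 : y ≠ 0 := by rw [← norm_ne_zero_iff, hyz]; exact norm_ne_zero_iff.2 hz0
    have hyi : ‖y⁻¹‖ ≤ 1 := by rw [norm_inv, hyz]; exact inv_le_one_of_one_le₀ hz
    have := hPe (toZ y⁻¹) (by
      rw [PadicInt.norm_def, PadicInt.coe_sub, coe_toZ hyi, coe_toZ hzi,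
        show y⁻¹ - z⁻¹ = -(y - z) * (y⁻¹ * z⁻¹) by field_simp; ring, norm_mul, norm_neg, norm_mul]
      have h3 : ‖y⁻¹‖ * ‖z⁻¹‖ ≤ 1 := mul_le_one₀ hyi (norm_nonneg _) hzi
      refine (mul_le_of_le_one_right (norm_nonneg _) h3).trans (hy.trans ?_)
      rw [hpN]
      exact mul_le_of_le_one_right (by positivity) hinv.le)
    rw [ch2, coe_toZ hyi] at this
    rw [hF.res_eq hy0, this, Polynomial.eval_mul, Polynomial.eval_C,
      eval_reflect hP (iotaL_ne_zero hy0), valuation_eq_of_norm_eq hyz, iotaL_inv, mul_assoc]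

lemma exists_infty_of_LPn {F : ℚ_[p] → ℚ_[p] → L} (hF : Hom χ d F) {N : ℕ}
    (h2 : LPn d N (ch2 F)) : ∃ (R : ℝ) (Q : Polynomial L), ∀ y : ℚ_[p], R < ‖y‖ →
      res F y = χ ^ y.valuation * Q.eval (iotaL p L y) := by
  have hp := p_pos (p := p)
  obtain ⟨P, hP, hPe⟩ := h2 0
  refine ⟨(p : ℝ) ^ N, Polynomial.reflect d P, fun y hy => ?_⟩
  have hpN : 1 ≤ (p : ℝ) ^ N := one_le_pow₀ one_lt_p.le
  have hy0 : y ≠ 0 := norm_pos_iff.1 ((zero_lt_one.trans_le hpN).trans hy)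
  have hyi : ‖y⁻¹‖ ≤ (p : ℝ) ^ (-(N : ℤ)) := by
    rw [norm_inv, zpow_neg, zpow_natCast]
    exact inv_anti₀ (by positivity) hy.le
  have hyi1 : ‖y⁻¹‖ ≤ 1 := hyi.trans (zpow_le_one_of_nonpos₀ one_lt_p.le (by omega))
  have := hPe (toZ y⁻¹) (by rwa [PadicInt.norm_def, PadicInt.coe_sub, coe_toZ hyi1,
    PadicInt.coe_zero, sub_zero])
  rw [ch2, coe_toZ hyi1] at this
  rw [hF.res_eq hy0, this, eval_reflect hP (iotaL_ne_zero hy0), iotaL_inv, mul_assoc]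

/-- A compactly supported element of `PiF` vanishes at infinity. -/
lemma Nice.apply_one_zero (hr : 0 ≤ r) {F : ℚ_[p] → ℚ_[p] → L} (hF : Nice χ d r F)
    (hsupp : ∃ R : ℝ, ∀ z : ℚ_[p], R < ‖z‖ → res F z = 0) : F 1 0 = 0 := by
  have hp := p_pos (p := p)
  obtain ⟨R, hR⟩ := hsupp
  have ht : Tendsto (fun n : ℕ => (p : ℤ_[p]) ^ n) atTop (𝓝 0) :=
    tendsto_pow_atTop_nhds_zero_of_norm_lt_one
      (by rw [PadicInt.norm_p]; exact inv_lt_one_of_one_lt₀ one_lt_p)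
  have h1 := ((hF.2.2.continuous hr).tendsto 0).comp ht
  have h2 : ∀ᶠ n : ℕ in atTop, (0 : L) = (ch2 F ∘ fun n : ℕ => (p : ℤ_[p]) ^ n) n := by
    filter_upwards [(tendsto_pow_atTop_atTop_of_one_lt (one_lt_p (p := p))).eventually_gt_atTop R]
      with n hn
    have hpn : ((p : ℚ_[p]) ^ n)⁻¹ ≠ 0 := inv_ne_zero (pow_ne_zero _ p_ne_zero')
    have h3 := hR ((p : ℚ_[p]) ^ n)⁻¹ (by
      rw [norm_inv, norm_pow, Padic.norm_p, inv_pow, inv_inv]; exact hn)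
    rw [hF.1.res_eq hpn, inv_inv] at h3
    have h5 : F 1 ((p : ℚ_[p]) ^ n) = 0 := by
      by_contra h6
      rcases mul_eq_zero.1 ((mul_eq_zero.1 h3).resolve_right h6) with h7 | h7
      · have hχ : χ = 0 := by
          by_contra hχ
          exact zpow_ne_zero _ hχ h7
        have := hF.1.2 (p : ℚ_[p]) p_ne_zero' ((p : ℚ_[p])⁻¹) ((p : ℚ_[p])⁻¹ * (p : ℚ_[p]) ^ n)
        rw [mul_inv_cancel₀ p_ne_zero', mul_inv_cancel_left₀ p_ne_zero', hχ, Padic.valuation_p,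
          zpow_one, zero_mul, zero_mul] at this
        exact h6 this
      · exact pow_ne_zero _ (iotaL_ne_zero hpn) h7
    simp [ch2, h5]
  have h3 := tendsto_nhds_unique (tendsto_const_nhds.congr' h2) h1
  rw [ch2, PadicInt.coe_zero] at h3
  exact h3.symm

lemma affRep_map_lineF (h : Good p α χ d r) :
    AffRep χ d ((lineF p α χ d).map (resHom : (ℚ_[p] → ℚ_[p] → L) →ₗ[L] (ℚ_[p] → L))) where
  trans := by
    rintro _ ⟨F, hF, rfl⟩ b
    refine ⟨act α 1 b 0 1 F, act_mem_lineF h.alpha_ne_zero (by simp) hF, ?_⟩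
    funext z
    simp [resHom, res, act]
  scale := by
    rintro _ ⟨F, hF, rfl⟩ t ht
    refine ⟨α ^ t.valuation • act α t 0 0 1 F,
      Submodule.smul_mem _ _ (act_mem_lineF h.alpha_ne_zero (by simpa using ht) hF), ?_⟩
    funext z
    simp [resHom, res, act, h.alpha_ne_zero]
    rw [mul_inv_cancel_left₀ (zpow_ne_zero _ h.alpha_ne_zero)]
  inv := by
    rintro _ ⟨F, hF, rfl⟩ hsupp
    refine ⟨act α 0 1 1 0 F, act_mem_lineF h.alpha_ne_zero (by simp) hF, ?_⟩
    have hN := nice_of_mem_PiF h (lineF_le_PiF hF)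
    have h0 := hN.apply_one_zero h.r_pos.le hsupp
    rw [act_eq_of_norm_det (by simp)]
    funext z
    split_ifs with hz
    · simp [resHom, res, hz, h0]
    · have := hN.1.2 z hz z⁻¹ 1
      rw [mul_inv_cancel₀ hz, mul_one] at this
      simp [resHom, res, this]
  level := by
    rintro _ ⟨F, hF, rfl⟩
    obtain ⟨N, h1, h2⟩ := exists_LPn_of_mem_PiF h (lineF_le_PiF hF)
    exact ⟨N + 1, exists_level_of_LPn (hom_of_mem_PiF h.chi_ne_zero (lineF_le_PiF hF)) h1 h2⟩
  infty := by
    rintro _ ⟨F, hF, rfl⟩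
    obtain ⟨N, h1, h2⟩ := exists_LPn_of_mem_PiF h (lineF_le_PiF hF)
    exact exists_infty_of_LPn (hom_of_mem_PiF h.chi_ne_zero (lineF_le_PiF hF)) h2

end line

section smooth
variable {χ : L} {d : ℕ} {V : Submodule L (ℚ_[p] → L)}

lemma charZero_of_padic (p : ℕ) [Fact p.Prime] (L : Type) [NontriviallyNormedField L]
    [NormedAlgebra ℚ_[p] L] : CharZero L :=
  charZero_of_injective_algebraMap (algebraMap ℚ_[p] L).injective

/-- A polynomial taking the same value along an arithmetic progression is constant. -/
lemma eval_eq_of_forall_nat {P : Polynomial L} {y c : ℚ_[p]} (hc : c ≠ 0) {s : L}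
    (h : ∀ t : ℕ, P.eval (iotaL p L (y + t * c)) = s) (x : L) : P.eval x = s := by
  have hP : P - Polynomial.C s = 0 := by
    refine Polynomial.eq_zero_of_infinite_isRoot _ ?_
    refine Set.Infinite.mono (s := Set.range fun t : ℕ => iotaL p L (y + t * c)) ?_ ?_
    · rintro _ ⟨t, rfl⟩
      simp [Polynomial.IsRoot, h t]
    · refine Set.infinite_range_of_injective fun t t' htt => ?_
      have h1 := (algebraMap ℚ_[p] L).injective htt
      exact_mod_cast mul_right_cancel₀ hc (add_left_cancel h1)
  rw [sub_eq_zero.1 hP, Polynomial.eval_C]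

/-- `f` is given by a polynomial on each ball of radius `p^{-N}`. -/
def BallPoly (N : ℕ) (f : ℚ_[p] → L) : Prop :=
  ∀ z : ℚ_[p], ∃ P : Polynomial L,
    ∀ y : ℚ_[p], ‖y - z‖ ≤ (p : ℝ) ^ (-(N : ℤ)) → f y = P.eval (iotaL p L y)

lemma norm_natCast_mul_pow_le (N t : ℕ) :
    ‖(t : ℚ_[p]) * (p : ℚ_[p]) ^ N‖ ≤ (p : ℝ) ^ (-(N : ℤ)) := by
  rw [norm_mul, norm_pow, Padic.norm_p, zpow_neg, zpow_natCast, inv_pow]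
  exact mul_le_of_le_one_left (by positivity) (by exact_mod_cast Padic.norm_int_le_one (t : ℤ))

lemma BallPoly.fwdDiff_pow {N : ℕ} {f : ℚ_[p] → L} (hf : BallPoly N f) :
    BallPoly N (fwdDiff ((p : ℚ_[p]) ^ N) f) := by
  intro z
  obtain ⟨P, hP⟩ := hf z
  refine ⟨P.comp (Polynomial.X + Polynomial.C (iotaL p L ((p : ℚ_[p]) ^ N))) - P, fun y hy => ?_⟩
  rw [fwdDiff, hP y hy, hP (y + (p : ℚ_[p]) ^ N) ?_]
  · simp [iotaL_add]
  · rw [show y + (p : ℚ_[p]) ^ N - z = (y - z) + (p : ℚ_[p]) ^ N by ring]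
    refine (Padic.nonarchimedean _ _).trans (max_le hy ?_)
    simp [Padic.norm_p]

lemma BallPoly.iterate_fwdDiff {N : ℕ} {f : ℚ_[p] → L} (hf : BallPoly N f) (m : ℕ) :
    BallPoly N ((fwdDiff ((p : ℚ_[p]) ^ N))^[m] f) := by
  induction m with
  | zero => exact hf
  | succ m ih => rw [Function.iterate_succ_apply']; exact ih.fwdDiff_pow

lemma AffRep.iterate_fwdDiff (h : AffRep χ d V) {f : ℚ_[p] → L} (hf : f ∈ V) (c : ℚ_[p])
    (m : ℕ) : (fwdDiff c)^[m] f ∈ V := by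
  induction m with
  | zero => exact hf
  | succ m ih => rw [Function.iterate_succ_apply']; exact V.sub_mem (h.trans _ ih c) ih

lemma fwdDiff_iter_eq_zero_of_level {N : ℕ} {f : ℚ_[p] → L}
    (hf : ∀ z : ℚ_[p], ∃ P : Polynomial L, P.natDegree ≤ d ∧
      ∀ y : ℚ_[p], ‖y - z‖ ≤ (p : ℝ) ^ (-(N : ℤ)) → f y = P.eval (iotaL p L y)) :
    (fwdDiff ((p : ℚ_[p]) ^ N))^[d + 1] f = 0 := by
  funext z
  obtain ⟨P, hP, hP'⟩ := hf z
  have key := Polynomial.fwdDiff_iter_eq_zero_of_degree_lt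
    (P := P.comp (Polynomial.C (iotaL p L z) + Polynomial.C ((p : L) ^ N) * Polynomial.X))
    (n := d + 1) ?_
  · have key' := congrFun key 0
    rw [fwdDiff_iter_eq_sum_shift] at key' ⊢
    rw [Pi.zero_apply] at key' ⊢
    rw [← key']
    refine Finset.sum_congr rfl fun i _ => ?_
    congr 1
    rw [hP']
    · simp [iotaL_add, iotaL_mul, iotaL_natCast, iotaL_pow, mul_comm]
    · rw [add_sub_cancel_left, nsmul_eq_mul]
      exact norm_natCast_mul_pow_le N i
  · refine lt_of_le_of_lt Polynomial.natDegree_comp_le ?_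
    refine lt_of_le_of_lt (Nat.mul_le_mul hP (?_ : _ ≤ 1)) (by omega)
    refine (Polynomial.natDegree_add_le _ _).trans (max_le (by simp) ?_)
    exact (Polynomial.natDegree_C_mul_le _ _).trans (by simp)

lemma BallPoly.periodic {N : ℕ} {f : ℚ_[p] → L} (hf : BallPoly N f)
    (h0 : fwdDiff ((p : ℚ_[p]) ^ N) f = 0) {b : ℚ_[p]} (hb : ‖b‖ ≤ (p : ℝ) ^ (-(N : ℤ)))
    (z : ℚ_[p]) : f (z + b) = f z := by
  have h1 : ∀ (t : ℕ), f (z + t * (p : ℚ_[p]) ^ N) = f z := by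
    intro t
    induction t with
    | zero => simp
    | succ t ih =>
      rw [← ih, Nat.cast_succ, add_mul, one_mul, ← add_assoc]
      exact sub_eq_zero.1 (congrFun h0 (z + t * (p : ℚ_[p]) ^ N))
  obtain ⟨P, hP⟩ := hf z
  rw [hP (z + b) (by simpa using hb)]
  refine eval_eq_of_forall_nat (y := z) (pow_ne_zero N (p_ne_zero' (p := p))) (fun t => ?_) _
  rw [← hP _ (by rw [add_sub_cancel_left]; exact norm_natCast_mul_pow_le N t), h1]

/-- A nonzero space contains a nonzero function which is uniformly locally constant. -/
lemma AffRep.exists_periodic (h : AffRep χ d V) {f : ℚ_[p] → L} (hf : f ∈ V) (hf0 : f ≠ 0) :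
    ∃ g ∈ V, g ≠ 0 ∧ ∃ N : ℕ, ∀ b : ℚ_[p], ‖b‖ ≤ (p : ℝ) ^ (-(N : ℤ)) →
      ∀ z, g (z + b) = g z := by
  obtain ⟨N, hN⟩ := h.level f hf
  have hex : ∃ m, (fwdDiff ((p : ℚ_[p]) ^ N))^[m] f = 0 :=
    ⟨d + 1, fwdDiff_iter_eq_zero_of_level hN⟩
  have hB : BallPoly N f := fun z => (hN z).imp fun P hP => hP.2
  obtain ⟨m, hm⟩ : ∃ m, Nat.find hex = m + 1 :=
    Nat.exists_eq_succ_of_ne_zero fun h0 => hf0 (by simpa [h0] using Nat.find_spec hex)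
  refine ⟨(fwdDiff ((p : ℚ_[p]) ^ N))^[m] f, h.iterate_fwdDiff hf _ _,
    Nat.find_min hex (by omega), N, fun b hb z => ?_⟩
  refine (hB.iterate_fwdDiff m).periodic ?_ hb z
  have := Nat.find_spec hex
  rwa [hm, Function.iterate_succ_apply'] at this

lemma norm_add_eq_left {y b : ℚ_[p]} (h : ‖b‖ < ‖y‖) : ‖y + b‖ = ‖y‖ :=
  norm_eq_of_norm_sub_lt (by simpa using h)

lemma exists_lt_norm (R : ℝ) : ∃ M : ℕ, R < ‖((p : ℚ_[p]) ^ M)⁻¹‖ := by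
  obtain ⟨M, hM⟩ := pow_unbounded_of_one_lt R (one_lt_p (p := p))
  exact ⟨M, by rwa [norm_inv, norm_pow, Padic.norm_p, inv_pow, inv_inv]⟩

lemma AffRep.infty_of_periodic (h : AffRep χ d V) (hχ : χ ≠ 0) {g : ℚ_[p] → L} (hg : g ∈ V)
    {N : ℕ} (hN : ∀ b : ℚ_[p], ‖b‖ ≤ (p : ℝ) ^ (-(N : ℤ)) → ∀ z, g (z + b) = g z) :
    ∃ (R : ℝ) (c : L), ∀ y : ℚ_[p], R < ‖y‖ → g y = χ ^ y.valuation * c := by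
  obtain ⟨R, Q, hQ⟩ := h.infty g hg
  obtain ⟨M, hM⟩ := exists_lt_norm (p := p) (max R ((p : ℝ) ^ (-(N : ℤ))))
  have hc : ∀ x, Q.eval x = Q.eval (iotaL p L ((p : ℚ_[p]) ^ M)⁻¹) := by
    refine eval_eq_of_forall_nat (y := ((p : ℚ_[p]) ^ M)⁻¹)
      (pow_ne_zero N (p_ne_zero' (p := p))) fun t => ?_
    have hb := norm_natCast_mul_pow_le (p := p) N t
    have hn := norm_add_eq_left (hb.trans_lt ((le_max_right _ _).trans_lt hM))
    have h1 := hN _ hb ((p : ℚ_[p]) ^ M)⁻¹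
    rw [hQ _ ((le_max_left _ _).trans_lt (hn ▸ hM)), hQ _ ((le_max_left _ _).trans_lt hM),
      valuation_eq_of_norm_eq hn] at h1
    exact mul_left_cancel₀ (zpow_ne_zero _ hχ) h1
  exact ⟨R, _, fun y hy => by rw [hQ y hy, hc]⟩

/-- A nonzero space contains a nonzero, uniformly locally constant function of compact support. -/
lemma AffRep.exists_compact (h : AffRep χ d V) (hχ : χ ≠ 0) (hχ1 : χ ≠ 1) {f : ℚ_[p] → L}
    (hf : f ∈ V) (hf0 : f ≠ 0) :
    ∃ g ∈ V, g ≠ 0 ∧ (∃ N : ℕ, ∀ b : ℚ_[p], ‖b‖ ≤ (p : ℝ) ^ (-(N : ℤ)) →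
      ∀ z, g (z + b) = g z) ∧ ∃ R : ℝ, ∀ z, R < ‖z‖ → g z = 0 := by
  obtain ⟨g, hg, hg0, N, hN⟩ := h.exists_periodic hf hf0
  obtain ⟨R, c, hc⟩ := h.infty_of_periodic hχ hg hN
  have hb : ∃ b : ℚ_[p], (fun z => g (z + b)) - g ≠ 0 := by
    by_contra! hcon
    have hconst : ∀ b, g b = g 0 := fun b => by
      simpa [sub_eq_zero] using congrFun (hcon b) 0
    obtain ⟨M, hM⟩ := exists_lt_norm (p := p) R
    have hM' : R < ‖((p : ℚ_[p]) ^ (M + 1))⁻¹‖ := by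
      refine hM.trans_le ?_
      simp only [norm_inv, norm_pow, Padic.norm_p, inv_pow, inv_inv]
      exact pow_le_pow_right₀ one_lt_p.le (by omega)
    have h1 := hc _ hM
    have h2 := hc _ hM'
    rw [hconst, Padic.valuation_inv, Padic.valuation_pow, Padic.valuation_p] at h1 h2
    have h0 : g 0 ≠ 0 := fun h0 => hg0 (funext fun b => by rw [hconst, h0, Pi.zero_apply])
    have hcne : c ≠ 0 := fun hc0 => h0 (by rw [h1, hc0, mul_zero])
    have h3 := mul_right_cancel₀ hcne (h1.symm.trans h2)
    rw [show (-(((M + 1 : ℕ) : ℤ) * 1) : ℤ) = -((M : ℤ) * 1) - 1 by push_cast; ring,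
      zpow_sub_one₀ hχ] at h3
    have h4 : χ⁻¹ = 1 := mul_left_cancel₀ (zpow_ne_zero _ hχ) (h3.symm.trans (mul_one _).symm)
    exact hχ1 (inv_eq_one.1 h4)
  obtain ⟨b, hb⟩ := hb
  refine ⟨_, V.sub_mem (h.trans g hg b) hg, hb, ⟨N, fun c hc z => ?_⟩, max R ‖b‖, fun z hz => ?_⟩
  · simp only [Pi.sub_apply, hN c hc z, add_right_comm z c b, hN c hc (z + b)]
  · have hn := norm_add_eq_left ((le_max_right _ _).trans_lt hz)
    have hR := (le_max_left _ _).trans_lt hz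
    simp only [Pi.sub_apply, hc _ hR, hc _ (hn ▸ hR), valuation_eq_of_norm_eq hn, sub_self]

lemma norm_le_inv_of_lt_one {c : ℚ_[p]} (hc : ‖c‖ < 1) : ‖c‖ ≤ (p : ℝ)⁻¹ := by
  have := (Padic.norm_le_pow_iff_norm_lt_pow_add_one c (-1)).2 (by simpa using hc)
  simpa using this

/-- A nonzero space contains a compactly supported function which is invariant under `pℤ_p` and
sums to zero on every coset of `ℤ_p`. -/
lemma AffRep.exists_sum_zero (h : AffRep χ d V) (hχ : χ ≠ 0) (hχ1 : χ ≠ 1) {f : ℚ_[p] → L}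
    (hf : f ∈ V) (hf0 : f ≠ 0) :
    ∃ g ∈ V, g 0 ≠ 0 ∧ (∀ c : ℚ_[p], ‖c‖ < 1 → ∀ z, g (z + c) = g z) ∧
      (∀ z, ∑ i ∈ Finset.range p, g (z + i) = 0) ∧ ∃ R : ℝ, ∀ z, R < ‖z‖ → g z = 0 := by
  obtain ⟨g, hg, hg0, ⟨N, hN⟩, R, hR⟩ := h.exists_compact hχ hχ1 hf hf0
  have hn : ∃ n : ℤ, (∀ b : ℚ_[p], ‖b‖ ≤ (p : ℝ) ^ (-n) → ∀ z, g (z + b) = g z) ∧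
      ¬ ∀ b : ℚ_[p], ‖b‖ ≤ (p : ℝ) ^ (-(n - 1)) → ∀ z, g (z + b) = g z := by
    by_contra! hcon
    have hall : ∀ m : ℕ, ∀ b : ℚ_[p], ‖b‖ ≤ (p : ℝ) ^ (-((N : ℤ) - m)) → ∀ z, g (z + b) = g z := by
      intro m
      induction m with
      | zero => simpa using hN
      | succ m ih =>
        have := hcon _ ih
        rwa [show (N : ℤ) - (m + 1 : ℕ) = (N : ℤ) - m - 1 by push_cast; ring]
    refine hg0 (funext fun z => ?_)
    obtain ⟨M, hM⟩ := exists_lt_norm (p := p) (max R ‖z‖)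
    have h1 := hall (N + M) ((p : ℚ_[p]) ^ M)⁻¹ (by
      rw [norm_inv, norm_pow, Padic.norm_p, inv_pow, inv_inv,
        show (-((N : ℤ) - (N + M : ℕ)) : ℤ) = (M : ℤ) by push_cast; ring, zpow_natCast]) z
    rw [← h1, add_comm, hR, Pi.zero_apply]
    rw [norm_add_eq_left ((le_max_right _ _).trans_lt hM)]
    exact (le_max_left _ _).trans_lt hM
  obtain ⟨n, hn1, hn2⟩ := hn
  push Not at hn2
  obtain ⟨b, hb, z0, hz0⟩ := hn2
  have hb0 : b ≠ 0 := by rintro rfl; simp at hz0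
  have hbc : ∀ c : ℚ_[p], ‖c‖ ≤ (p : ℝ)⁻¹ → ‖b * c‖ ≤ (p : ℝ) ^ (-n) := by
    intro c hc
    rw [norm_mul]
    calc ‖b‖ * ‖c‖ ≤ (p : ℝ) ^ (-(n - 1)) * (p : ℝ)⁻¹ := by gcongr
      _ = (p : ℝ) ^ (-n) := by
        rw [← zpow_sub_one₀ p_pos.ne']; congr 1; ring
  refine ⟨fun z => g (b * z + z0 + b) - g (b * z + z0), ?_, ?_, fun c hc z => ?_, fun z => ?_,
    max (max R ‖z0‖) ‖z0 + b‖ / ‖b‖, fun z hz => ?_⟩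
  · exact V.sub_mem (h.scale _ (h.trans _ (h.trans _ hg b) z0) b hb0)
      (h.scale _ (h.trans _ hg z0) b hb0)
  · simpa [sub_eq_zero] using hz0
  · have h1 := hn1 _ (hbc c (norm_le_inv_of_lt_one hc))
    beta_reduce
    rw [show b * (z + c) + z0 + b = b * z + z0 + b + b * c by ring,
      show b * (z + c) + z0 = b * z + z0 + b * c by ring, h1, h1]
  · have h1 := Finset.sum_range_sub (fun i : ℕ => g (b * z + z0 + b * i)) p
    rw [hn1 _ (hbc p (by rw [Padic.norm_p])), Nat.cast_zero, mul_zero, add_zero, sub_self] at h1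
    rw [← h1]
    refine Finset.sum_congr rfl fun i _ => ?_
    beta_reduce
    rw [show b * (z + i) + z0 + b = b * z + z0 + b * ((i + 1 : ℕ) : ℚ_[p]) by push_cast; ring,
      show b * (z + i) + z0 = b * z + z0 + b * (i : ℚ_[p]) by ring]
  · rw [div_lt_iff₀ (norm_pos_iff.2 hb0), mul_comm, ← norm_mul, max_lt_iff, max_lt_iff] at hz
    have h1 : ‖b * z + z0‖ = ‖b * z‖ := norm_add_eq_left hz.1.2
    have h2 : ‖b * z + z0 + b‖ = ‖b * z‖ := by rw [add_assoc]; exact norm_add_eq_left hz.2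
    beta_reduce
    rw [hR _ (h2 ▸ hz.1.1), hR _ (h1 ▸ hz.1.1), sub_self]

end smooth

section average
variable {χ : L} {d : ℕ} {V : Submodule L (ℚ_[p] → L)}

/-- The indicator function of the ball of centre `b` and radius `p^{-n}`. -/
def ballInd (L : Type) [NontriviallyNormedField L] (b : ℚ_[p]) (n : ℤ) : ℚ_[p] → L :=
  fun z => if ‖z - b‖ ≤ (p : ℝ) ^ (-n) then 1 else 0

/-- The average of `g` over units modulo `p^(M+1)`. -/
def unitSum (M : ℕ) (g : ℚ_[p] → L) : ℚ_[p] → L :=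
  fun z => ∑ u : (ZMod (p ^ (M + 1)))ˣ, g (((u : ZMod (p ^ (M + 1))).val : ℚ_[p]) * z)

lemma coprime_val_unit {M : ℕ} (u : (ZMod (p ^ (M + 1)))ˣ) :
    Nat.Coprime (u : ZMod (p ^ (M + 1))).val p :=
  (Nat.coprime_pow_right_iff M.succ_pos _ _).1 (ZMod.val_coe_unit_coprime u)

lemma norm_natCast_of_coprime {n : ℕ} (h : Nat.Coprime n p) : ‖(n : ℚ_[p])‖ = 1 := by
  rw [Padic.norm_natCast_eq_one_iff]; exact h.symm

lemma sum_mul_range {g : ℚ_[p] → L} (hper : ∀ c : ℚ_[p], ‖c‖ < 1 → ∀ z, g (z + c) = g z)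
    (hsum : ∀ z, ∑ i ∈ Finset.range p, g (z + i) = 0) {v : ℕ} (hv : Nat.Coprime v p) (w : ℚ_[p]) :
    ∑ i ∈ Finset.range p, g (w + v * i) = 0 := by
  have hp0 : 0 < p := (Fact.out : p.Prime).pos
  rw [← hsum w]
  have hmaps : Set.MapsTo (fun i => v * i % p) (Finset.range p) (Finset.range p) :=
    fun i _ => by simpa using Nat.mod_lt _ hp0
  have hinj : Set.InjOn (fun i => v * i % p) (Finset.range p) := by
    intro i hi j hj hij
    have h1 : i ≡ j [MOD p] := Nat.ModEq.cancel_left_of_coprime hv.symm hij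
    exact Nat.ModEq.eq_of_lt_of_lt h1 (by simpa using hi) (by simpa using hj)
  refine Finset.sum_nbij (fun i => v * i % p) hmaps hinj
    (Finset.surjOn_of_injOn_of_card_le _ hmaps hinj le_rfl) fun i _ => ?_
  have h1 : (v : ℚ_[p]) * i = ((v * i % p : ℕ) : ℚ_[p]) + p * ((v * i / p : ℕ) : ℚ_[p]) := by
    exact_mod_cast (Nat.mod_add_div (v * i) p).symm
  rw [h1, ← add_assoc]
  refine hper _ ?_ _
  rw [norm_mul, Padic.norm_p]
  refine (mul_le_of_le_one_right (by positivity)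
    (by exact_mod_cast Padic.norm_int_le_one ((v * i / p : ℕ) : ℤ))).trans_lt ?_
  exact inv_lt_one_of_one_lt₀ one_lt_p

lemma unitSum_periodic {M : ℕ} {g : ℚ_[p] → L}
    (hper : ∀ c : ℚ_[p], ‖c‖ < 1 → ∀ z, g (z + c) = g z) {c : ℚ_[p]} (hc : ‖c‖ < 1) (z : ℚ_[p]) :
    unitSum M g (z + c) = unitSum M g z := by
  refine Finset.sum_congr rfl fun u _ => ?_
  rw [mul_add]
  refine hper _ ?_ _
  rwa [norm_mul, norm_natCast_of_coprime (coprime_val_unit u), one_mul]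

lemma unitSum_sum {M : ℕ} {g : ℚ_[p] → L}
    (hper : ∀ c : ℚ_[p], ‖c‖ < 1 → ∀ z, g (z + c) = g z)
    (hsum : ∀ z, ∑ i ∈ Finset.range p, g (z + i) = 0) (z : ℚ_[p]) :
    ∑ i ∈ Finset.range p, unitSum M g (z + i) = 0 := by
  simp only [unitSum]
  rw [Finset.sum_comm]
  refine Finset.sum_eq_zero fun u _ => ?_
  simp only [mul_add]
  exact sum_mul_range hper hsum (coprime_val_unit u) _

lemma unitSum_mul {M : ℕ} {g : ℚ_[p] → L}
    (hper : ∀ c : ℚ_[p], ‖c‖ < 1 → ∀ z, g (z + c) = g z)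
    (hsupp : ∀ z : ℚ_[p], (p : ℝ) ^ M < ‖z‖ → g z = 0) {v : ℚ_[p]} (hv : ‖v‖ = 1) (z : ℚ_[p]) :
    unitSum M g (v * z) = unitSum M g z := by
  have hp := p_pos (p := p)
  by_cases hz : (p : ℝ) ^ M < ‖z‖
  · simp only [unitSum]
    rw [Finset.sum_eq_zero fun u _ => ?_, Finset.sum_eq_zero fun u _ => ?_]
    · exact hsupp _ (by rwa [norm_mul, norm_natCast_of_coprime (coprime_val_unit u), one_mul])
    · exact hsupp _ (by
        rwa [norm_mul, norm_mul, hv, norm_natCast_of_coprime (coprime_val_unit u), one_mul, one_mul])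
  · have hvu : IsUnit (toZ v) := by
      rw [PadicInt.isUnit_iff, PadicInt.norm_def, coe_toZ hv.le, hv]
    set w : (ZMod (p ^ (M + 1)))ˣ := (hvu.map (PadicInt.toZModPow (M + 1))).unit with hw
    refine Fintype.sum_equiv (Equiv.mulRight w) _ _ fun u => ?_
    set n := (u : ZMod (p ^ (M + 1))).val with hn
    set m := ((Equiv.mulRight w u : (ZMod (p ^ (M + 1)))ˣ) : ZMod (p ^ (M + 1))).val with hm
    have hdiff : ‖(n : ℚ_[p]) * v - m‖ ≤ (p : ℝ) ^ (-((M + 1 : ℕ) : ℤ)) := by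
      have h1 : (n : ℤ_[p]) * toZ v - (m : ℤ_[p]) ∈ RingHom.ker (PadicInt.toZModPow (p := p) (M + 1)) := by
        rw [RingHom.mem_ker, map_sub, map_mul, map_natCast, map_natCast, hn, hm]
        simp [hw]
      rw [PadicInt.ker_toZModPow, ← PadicInt.norm_le_pow_iff_mem_span_pow] at h1
      rwa [PadicInt.norm_def, PadicInt.coe_sub, PadicInt.coe_mul, coe_toZ hv.le,
        PadicInt.coe_natCast, PadicInt.coe_natCast] at h1
    rw [show (n : ℚ_[p]) * (v * z) = m * z + (n * v - m) * z by ring]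
    refine hper _ ?_ _
    rw [norm_mul]
    calc ‖(n : ℚ_[p]) * v - m‖ * ‖z‖ ≤ (p : ℝ) ^ (-((M + 1 : ℕ) : ℤ)) * (p : ℝ) ^ M := by
          gcongr; exact not_lt.1 hz
      _ = (p : ℝ)⁻¹ := by
          rw [zpow_neg, zpow_natCast, pow_succ]; field_simp
      _ < 1 := inv_lt_one_of_one_lt₀ one_lt_p

lemma AffRep.ballInd_mem (h : AffRep χ d V) (hχ : χ ≠ 0) (hχ1 : χ ≠ 1) {f : ℚ_[p] → L}
    (hf : f ∈ V) (hf0 : f ≠ 0) : ballInd L (0 : ℚ_[p]) 0 - (p : L) • ballInd L 0 1 ∈ V := by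
  have hp := p_pos (p := p)
  have : CharZero L := charZero_of_padic p L
  obtain ⟨g, hg, hg0, hper, hsum, R, hR⟩ := h.exists_sum_zero hχ hχ1 hf hf0
  obtain ⟨M, hM⟩ := pow_unbounded_of_one_lt R (one_lt_p (p := p))
  have hsupp : ∀ z : ℚ_[p], (p : ℝ) ^ M < ‖z‖ → g z = 0 := fun z hz => hR z (hM.trans hz)
  have hGper := fun c hc z => unitSum_periodic (M := M) hper (c := c) hc z
  have hGsum := unitSum_sum (M := M) hper hsum
  have hGmul := fun v hv z => unitSum_mul (M := M) hper hsupp (v := v) hv z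
  have hGV : unitSum M g ∈ V := by
    have h1 : unitSum M g = ∑ u : (ZMod (p ^ (M + 1)))ˣ,
        fun z => g (((u : ZMod (p ^ (M + 1))).val : ℚ_[p]) * z) := by
      funext z; simp [unitSum, Finset.sum_apply]
    rw [h1]
    refine V.sum_mem fun u _ => h.scale _ hg _ fun h0 => ?_
    have := norm_natCast_of_coprime (coprime_val_unit u)
    rw [h0, norm_zero] at this
    exact zero_ne_one this
  have hG0 : unitSum M g 0 ≠ 0 := by
    simp only [unitSum, mul_zero, Finset.sum_const, nsmul_eq_mul]
    exact mul_ne_zero (Nat.cast_ne_zero.2 Fintype.card_ne_zero) hg0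
  generalize unitSum M g = G at *
  have hrad : ∀ z w : ℚ_[p], ‖z‖ = ‖w‖ → w ≠ 0 → G z = G w := by
    intro z w hzw hw
    rw [← hGmul (z / w) (by rw [norm_div, hzw, div_self (norm_ne_zero_iff.2 hw)]) w,
      div_mul_cancel₀ _ hw]
  have hfar : ∀ z : ℚ_[p], 1 < ‖z‖ → G z = 0 := by
    intro z hz
    have hz0 : z ≠ 0 := norm_pos_iff.1 (zero_lt_one.trans hz)
    have h1 := hGsum z
    rw [Finset.sum_congr rfl fun (i : ℕ) _ => hrad (z + i) z (norm_add_eq_left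
      ((by exact_mod_cast Padic.norm_int_le_one ((i : ℕ) : ℤ) : ‖(i : ℚ_[p])‖ ≤ 1).trans_lt hz)) hz0,
      Finset.sum_const, Finset.card_range, nsmul_eq_mul] at h1
    exact (mul_eq_zero.1 h1).resolve_left p_ne_zero
  have hzero : G 0 = (1 - (p : L)) * G 1 := by
    have h1 := hGsum 0
    obtain ⟨q, hq⟩ : ∃ q, p = q + 1 := ⟨p - 1, (Nat.succ_pred_prime Fact.out).symm⟩
    have h2 : ∑ i ∈ Finset.range p, G ((0 : ℚ_[p]) + i) = ∑ i ∈ Finset.range (q + 1), G (i : ℚ_[p]) :=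
      Finset.sum_congr (by rw [hq]) fun i _ => by rw [zero_add]
    rw [h2, Finset.sum_range_succ', Finset.sum_congr rfl fun i hi => hrad ((i + 1 : ℕ) : ℚ_[p]) 1 ?_
      one_ne_zero, Finset.sum_const, Finset.card_range, nsmul_eq_mul, Nat.cast_zero] at h1
    · have h3 : (p : L) = q + 1 := by exact_mod_cast congrArg (Nat.cast (R := L)) hq
      rw [h3]
      linear_combination h1
    · rw [norm_one]
      refine norm_natCast_of_coprime (Nat.Coprime.symm ((Nat.Prime.coprime_iff_not_dvd Fact.out).2 ?_))
      exact Nat.not_dvd_of_pos_of_lt (by omega) (by have := Finset.mem_range.1 hi; omega)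
  have hG1 : G 1 ≠ 0 := fun h1 => hG0 (by rw [hzero, h1, mul_zero])
  have hG : G = G 1 • (ballInd L (0 : ℚ_[p]) 0 - (p : L) • ballInd L 0 1) := by
    funext z
    simp only [Pi.smul_apply, Pi.sub_apply, ballInd, sub_zero, neg_zero, zpow_zero, smul_eq_mul,
      zpow_neg, zpow_one]
    rcases lt_trichotomy ‖z‖ 1 with h1 | h1 | h1
    · rw [if_pos h1.le, if_pos (norm_le_inv_of_lt_one h1), ← zero_add z, hGper z h1, hzero]
      ring
    · rw [if_pos h1.le, if_neg (by rw [h1, not_le]; exact inv_lt_one_of_one_lt₀ one_lt_p),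
        hrad z 1 (by rw [h1, norm_one]) one_ne_zero]
      ring
    · rw [if_neg (not_le.2 h1),
        if_neg (not_le.2 ((inv_lt_one_of_one_lt₀ one_lt_p).trans h1)), hfar z h1]
      ring
  rw [hG] at hGV
  exact (V.smul_mem_iff hG1).1 hGV

end average

section balls
variable {χ : L} {d : ℕ} {V : Submodule L (ℚ_[p] → L)}

lemma mem_of_forall_sum_pow_smul_mem {K M : Type*} [Field K] [CharZero K] [AddCommGroup M]
    [Module K M] (W : Submodule K M) (n : ℕ) (v : ℕ → M)
    (h : ∀ t : ℕ, ∑ i ∈ Finset.range n, (t : K) ^ i • v i ∈ W) {i : ℕ} (hi : i < n) : v i ∈ W := by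
  rw [← Submodule.Quotient.mk_eq_zero, ← Module.forall_dual_apply_eq_zero_iff K]
  intro φ
  set P : Polynomial K := ∑ j ∈ Finset.range n,
    Polynomial.monomial j (φ (Submodule.Quotient.mk (v j))) with hP
  have hP0 : P = 0 := by
    refine Polynomial.eq_zero_of_infinite_isRoot _ ?_
    refine Set.Infinite.mono (s := Set.range (Nat.cast : ℕ → K)) ?_
      (Set.infinite_range_of_injective Nat.cast_injective)
    rintro _ ⟨t, rfl⟩
    have h1 := congrArg φ ((Submodule.Quotient.mk_eq_zero W).2 (h t))
    rw [map_zero, ← Submodule.mkQ_apply, map_sum, map_sum] at h1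
    change P.eval (t : K) = 0
    rw [← h1, hP, Polynomial.eval_finsetSum]
    refine Finset.sum_congr rfl fun j _ => ?_
    rw [Polynomial.eval_monomial, map_smul, map_smul, smul_eq_mul, Submodule.mkQ_apply, mul_comm]
  have h2 : P.coeff i = φ (Submodule.Quotient.mk (v i)) := by
    simp [hP, Polynomial.finsetSum_coeff, Polynomial.coeff_monomial, hi]
  rw [← h2, hP0, Polynomial.coeff_zero]

lemma ballInd_shift (b c : ℚ_[p]) (n : ℤ) :
    (fun z => ballInd L b n (z + c)) = ballInd L (b - c) n := by
  funext z
  rw [ballInd, ballInd, show z + c - b = z - (b - c) by ring]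

lemma ballInd_scale (b t : ℚ_[p]) (n m : ℤ) (ht : ‖t‖ = (p : ℝ) ^ (-m)) :
    (fun z => ballInd L b n (t * z)) = ballInd L (b / t) (n - m) := by
  have hp := p_pos (p := p)
  have ht0 : t ≠ 0 := norm_pos_iff.1 (by rw [ht]; positivity)
  funext z
  have h1 : ‖t * z - b‖ ≤ (p : ℝ) ^ (-n) ↔ ‖z - b / t‖ ≤ (p : ℝ) ^ (-(n - m)) := by
    rw [show t * z - b = t * (z - b / t) by field_simp, norm_mul, ht,
      show (-n : ℤ) = -m + (-(n - m)) by ring, zpow_add₀ hp.ne',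
      mul_le_mul_iff_right₀ (zpow_pos hp _)]
  simp only [ballInd, h1]

lemma ballInd_eq_of_norm_le {b : ℚ_[p]} {n : ℤ} (hb : ‖b‖ ≤ (p : ℝ) ^ (-n)) :
    ballInd L b n = ballInd L 0 n := by
  funext z
  have h1 : ‖z - b‖ ≤ (p : ℝ) ^ (-n) ↔ ‖z - 0‖ ≤ (p : ℝ) ^ (-n) := by
    rw [sub_zero]
    constructor <;> intro h
    · have := (Padic.nonarchimedean (z - b) b).trans (max_le h hb)
      rwa [sub_add_cancel] at this
    · rw [sub_eq_add_neg]
      exact (Padic.nonarchimedean z (-b)).trans (max_le h (by rwa [norm_neg]))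
  simp only [ballInd, h1]

lemma AffRep.ballInd_chain (h : AffRep χ d V)
    (he : ballInd L (0 : ℚ_[p]) 0 - (p : L) • ballInd L 0 1 ∈ V) (b : ℚ_[p]) (n : ℤ) (j : ℕ) :
    ballInd L b n - (p : L) ^ j • ballInd L b (n + j) ∈ V := by
  have hstep : ∀ m : ℤ, ballInd L b m - (p : L) • ballInd L b (m + 1) ∈ V := by
    intro m
    have ht : ‖(p : ℚ_[p]) ^ (-m)‖ = (p : ℝ) ^ (-(-m)) := by rw [Padic.norm_p_zpow]
    have h1 := h.trans _ (h.scale _ he ((p : ℚ_[p]) ^ (-m)) (zpow_ne_zero _ p_ne_zero')) (-b)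
    have h2 : (fun z => (fun z => (ballInd L (0 : ℚ_[p]) 0 - (p : L) • ballInd L 0 1 : ℚ_[p] → L)
        ((p : ℚ_[p]) ^ (-m) * z)) (z + -b)) =
        (fun z => (fun z => ballInd L (0 : ℚ_[p]) 0 ((p : ℚ_[p]) ^ (-m) * z)) (z + -b)) -
        (p : L) • (fun z => (fun z => ballInd L (0 : ℚ_[p]) 1 ((p : ℚ_[p]) ^ (-m) * z)) (z + -b)) :=
      rfl
    rw [h2, ballInd_scale _ _ _ _ ht, ballInd_scale _ _ _ _ ht, ballInd_shift, ballInd_shift] at h1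
    simpa [add_comm] using h1
  induction j with
  | zero => simp
  | succ j ih =>
    have h1 := V.add_mem ih (V.smul_mem ((p : L) ^ j) (hstep (n + j)))
    rwa [smul_sub, smul_smul, ← pow_succ, sub_add_sub_cancel, add_assoc, ← Nat.cast_succ] at h1

/-- Modulo `V`, the indicator function of a ball is its volume times that of `ℤ_p`. -/
lemma AffRep.ballInd_sub_mem (h : AffRep χ d V)
    (he : ballInd L (0 : ℚ_[p]) 0 - (p : L) • ballInd L 0 1 ∈ V) (b : ℚ_[p]) (n : ℤ) :
    ballInd L b n - (p : L) ^ (-n) • ballInd L 0 0 ∈ V := by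
  have hp := p_pos (p := p)
  have hpL : (p : L) ≠ 0 := p_ne_zero
  obtain ⟨M₀, hM₀⟩ := pow_unbounded_of_one_lt ‖b‖ (one_lt_p (p := p))
  set M := max M₀ n.natAbs with hM
  have hb : ‖b‖ ≤ (p : ℝ) ^ (-(-(M : ℤ))) := by
    rw [neg_neg, zpow_natCast]
    exact hM₀.le.trans (pow_le_pow_right₀ one_lt_p.le (le_max_left _ _))
  obtain ⟨j, hj⟩ : ∃ j : ℕ, (j : ℤ) = n + M := by
    refine ⟨(n + M).toNat, Int.toNat_of_nonneg ?_⟩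
    have : n.natAbs ≤ M := le_max_right _ _
    omega
  have h1 := h.ballInd_chain he b (-M) j
  have h2 := h.ballInd_chain he 0 (-M) M
  rw [ballInd_eq_of_norm_le hb, hj, show -(M : ℤ) + (n + M) = n by ring] at h1
  rw [show -(M : ℤ) + M = 0 by ring] at h2
  have h3 := V.smul_mem ((p : L) ^ (-(j : ℤ))) (V.sub_mem h2 h1)
  rw [sub_sub_sub_cancel_left, smul_sub, smul_smul, smul_smul, ← zpow_natCast, ← zpow_natCast,
    ← zpow_add₀ hpL, ← zpow_add₀ hpL, hj, show -(n + (M : ℤ)) + (n + M) = 0 by ring,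
    show -(n + (M : ℤ)) + M = -n by ring, zpow_zero, one_smul] at h3
  exact h3

lemma inv_ballInd {a : ℚ_[p]} {n m : ℤ} (ha : (p : ℝ) ^ (-n) < ‖a‖)
    (hm : (p : ℝ) ^ (-m) * ‖a‖ ^ 2 = (p : ℝ) ^ (-n)) (z : ℚ_[p]) :
    (if z = 0 then 0 else χ ^ z.valuation * iotaL p L z ^ d * ballInd L a n z⁻¹) =
      χ ^ (-a.valuation) * (iotaL p L z ^ d * ballInd L a⁻¹ m z) := by
  have hp := p_pos (p := p)
  have ha0 : 0 < ‖a‖ := (zpow_pos hp _).trans ha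
  have hane : a ≠ 0 := norm_pos_iff.1 ha0
  have hm' : (p : ℝ) ^ (-m) < ‖a⁻¹‖ := by
    rw [norm_inv, ← mul_lt_mul_iff_left₀ (pow_pos ha0 2), hm]
    calc (p : ℝ) ^ (-n) < ‖a‖ := ha
      _ = ‖a‖⁻¹ * ‖a‖ ^ 2 := by field_simp
  by_cases hz : z = 0
  · rw [if_pos hz, ballInd, if_neg, mul_zero, mul_zero]
    rw [hz, zero_sub, norm_neg, not_le]
    exact hm'
  rw [if_neg hz]
  have hz0 : 0 < ‖z‖ := norm_pos_iff.2 hz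
  have key : ‖z‖ = ‖a‖⁻¹ → (‖z⁻¹ - a‖ ≤ (p : ℝ) ^ (-n) ↔ ‖z - a⁻¹‖ ≤ (p : ℝ) ^ (-m)) := by
    intro hza
    rw [show z⁻¹ - a = -((z - a⁻¹) * (z⁻¹ * a)) by field_simp; ring, norm_neg, norm_mul, norm_mul,
      norm_inv, hza, inv_inv, ← sq, ← hm, mul_le_mul_iff_left₀ (pow_pos ha0 2)]
  have h1 : ‖z⁻¹ - a‖ ≤ (p : ℝ) ^ (-n) → ‖z‖ = ‖a‖⁻¹ := fun h => by
    rw [← norm_eq_of_norm_sub_lt (h.trans_lt ha), norm_inv, inv_inv]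
  have h2 : ‖z - a⁻¹‖ ≤ (p : ℝ) ^ (-m) → ‖z‖ = ‖a‖⁻¹ := fun h => by
    rw [← norm_inv]; exact norm_eq_of_norm_sub_lt (h.trans_lt hm')
  have hiff : ‖z⁻¹ - a‖ ≤ (p : ℝ) ^ (-n) ↔ ‖z - a⁻¹‖ ≤ (p : ℝ) ^ (-m) :=
    ⟨fun h => (key (h1 h)).1 h, fun h => (key (h2 h)).2 h⟩
  simp only [ballInd, hiff]
  split_ifs with h3
  · rw [← Padic.valuation_inv, valuation_eq_of_norm_eq ((h2 h3).trans (norm_inv a).symm), mul_one,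
      mul_one]
  · simp

/-- From `z^d h(z)` with `h` invariant under `pℤ_p` one recovers `z^j h(z)` for all `j ≤ d`. -/
lemma AffRep.pow_mul_mem (h : AffRep χ d V) {g : ℚ_[p] → L}
    (hper : ∀ c : ℚ_[p], ‖c‖ < 1 → ∀ z, g (z + c) = g z)
    (hg : (fun z => iotaL p L z ^ d * g z) ∈ V) {j : ℕ} (hj : j ≤ d) :
    (fun z => iotaL p L z ^ j * g z) ∈ V := by
  have : CharZero L := charZero_of_padic p L
  have hpL : (p : L) ≠ 0 := p_ne_zero
  have h1 := mem_of_forall_sum_pow_smul_mem V (d + 1)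
    (fun i => ((d.choose i : L) * (p : L) ^ i) • fun z => iotaL p L z ^ (d - i) * g z) ?_
    (i := d - j) (by omega)
  · rw [V.smul_mem_iff, Nat.sub_sub_self hj] at h1
    · exact h1
    · exact mul_ne_zero (Nat.cast_ne_zero.2 (Nat.choose_pos (Nat.sub_le _ _)).ne')
        (pow_ne_zero _ hpL)
  · intro t
    have h2 := h.trans _ hg ((p : ℚ_[p]) * t)
    convert h2 using 1
    funext z
    have hc : ‖(p : ℚ_[p]) * t‖ < 1 := by
      have := norm_natCast_mul_pow_le (p := p) 1 t
      rw [pow_one, mul_comm] at this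
      refine this.trans_lt ?_
      simpa using inv_lt_one_of_one_lt₀ (one_lt_p (p := p))
    rw [hper _ hc, iotaL_add, iotaL_mul, iotaL_natCast, iotaL_natCast, add_comm (iotaL p L z),
      add_pow,
      Finset.sum_mul, Finset.sum_apply]
    refine Finset.sum_congr rfl fun i _ => ?_
    simp only [Pi.smul_apply, smul_eq_mul, mul_pow]
    ring

lemma ballInd_periodic {b : ℚ_[p]} {n : ℤ} (hn : n ≤ 1) {c : ℚ_[p]} (hc : ‖c‖ < 1) (z : ℚ_[p]) :
    ballInd L b n (z + c) = ballInd L b n z := by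
  have h1 : ‖c‖ ≤ (p : ℝ) ^ (-n) := by
    refine (norm_le_inv_of_lt_one hc).trans ?_
    rw [← zpow_neg_one]
    exact zpow_le_zpow_right₀ one_lt_p.le (by omega)
  have h2 : ‖z + c - b‖ ≤ (p : ℝ) ^ (-n) ↔ ‖z - b‖ ≤ (p : ℝ) ^ (-n) := by
    rw [show z + c - b = z - b + c by ring]
    constructor <;> intro h
    · have := (Padic.nonarchimedean (z - b + c) (-c)).trans (max_le h (by rwa [norm_neg]))
      rwa [add_neg_cancel_right] at this
    · exact (Padic.nonarchimedean _ _).trans (max_le h h1)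
  simp only [ballInd, h2]

lemma ballInd_eq_zero_of_lt {b : ℚ_[p]} {n : ℤ} {z : ℚ_[p]}
    (hz : max ‖b‖ ((p : ℝ) ^ (-n)) < ‖z‖) : ballInd L b n z = 0 := by
  rw [ballInd, if_neg]
  rw [max_lt_iff] at hz
  rw [sub_eq_add_neg, norm_add_eq_left (by rw [norm_neg]; exact hz.1), not_le]
  exact hz.2

/-- If `χ ≠ p²`, the indicator function of `ℤ_p` belongs to `V`. -/
lemma AffRep.ballInd_zero_mem (h : AffRep χ d V) (hχ : χ ≠ 0) (hχ2 : χ ≠ (p : L) ^ 2)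
    (he : ballInd L (0 : ℚ_[p]) 0 - (p : L) • ballInd L 0 1 ∈ V) : ballInd L (0 : ℚ_[p]) 0 ∈ V := by
  have hp := p_pos (p := p)
  have hp1 := inv_lt_one_of_one_lt₀ (one_lt_p (p := p))
  have hpL : (p : L) ≠ 0 := p_ne_zero
  have h0 : ballInd L (1 : ℚ_[p]) 1 - (p : L) • ballInd L (p : ℚ_[p]) 2 ∈ V := by
    have h1 := V.sub_mem (h.ballInd_sub_mem he 1 1)
      (V.smul_mem (p : L) (h.ballInd_sub_mem he (p : ℚ_[p]) 2))
    have h2 : (p : L) * (p : L) ^ (-2 : ℤ) = (p : L) ^ (-1 : ℤ) := by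
      rw [← zpow_one_add₀ hpL]; norm_num
    rw [smul_sub, smul_smul, h2] at h1
    convert h1 using 1
    abel
  have h1 := h.inv _ h0 ⟨max (max ‖(1 : ℚ_[p])‖ ((p : ℝ) ^ (-1 : ℤ)))
    (max ‖(p : ℚ_[p])‖ ((p : ℝ) ^ (-2 : ℤ))), fun z hz => by
      rw [max_lt_iff] at hz
      rw [Pi.sub_apply, Pi.smul_apply, ballInd_eq_zero_of_lt hz.1, ballInd_eq_zero_of_lt hz.2,
        smul_zero, sub_zero]⟩
  have h2 : (fun z : ℚ_[p] => if z = 0 then 0 else χ ^ z.valuation * iotaL p L z ^ d *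
      (ballInd L (1 : ℚ_[p]) 1 - (p : L) • ballInd L (p : ℚ_[p]) 2) z⁻¹) =
      fun z => iotaL p L z ^ d *
        (ballInd L (1 : ℚ_[p]) 1 - ((p : L) * χ⁻¹) • ballInd L (p : ℚ_[p])⁻¹ 0) z := by
    funext z
    have e1 := inv_ballInd (χ := χ) (d := d) (a := (1 : ℚ_[p])) (n := 1) (m := 1)
      (by simpa using hp1) (by simp) z
    have e2 := inv_ballInd (χ := χ) (d := d) (a := (p : ℚ_[p])) (n := 2) (m := 0)
      (by
        rw [Padic.norm_p, ← zpow_neg_one]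
        exact zpow_lt_zpow_right₀ one_lt_p (by norm_num))
      (by rw [Padic.norm_p, neg_zero, zpow_zero, one_mul, zpow_neg, inv_pow]; norm_cast) z
    rw [inv_one, Padic.valuation_one, neg_zero, zpow_zero, one_mul] at e1
    rw [Padic.valuation_p, zpow_neg_one] at e2
    by_cases hz : z = 0
    · rw [if_pos hz] at e1 e2 ⊢
      simp only [Pi.sub_apply, Pi.smul_apply, smul_eq_mul]
      linear_combination e1 - (p : L) * e2
    · rw [if_neg hz] at e1 e2 ⊢
      simp only [Pi.sub_apply, Pi.smul_apply, smul_eq_mul]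
      linear_combination e1 - (p : L) * e2
  rw [h2] at h1
  have h3 := h.pow_mul_mem (fun c hc z => by
    simp only [Pi.sub_apply, Pi.smul_apply, ballInd_periodic le_rfl hc,
      ballInd_periodic zero_le_one hc]) h1 (Nat.zero_le d)
  simp only [pow_zero, one_mul] at h3
  have h4 := V.add_mem (V.sub_mem (h.ballInd_sub_mem he 1 1) h3) (V.smul_mem (-((p : L) * χ⁻¹))
    (h.ballInd_sub_mem he (p : ℚ_[p])⁻¹ 0))
  have h5 : ((p : L) * χ⁻¹ - (p : L)⁻¹) • ballInd L (0 : ℚ_[p]) 0 ∈ V := by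
    convert h4 using 1
    funext z
    simp only [Pi.add_apply, Pi.sub_apply, Pi.smul_apply, smul_eq_mul, neg_zero, zpow_zero,
      zpow_neg_one]
    ring
  refine (V.smul_mem_iff fun h6 => hχ2 ?_).1 h5
  field_simp at h6
  linear_combination -h6

/-- If the indicator function of `ℤ_p` belongs to `V`, so do the functions `z^j 1_{ℤ_p}`. -/
lemma AffRep.pow_mul_ballInd_mem (h : AffRep χ d V)
    (he : ballInd L (0 : ℚ_[p]) 0 - (p : L) • ballInd L 0 1 ∈ V)
    (h0 : ballInd L (0 : ℚ_[p]) 0 ∈ V) {j : ℕ} (hj : j ≤ d) :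
    (fun z => iotaL p L z ^ j * ballInd L (0 : ℚ_[p]) 0 z) ∈ V := by
  have hp1 := inv_lt_one_of_one_lt₀ (one_lt_p (p := p))
  have hpL : (p : L) ≠ 0 := p_ne_zero
  have h1 : ballInd L (1 : ℚ_[p]) 1 ∈ V := by
    have := V.add_mem (h.ballInd_sub_mem he 1 1) (V.smul_mem ((p : L) ^ (-1 : ℤ)) h0)
    rwa [sub_add_cancel] at this
  have h2 := h.inv _ h1 ⟨_, fun z hz => ballInd_eq_zero_of_lt hz⟩
  have h3 : (fun z => iotaL p L z ^ d * ballInd L (1 : ℚ_[p]) 1 z) ∈ V := by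
    convert h2 using 1
    funext z
    rw [inv_ballInd (χ := χ) (d := d) (a := (1 : ℚ_[p])) (n := 1) (m := 1)
      (by simpa using hp1) (by simp) z, inv_one, Padic.valuation_one, neg_zero, zpow_zero, one_mul]
  have h4 : (fun z => (iotaL p L z - 1) ^ j * ballInd L (1 : ℚ_[p]) 1 z) ∈ V := by
    have h5 := V.sum_mem (t := Finset.range (j + 1))
      (f := fun i => ((-1 : L) ^ (j - i) * (j.choose i : L)) •
        fun z => iotaL p L z ^ i * ballInd L (1 : ℚ_[p]) 1 z) fun i hi =>
      V.smul_mem _ (h.pow_mul_mem (fun c hc z => ballInd_periodic le_rfl hc z) h3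
        (by have := Finset.mem_range.1 hi; omega))
    convert h5 using 1
    funext z
    rw [sub_eq_add_neg, add_pow, Finset.sum_mul, Finset.sum_apply]
    refine Finset.sum_congr rfl fun i _ => ?_
    simp only [Pi.smul_apply, smul_eq_mul]
    ring
  have h5 := h.scale _ (h.trans _ h4 1) (p : ℚ_[p]) p_ne_zero'
  refine (V.smul_mem_iff (pow_ne_zero j hpL)).1 ?_
  convert h5 using 1
  funext z
  have h6 := congrFun (ballInd_shift (L := L) (1 : ℚ_[p]) 1 1) (p * z)
  have h7 := congrFun (ballInd_scale (L := L) ((1 : ℚ_[p]) - 1) (p : ℚ_[p]) 1 1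
    (by rw [Padic.norm_p, zpow_neg_one])) z
  simp only [sub_self, zero_div] at h6 h7
  simp only [Pi.smul_apply, smul_eq_mul, h6, h7, iotaL_add, iotaL_mul, iotaL_natCast, iotaL_one,
    add_sub_cancel_right, mul_pow]
  ring

end balls

section conclusion
variable {k : ℕ} {α β χ : L} {d : ℕ}

lemma res_Phi (j : ℕ) : res (Phi χ d j : ℚ_[p] → ℚ_[p] → L) =
    fun z => iotaL p L z ^ j * ballInd L (0 : ℚ_[p]) 0 z := by
  funext z
  simp [res, Phi, ballInd, iotaL_one]

/-- Elements of `PiF` are determined by their restriction to the affine line. -/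
lemma mem_lineF_of_res_mem (h : Data p k α β χ d r) {F : ℚ_[p] → ℚ_[p] → L}
    (hF : F ∈ PiF p α χ d) (hres : res F ∈ (lineF p α χ d).map
      (resHom : (ℚ_[p] → ℚ_[p] → L) →ₗ[L] (ℚ_[p] → L))) : F ∈ lineF p α χ d := by
  obtain ⟨G, hG, hGF⟩ := hres
  rwa [(nice_of_mem_PiF h.toGood hF).res_injective h
    (nice_of_mem_PiF h.toGood (lineF_le_PiF hG)) hGF.symm]

/-- The case `χ = p²`: the function `Φ_0` is congruent to arbitrarily small functions. -/
lemma Phi_zero_mem_lineF_of_chi_eq (h : Data p k α β χ d r) (hχ2 : χ = (p : L) ^ 2)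
    (he : ballInd L (0 : ℚ_[p]) 0 - (p : L) • ballInd L 0 1 ∈ (lineF p α χ d).map
      (resHom : (ℚ_[p] → ℚ_[p] → L) →ₗ[L] (ℚ_[p] → L))) : Phi χ d 0 ∈ lineF p α χ d := by
  have hp := p_pos (p := p)
  have hpL : (p : L) ≠ 0 := p_ne_zero
  have hα := h.alpha_ne_zero
  have hr : 1 < r := by
    have h1 := h.norm_chi
    rw [hχ2, norm_pow, norm_natCast_p, inv_pow, ← Real.rpow_natCast, ← Real.rpow_neg hp.le] at h1
    have h2 : -((2 : ℕ) : ℝ) = (d : ℝ) - 2 * r :=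
      (Real.rpow_right_inj hp (one_lt_p (p := p)).ne').1 h1
    have h3 := h.r_lt
    push_cast at h2
    linarith
  intro c
  obtain ⟨n, hn⟩ : ∃ n : ℕ, ‖c * ((p : L)⁻¹ * α) ^ n‖ ≤ 1 := by
    have hlt : ‖(p : L)⁻¹ * α‖ < 1 := by
      rw [norm_mul, norm_inv, norm_natCast_p, inv_inv, h.norm_alpha]
      nth_rewrite 1 [← Real.rpow_one (p : ℝ)]
      rw [← Real.rpow_add hp]
      exact Real.rpow_lt_one_of_one_lt_of_neg one_lt_p (by linarith)
    have ht := (tendsto_pow_atTop_nhds_zero_of_norm_lt_one hlt).const_mul c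
    rw [mul_zero] at ht
    have := (ht.norm.eventually (gt_mem_nhds (by simp : ‖(0 : L)‖ < 1))).exists
    exact this.imp fun n hn => hn.le
  have hpn : (p : ℚ_[p]) ^ n ≠ 0 := pow_ne_zero _ p_ne_zero'
  have hdet : (p : ℚ_[p]) ^ n * 1 - 0 * 0 ≠ 0 := by simpa using hpn
  set G : ℚ_[p] → ℚ_[p] → L := act α ((p : ℚ_[p]) ^ n) 0 0 1 (Phi χ d 0) with hG
  have hGL : G ∈ LamF p α χ d := act_Phi_mem_LamF hdet (Nat.zero_le d)
  have hres : res G = (α ^ n)⁻¹ • ballInd L (0 : ℚ_[p]) (-n) := by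
    have h1 := ballInd_scale (L := L) (0 : ℚ_[p]) ((p : ℚ_[p]) ^ n) 0 n (by
      rw [norm_pow, Padic.norm_p, zpow_neg, zpow_natCast, inv_pow])
    rw [zero_div, zero_sub] at h1
    rw [← h1]
    funext z
    have h2 := congrFun (res_Phi (p := p) (χ := χ) (d := d) 0) ((p : ℚ_[p]) ^ n * z)
    rw [pow_zero, one_mul, res] at h2
    simp [hG, res, act, ← h2]
  have hmem : Phi χ d 0 - ((p : L)⁻¹ * α) ^ n • G ∈ lineF p α χ d := by
    refine mem_lineF_of_res_mem h
      (Submodule.sub_mem _ (Phi_mem_PiF (Nat.zero_le d)) (Submodule.smul_mem _ _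
        (LamF_subset_PiF hGL))) ?_
    have h1 := Submodule.smul_mem _ (-((p : L)⁻¹) ^ n)
      ((affRep_map_lineF h.toGood).ballInd_sub_mem he 0 (-n))
    convert h1 using 1
    rw [res_sub, res_smul, hres, res_Phi, neg_neg, zpow_natCast, smul_smul, mul_pow,
      mul_inv_cancel_right₀ (pow_ne_zero n hα)]
    funext z
    simp only [Pi.sub_apply, Pi.smul_apply, smul_eq_mul, pow_zero, one_mul]
    have h2 : (p : L)⁻¹ ^ n * (p : L) ^ n = 1 := by rw [← mul_pow, inv_mul_cancel₀ hpL, one_pow]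
    linear_combination (-ballInd L (0 : ℚ_[p]) 0 z) * h2
  have h3 := isOMod_LamF.add_mem _ (hmem c) _ (isOMod_LamF.smul_mem _ hn _ hGL)
  rwa [smul_sub, smul_smul, sub_add_cancel] at h3

/-- If `LamF` contains a line, it is the whole space. -/
lemma PiF_subset_LamF_of_line (h : Data p k α β χ d r) (hχ1 : χ ≠ 1) {F : ℚ_[p] → ℚ_[p] → L}
    (hF : F ∈ lineF p α χ d) (hF0 : F ≠ 0) : ∀ G ∈ PiF p α χ d, G ∈ LamF p α χ d := by
  have hV := affRep_map_lineF h.toGood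
  have hχ := h.chi_ne_zero
  have hres0 : res F ≠ 0 := fun h0 =>
    hF0 ((nice_of_mem_PiF h.toGood (lineF_le_PiF hF)).eq_zero h h0)
  have he := hV.ballInd_mem hχ hχ1 ⟨F, hF, rfl⟩ hres0
  have h0 : ballInd L (0 : ℚ_[p]) 0 ∈ (lineF p α χ d).map
      (resHom : (ℚ_[p] → ℚ_[p] → L) →ₗ[L] (ℚ_[p] → L)) := by
    by_cases hχ2 : χ = (p : L) ^ 2
    · refine ⟨Phi χ d 0, Phi_zero_mem_lineF_of_chi_eq h hχ2 he, ?_⟩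
      exact (res_Phi 0).trans (funext fun z => by rw [pow_zero, one_mul])
    · exact hV.ballInd_zero_mem hχ hχ2 he
  have hle : PiF p α χ d ≤ lineF p α χ d := by
    refine Submodule.span_le.2 ?_
    rintro _ ⟨a, b, c, e, j, hdet, hj, rfl⟩
    refine act_mem_lineF h.alpha_ne_zero hdet (mem_lineF_of_res_mem h (Phi_mem_PiF hj) ?_)
    rw [res_Phi]
    exact hV.pow_mul_ballInd_mem he h0 hj
  exact fun G hG => lineF_subset_LamF (hle hG)

lemma Data.exists_not_memLalpha_iff (h : Data p k α β χ d r) (hχ1 : χ ≠ 1) :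
    (∃ f : ℚ_[p] → L, MemB p L k α β f ∧ ¬ MemLalpha p L k α β f) ↔
      ∃ Λ : Set (ℚ_[p] → L), IsLatticeStable p L k α β Λ := by
  refine ⟨fun ⟨f, hf, hf'⟩ => ⟨_, isLatticeStable_res_LamF h fun F _ hline => ?_⟩,
    fun ⟨Λ, hΛ⟩ => hΛ.exists_not_memLalpha h⟩
  by_contra hF0
  exact hf' (memLalpha_of_forall_mem_LamF h (PiF_subset_LamF_of_line h hχ1 hline hF0) hf)

lemma norm_eq_rpow_neg_valL {x : L} (hx : x ≠ 0) : ‖x‖ = (p : ℝ) ^ (-valL p L x) := by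
  rw [valL, neg_neg, Real.rpow_logb p_pos one_lt_p.ne' (norm_pos_iff.2 hx)]

lemma ne_zero_of_valL_pos {x : L} (hx : 0 < valL p L x) : x ≠ 0 := by
  rintro rfl; simp [valL] at hx

lemma data_of_valL (hk : 2 ≤ k) (hα : 0 < valL p L α) (hβ : 0 < valL p L β)
    (hsum : valL p L α + valL p L β = (k : ℝ) - 1) :
    Data p k α β (α * (p : L) / β) (k - 2) (valL p L α) where
  norm_alpha := norm_eq_rpow_neg_valL (p := p) (ne_zero_of_valL_pos hα)
  norm_chi := by
    have hp := p_pos (p := p)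
    rw [norm_div, norm_mul, norm_natCast_p, norm_eq_rpow_neg_valL (p := p) (ne_zero_of_valL_pos hα),
      norm_eq_rpow_neg_valL (p := p) (ne_zero_of_valL_pos hβ), ← Real.rpow_neg_one, ← Real.rpow_add hp,
      ← Real.rpow_sub hp, Nat.cast_sub hk]
    congr 1
    push_cast
    linarith
  r_pos := hα
  r_lt := by
    rw [Nat.cast_sub hk]; push_cast; linarith
  chi_eq := rfl
  d_eq := rfl
  r_eq := rfl

lemma valL_mul_p {x : L} (hx : x ≠ 0) : valL p L (x * p) = valL p L x + 1 := by
  rw [valL, valL, norm_mul, norm_natCast_p,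
    Real.logb_mul (norm_ne_zero_iff.2 hx) (inv_ne_zero p_pos.ne'), Real.logb_inv,
    Real.logb_self_eq_one one_lt_p]
  ring

end conclusion

end ProofOfStatement

/-- If `α ≠ pβ` : `B(α)/L(α) ≠ 0` iff `π(α)` has a `GL₂(ℚ_p)`-stable
`𝒪_L`-lattice, and similarly for `β`.  If `α = pβ` : `B(α)/L(α) ≠ 0` iff `π(α)`
has a `GL₂(ℚ_p)`-stable `𝒪_L`-lattice. -/
theorem statement10 (p : ℕ) [Fact p.Prime] (L : Type) [NontriviallyNormedField L]
    [NormedAlgebra ℚ_[p] L] [FiniteDimensional ℚ_[p] L] [IsUltrametricDist L]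
    (k : ℕ) (α β : L) (h : Hyps p L k α β) :
    (α ≠ (p : L) * β →
      ((∃ f : ℚ_[p] → L, MemB p L k α β f ∧ ¬ MemLalpha p L k α β f) ↔
        ∃ Λ : Set (ℚ_[p] → L), IsLatticeStable p L k α β Λ) ∧
      ((∃ f : ℚ_[p] → L, MemB p L k β α f ∧ ¬ MemLalpha p L k β α f) ↔
        ∃ Λ : Set (ℚ_[p] → L), IsLatticeStable p L k β α Λ)) ∧
    (α = (p : L) * β →
      ((∃ f : ℚ_[p] → L, MemB p L k α β f ∧ ¬ MemLalpha p L k α β f) ↔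
        ∃ Λ : Set (ℚ_[p] → L), IsLatticeStable p L k α β Λ)) := by
  have : CompleteSpace L := FiniteDimensional.complete ℚ_[p] L
  obtain ⟨hk, -, hα, hβ, hsum, hle⟩ := h
  have hα0 := ne_zero_of_valL_pos hα
  have hβ0 := ne_zero_of_valL_pos hβ
  have hmain := (data_of_valL hk hα hβ hsum).exists_not_memLalpha_iff (by
    rw [Ne, div_eq_one_iff_eq hβ0]
    intro h1
    have h2 := valL_mul_p (p := p) hα0
    rw [h1] at h2
    linarith)
  refine ⟨fun hne => ⟨hmain, ?_⟩, fun _ => hmain⟩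
  refine (data_of_valL hk hβ hα (by rw [add_comm]; exact hsum)).exists_not_memLalpha_iff ?_
  rw [Ne, div_eq_one_iff_eq hα0, mul_comm]
  exact fun h1 => hne h1.symm

end Paper

end
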